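/- arXiv:1312.6418 — 6 statements merged into one kernel-verified Lean document; each statement's English description precedes it below -/
import Mathlib

section
/- Let ℓ ≥ 5 be a prime. Let E be a group and π : E → PGL₂(F_ℓ) a surjective group homomorphism whose kernel has order 2 and is contained in the center of E. Assume: (a) E has exactly one subgroup of index 2; and (b) there exists an element e ∈ E of order 2 with π(e) equal to the class of the matrix diag(1,−1) in PGL₂(F_ℓ). Then there exists a group isomorphism φ : E → GL₂(F_ℓ)/Z₁ such that q ∘ φ = π; in particular E ≅ GL₂(F_ℓ)/Z₁ as an extension of PGL₂(F_ℓ) by a group of order 2. -/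
open Matrix


/-- The embedding of scalars `F_ℓ^* → GL₂(F_ℓ)`, sending `s` to the scalar matrix `s·I`. -/
noncomputable def scalarGL (ℓ : ℕ) [Fact ℓ.Prime] : (ZMod ℓ)ˣ →* GL (Fin 2) (ZMod ℓ) :=
  Units.map (Matrix.scalar (Fin 2)).toMonoidHom

lemma scalarGL_mem_center (ℓ : ℕ) [Fact ℓ.Prime] (s : (ZMod ℓ)ˣ) :
    scalarGL ℓ s ∈ Subgroup.center (GL (Fin 2) (ZMod ℓ)) := by
  rw [Subgroup.mem_center_iff]
  intro g
  ext : 1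
  simp only [Units.val_mul, scalarGL, Units.coe_map, RingHom.toMonoidHom_eq_coe,
    MonoidHom.coe_coe]
  exact (Matrix.scalar_commute ((s : ZMod ℓ)) (fun r => Commute.all _ _) g.val).symm

/-- The central subgroup `Z₁ = {λ·I : λ a nonzero square in F_ℓ}` of `GL₂(F_ℓ)`. -/
noncomputable def sqScalarSubgroup (ℓ : ℕ) [Fact ℓ.Prime] :
    Subgroup (GL (Fin 2) (ZMod ℓ)) :=
  (MonoidHom.range (powMonoidHom 2 : (ZMod ℓ)ˣ →* (ZMod ℓ)ˣ)).map (scalarGL ℓ)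

instance (ℓ : ℕ) [Fact ℓ.Prime] : (sqScalarSubgroup ℓ).Normal := by
  constructor
  intro n hn g
  have hcen : n ∈ Subgroup.center (GL (Fin 2) (ZMod ℓ)) := by
    obtain ⟨s, _, rfl⟩ := hn
    exact scalarGL_mem_center ℓ s
  have h := (Subgroup.mem_center_iff.mp hcen) g
  have : g * n * g⁻¹ = n := by rw [h, mul_assoc, mul_inv_cancel, mul_one]
  rwa [this]

lemma sqScalarSubgroup_le_center (ℓ : ℕ) [Fact ℓ.Prime] :
    sqScalarSubgroup ℓ ≤ Subgroup.center (GL (Fin 2) (ZMod ℓ)) := by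
  rintro n ⟨s, _, rfl⟩
  exact scalarGL_mem_center ℓ s

/-- The natural projection `q : GL₂(F_ℓ)/Z₁ → PGL₂(F_ℓ)` (whose kernel has order 2). -/
noncomputable def qProj (ℓ : ℕ) [Fact ℓ.Prime] :
    (GL (Fin 2) (ZMod ℓ) ⧸ sqScalarSubgroup ℓ) →*
      (GL (Fin 2) (ZMod ℓ) ⧸ Subgroup.center (GL (Fin 2) (ZMod ℓ))) :=
  QuotientGroup.map _ _ (MonoidHom.id _) (sqScalarSubgroup_le_center ℓ)

/-- The class of the diagonal matrix `diag(1, -1)` in `GL₂(R)`. -/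
noncomputable def diagOneNegOne (R : Type*) [CommRing R] : GL (Fin 2) R :=
  ⟨Matrix.diagonal ![1, -1], Matrix.diagonal ![1, -1],
    by
      rw [Matrix.diagonal_mul_diagonal]
      convert Matrix.diagonal_one using 2
      funext i
      fin_cases i <;> simp,
    by
      rw [Matrix.diagonal_mul_diagonal]
      convert Matrix.diagonal_one using 2
      funext i
      fin_cases i <;> simp⟩


def matU {F : Type*} [Field F] (a : F) : GL (Fin 2) F :=
  ⟨!![1, a; 0, 1], !![1, -a; 0, 1], by ext i j; fin_cases i <;> fin_cases j <;> simp [Matrix.mul_apply, Fin.sum_univ_two],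
    by ext i j; fin_cases i <;> fin_cases j <;> simp [Matrix.mul_apply, Fin.sum_univ_two]⟩

def matD {F : Type*} [Field F] (p q : Fˣ) : GL (Fin 2) F :=
  ⟨!![(p : F), 0; 0, (q : F)], !![((p⁻¹ : Fˣ) : F), 0; 0, ((q⁻¹ : Fˣ) : F)],
    by ext i j; fin_cases i <;> fin_cases j <;> simp [Matrix.mul_apply, Fin.sum_univ_two],
    by ext i j; fin_cases i <;> fin_cases j <;> simp [Matrix.mul_apply, Fin.sum_univ_two]⟩

def matW {F : Type*} [Field F] : GL (Fin 2) F :=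
  ⟨!![0, 1; -1, 0], !![0, -1; 1, 0], by ext i j; fin_cases i <;> fin_cases j <;> simp [Matrix.mul_apply, Fin.sum_univ_two],
    by ext i j; fin_cases i <;> fin_cases j <;> simp [Matrix.mul_apply, Fin.sum_univ_two]⟩

section
variable {F : Type*} [Field F]

lemma val_matU (a : F) : (matU a).val = !![1, a; 0, 1] := rfl
lemma val_matD (p q : Fˣ) : (matD p q).val = !![(p : F), 0; 0, (q : F)] := rfl
lemma val_matW : (matW (F := F)).val = !![0, 1; -1, 0] := rfl

lemma matU_add (a b : F) : matU (a + b) = matU a * matU b := by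
  apply Units.ext
  simp only [Units.val_mul, val_matU, val_matD, val_matW, Matrix.mul_fin_two]
  ext i j; fin_cases i <;> fin_cases j <;> simp <;> ring

lemma matD_mul (p q p' q' : Fˣ) : matD (p * p') (q * q') = matD p q * matD p' q' := by
  apply Units.ext
  simp only [Units.val_mul, val_matU, val_matD, val_matW, Matrix.mul_fin_two]
  ext i j; fin_cases i <;> fin_cases j <;> simp

lemma matD_matU (p q : Fˣ) (a : F) :
    matD p q * matU a = matU ((p : F) * (q : F)⁻¹ * a) * matD p q := by
  have := q.ne_zero
  apply Units.ext
  simp only [Units.val_mul, val_matU, val_matD, val_matW, Matrix.mul_fin_two]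
  ext i j; fin_cases i <;> fin_cases j <;> simp; field_simp

lemma matW_matD (p q : Fˣ) : matW * matD p q = matD q p * matW := by
  apply Units.ext
  simp only [Units.val_mul, val_matU, val_matD, val_matW, Matrix.mul_fin_two]
  ext i j; fin_cases i <;> fin_cases j <;> simp

lemma matW_matW : matW * matW = matD (-1 : Fˣ) (-1) := by
  apply Units.ext
  simp only [Units.val_mul, val_matU, val_matD, val_matW, Matrix.mul_fin_two]
  ext i j; fin_cases i <;> fin_cases j <;> simp

lemma matR (r : Fˣ) : matW * matU (r : F) * matW =
    matU (-(r : F)⁻¹) * matW * matD (-r) (-r⁻¹) * matU (-(r : F)⁻¹) := by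
  have := r.ne_zero
  apply Units.ext
  simp only [Units.val_mul, val_matU, val_matD, val_matW, Matrix.mul_fin_two]
  ext i j; fin_cases i <;> fin_cases j <;> simp <;> field_simp

lemma mat_decomp (g : GL (Fin 2) F) : (∃ b p q, g = matU b * matD p q) ∨
    (∃ r p q s, g = matU r * matW * matD p q * matU s) := by
  have hdet : g.val.det ≠ 0 := ((Matrix.isUnit_iff_isUnit_det _).mp g.isUnit).ne_zero
  rw [Matrix.det_fin_two] at hdet
  by_cases hc : g.val 1 0 = 0
  · left
    rw [hc] at hdet
    have ha : g.val 0 0 ≠ 0 := by intro h; simp [h] at hdet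
    have hd : g.val 1 1 ≠ 0 := by intro h; simp [h] at hdet
    refine ⟨g.val 0 1 / g.val 1 1, Units.mk0 _ ha, Units.mk0 _ hd, ?_⟩
    apply Units.ext
    simp only [Units.val_mul, val_matU, val_matD, val_matW, Matrix.mul_fin_two]
    ext i j; fin_cases i <;> fin_cases j <;> simp [hc]; field_simp
  · right
    refine ⟨g.val 0 0 / g.val 1 0, Units.mk0 (-g.val 1 0) (neg_ne_zero.mpr hc),
      Units.mk0 (-(g.val 0 0 * g.val 1 1 - g.val 0 1 * g.val 1 0) / g.val 1 0)
        (div_ne_zero (neg_ne_zero.mpr hdet) hc), g.val 1 1 / g.val 1 0, ?_⟩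
    apply Units.ext
    simp only [Units.val_mul, val_matU, val_matD, val_matW, Matrix.mul_fin_two]
    ext i j; fin_cases i <;> fin_cases j <;> simp <;> field_simp; try ring

variable {E : Type*} [Group E]

def LiftRel (x : F → E) (T : Fˣ → Fˣ → E) (w : E) (g : GL (Fin 2) F) (e : E) : Prop :=
  (∃ b p q, g = matU b * matD p q ∧ e = x b * T p q) ∨
  (∃ r p q s, g = matU r * matW * matD p q * matU s ∧ e = x r * w * T p q * x s)

lemma LiftRel.unique {x : F → E} {T : Fˣ → Fˣ → E} {w : E} {g : GL (Fin 2) F} {e e' : E}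
    (h : LiftRel x T w g e) (h' : LiftRel x T w g e') : e = e' := by
  rcases h with ⟨b, p, q, rfl, rfl⟩ | ⟨r, p, q, s, rfl, rfl⟩ <;>
  rcases h' with ⟨b', p', q', h, rfl⟩ | ⟨r', p', q', s', h, rfl⟩ <;>
  have h := congrArg Units.val h <;>
  simp only [Units.val_mul, val_matU, val_matD, val_matW, Matrix.mul_fin_two] at h <;>
  have h00 := congrFun (congrFun h 0) 0 <;>
  have h01 := congrFun (congrFun h 0) 1 <;>
  have h10 := congrFun (congrFun h 1) 0 <;>
  have h11 := congrFun (congrFun h 1) 1 <;>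
  simp at h00 h01 h10 h11
  · obtain rfl := Units.ext h00
    obtain rfl := Units.ext h11
    simp at h01
    rw [h01]
  · obtain rfl := Units.ext h10
    simp at h00 h11
    subst h00
    subst h11
    simp at h01
    obtain rfl := Units.ext h01
    rfl

lemma LiftRel.total (x : F → E) (T : Fˣ → Fˣ → E) (w : E) (g : GL (Fin 2) F) :
    ∃ e, LiftRel x T w g e := by
  rcases mat_decomp g with ⟨b, p, q, h⟩ | ⟨r, p, q, s, h⟩
  · exact ⟨_, Or.inl ⟨b, p, q, h, rfl⟩⟩
  · exact ⟨_, Or.inr ⟨r, p, q, s, h, rfl⟩⟩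

/-- relations package -/
structure LiftData (x : F → E) (T : Fˣ → Fˣ → E) (w : E) : Prop where
  x_add : ∀ a b, x (a + b) = x a * x b
  T_mul : ∀ p q p' q', T (p * p') (q * q') = T p q * T p' q'
  T_x : ∀ (p q : Fˣ) (a : F), T p q * x a = x ((p : F) * (q : F)⁻¹ * a) * T p q
  w_T : ∀ p q, w * T p q = T q p * w
  w_w : w * w = T (-1) (-1)
  rel : ∀ r : Fˣ, w * x r * w = x (-(r : F)⁻¹) * w * T (-r) (-r⁻¹) * x (-(r : F)⁻¹)

variable {x : F → E} {T : Fˣ → Fˣ → E} {w : E}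

lemma LiftRel.matU_mul (D : LiftData x T w) (a : F) {g : GL (Fin 2) F} {e : E}
    (h : LiftRel x T w g e) : LiftRel x T w (matU a * g) (x a * e) := by
  rcases h with ⟨b, p, q, rfl, rfl⟩ | ⟨r, p, q, s, rfl, rfl⟩
  · exact Or.inl ⟨a + b, p, q, by rw [matU_add, mul_assoc], by rw [D.x_add, mul_assoc]⟩
  · exact Or.inr ⟨a + r, p, q, s, by simp only [matU_add, mul_assoc],
      by simp only [D.x_add, mul_assoc]⟩

lemma LiftRel.matD_mul (D : LiftData x T w) (p q : Fˣ) {g : GL (Fin 2) F} {e : E}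
    (h : LiftRel x T w g e) : LiftRel x T w (matD p q * g) (T p q * e) := by
  rcases h with ⟨b, p', q', rfl, rfl⟩ | ⟨r, p', q', s, rfl, rfl⟩
  · refine Or.inl ⟨(p : F) * (q : F)⁻¹ * b, p * p', q * q', ?_, ?_⟩
    · rw [← mul_assoc, matD_matU, _root_.matD_mul, mul_assoc]
    · rw [← mul_assoc, D.T_x, D.T_mul, mul_assoc]
  · refine Or.inr ⟨(p : F) * (q : F)⁻¹ * r, q * p', p * q', s, ?_, ?_⟩
    · rw [_root_.matD_mul]
      simp only [← mul_assoc]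
      rw [matD_matU, mul_assoc _ matW (matD q p), matW_matD]
      simp only [← mul_assoc]
    · rw [D.T_mul]
      simp only [← mul_assoc]
      rw [D.T_x, mul_assoc _ w (T q p), D.w_T]
      simp only [← mul_assoc]

lemma LiftRel.matW_mul (D : LiftData x T w) {g : GL (Fin 2) F} {e : E}
    (h : LiftRel x T w g e) : LiftRel x T w (matW * g) (w * e) := by
  have hx0 : x 0 = 1 := by
    have := D.x_add 0 0
    simpa using this
  have hU0 : matU (0 : F) = 1 := by
    have := matU_add (0 : F) 0
    simpa using this
  rcases h with ⟨b, p, q, rfl, rfl⟩ | ⟨r, p, q, s, rfl, rfl⟩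
  · refine Or.inr ⟨0, p, q, (q : F) * (p : F)⁻¹ * b, ?_, ?_⟩
    · rw [hU0, one_mul, mul_assoc matW, matD_matU]
      congr 3
      have := p.ne_zero
      have := q.ne_zero
      field_simp
    · rw [hx0, one_mul, mul_assoc w, D.T_x]
      congr 3
      have := p.ne_zero
      have := q.ne_zero
      field_simp
  · by_cases hr : r = 0
    · subst hr
      refine Or.inl ⟨((-1 * p : Fˣ) : F) * ((-1 * q : Fˣ) : F)⁻¹ * s, -1 * p, -1 * q, ?_, ?_⟩
      · rw [hU0, one_mul, ← matD_matU, _root_.matD_mul, ← matW_matW]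
        simp only [mul_assoc]
      · rw [hx0, one_mul, ← D.T_x, D.T_mul, ← D.w_w]
        simp only [mul_assoc]
    · obtain ⟨r, rfl⟩ : ∃ r' : Fˣ, (r' : F) = r := ⟨Units.mk0 r hr, rfl⟩
      refine Or.inr ⟨-(r : F)⁻¹, -r * p, -r⁻¹ * q, (q : F) * (p : F)⁻¹ * (-(r : F)⁻¹) + s, ?_, ?_⟩
      · have h1 := matD_matU p q ((q : F) * (p : F)⁻¹ * (-(r : F)⁻¹))
        have h2 : (p : F) * (q : F)⁻¹ * ((q : F) * (p : F)⁻¹ * (-(r : F)⁻¹)) = -(r : F)⁻¹ := by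
          have := p.ne_zero
          have := q.ne_zero
          field_simp
        rw [h2] at h1
        calc matW * (matU (r : F) * matW * matD p q * matU s)
            = (matW * matU (r : F) * matW) * matD p q * matU s := by simp only [mul_assoc]
          _ = matU (-(r : F)⁻¹) * matW * matD (-r) (-r⁻¹) * (matU (-(r : F)⁻¹) * matD p q)
                * matU s := by rw [matR]; simp only [mul_assoc]
          _ = _ := by rw [← h1, _root_.matD_mul, matU_add]; simp only [mul_assoc]
      · have h1 := D.T_x p q ((q : F) * (p : F)⁻¹ * (-(r : F)⁻¹))
        have h2 : (p : F) * (q : F)⁻¹ * ((q : F) * (p : F)⁻¹ * (-(r : F)⁻¹)) = -(r : F)⁻¹ := by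
          have := p.ne_zero
          have := q.ne_zero
          field_simp
        rw [h2] at h1
        calc w * (x (r : F) * w * T p q * x s)
            = (w * x (r : F) * w) * T p q * x s := by simp only [mul_assoc]
          _ = x (-(r : F)⁻¹) * w * T (-r) (-r⁻¹) * (x (-(r : F)⁻¹) * T p q)
                * x s := by rw [D.rel]; simp only [mul_assoc]
          _ = _ := by rw [← h1, D.T_mul, D.x_add]; simp only [mul_assoc]

lemma LiftRel.mul (D : LiftData x T w) {g h : GL (Fin 2) F} {e f : E}
    (hg : LiftRel x T w g e) (hh : LiftRel x T w h f) : LiftRel x T w (g * h) (e * f) := by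
  rcases hg with ⟨b, p, q, rfl, rfl⟩ | ⟨r, p, q, s, rfl, rfl⟩
  · simp only [mul_assoc]
    exact ((hh.matD_mul D p q).matU_mul D b)
  · simp only [mul_assoc]
    exact (((hh.matU_mul D s).matD_mul D p q).matW_mul D).matU_mul D r

lemma exists_liftHom (D : LiftData x T w) : ∃ Φ : GL (Fin 2) F →* E,
    ∀ g, LiftRel x T w g (Φ g) := by
  choose f hf using LiftRel.total x T w
  exact ⟨MonoidHom.mk' f fun g h => (hf (g * h)).unique ((hf g).mul D (hf h)), hf⟩

end

section
variable {F : Type*} [Field F]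

lemma mem_center_GL_iff (g : GL (Fin 2) F) :
    g ∈ Subgroup.center (GL (Fin 2) F) ↔ ∃ a, g = matD a a := by
  constructor
  · intro h
    rw [Subgroup.mem_center_iff] at h
    have h1 := h (matU 1)
    have h2 := h matW
    rcases mat_decomp g with ⟨b, p, q, rfl⟩ | ⟨r, p, q, s, rfl⟩
    · have h1 := congrArg Units.val h1
      have h2 := congrArg Units.val h2
      simp only [Units.val_mul, val_matU, val_matD, val_matW, Matrix.mul_fin_two] at h1 h2
      have h10 := congrFun (congrFun h2 1) 1
      have h01 := congrFun (congrFun h1 0) 1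
      simp at h10 h01
      have hpq : q = p := by
        apply Units.ext
        subst h10
        simpa using h01
      subst hpq
      subst h10
      refine ⟨q, ?_⟩
      have hU0 : matU (0 : F) = 1 := by
        have := matU_add (0 : F) 0
        simpa using this
      rw [hU0, one_mul]
    · exfalso
      have h1 := congrArg Units.val h1
      simp only [Units.val_mul, val_matU, val_matD, val_matW, Matrix.mul_fin_two] at h1
      have h00 := congrFun (congrFun h1 0) 0
      simp at h00
  · rintro ⟨a, rfl⟩
    rw [Subgroup.mem_center_iff]
    intro g
    apply Units.ext
    rw [Units.val_mul, Units.val_mul, Matrix.eta_fin_two g.val, val_matD, Matrix.mul_fin_two,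
      Matrix.mul_fin_two]
    ext i j; fin_cases i <;> fin_cases j <;> simp [mul_comm]

lemma matU_pow (n : ℕ) : matU (1 : F) ^ n = matU (n : F) := by
  induction n with
  | zero =>
    have := matU_add (0 : F) 0
    have h0 : matU (0 : F) = 1 := by simpa using this
    rw [pow_zero, Nat.cast_zero, h0]
  | succ n ih => rw [pow_succ, ih, Nat.cast_succ, matU_add]

lemma matD_one : matD (1 : Fˣ) 1 = 1 := by
  have := matD_mul (1 : Fˣ) 1 1 1
  simpa using this

lemma mk_eq_of {g h : GL (Fin 2) F} (a : Fˣ) (H : h = g * matD a a) :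
    (QuotientGroup.mk g : GL (Fin 2) F ⧸ Subgroup.center (GL (Fin 2) F)) = QuotientGroup.mk h := by
  rw [QuotientGroup.eq]
  rw [H, inv_mul_cancel_left, mem_center_GL_iff]
  exact ⟨a, rfl⟩

lemma det_matD (p q : Fˣ) : Matrix.GeneralLinearGroup.det (matD p q) = p * q := by
  apply Units.ext
  rw [Matrix.GeneralLinearGroup.val_det_apply, val_matD, Matrix.det_fin_two_of, Units.val_mul,
    mul_zero, sub_zero]

lemma matW_conj (q : Fˣ) : matW * matD q 1 * matW⁻¹ = matD 1 q := by
  rw [matW_matD, mul_inv_cancel_right]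

lemma matUWU : matU (1 : F) * matW * matU 1 * matW⁻¹ * matU 1 = matW := by
  have h : (matW : GL (Fin 2) F)⁻¹ = matW * matD (-1) (-1) := by
    rw [inv_eq_iff_mul_eq_one, ← mul_assoc, matW_matW, ← matD_mul]
    simp [matD_one]
  rw [h]
  apply Units.ext
  simp only [Units.val_mul, val_matU, val_matD, val_matW, Matrix.mul_fin_two]
  ext i j; fin_cases i <;> fin_cases j <;> simp
end

lemma exists_lift_PGL
    (ℓ : ℕ) [Fact ℓ.Prime] (h5 : 5 ≤ ℓ) (E : Type*) [Group E]
    (π : E →* GL (Fin 2) (ZMod ℓ) ⧸ Subgroup.center (GL (Fin 2) (ZMod ℓ)))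
    (hsurj : Function.Surjective π)
    (hker2 : Nat.card π.ker = 2)
    (hcentral : π.ker ≤ Subgroup.center E)
    (he : ∃ e : E, orderOf e = 2 ∧ π e = QuotientGroup.mk (diagOneNegOne (ZMod ℓ))) :
    ∃ Φ : GL (Fin 2) (ZMod ℓ) →* E, ∀ g, π (Φ g) = QuotientGroup.mk g := by
  have hprime : ℓ.Prime := Fact.out
  have hodd : Odd ℓ := hprime.odd_of_ne_two (by omega)
  have hsq : ∀ k, π k = 1 → k * k = 1 := by
    intro k hk
    have := pow_card_eq_one' (x := (⟨k, hk⟩ : π.ker))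
    rw [hker2, sq] at this
    exact congrArg Subtype.val this
  have hcen : ∀ k, π k = 1 → ∀ e, e * k = k * e := fun k hk e =>
    Subgroup.mem_center_iff.1 (hcentral hk) e
  have hdiff : ∀ e e', π e = π e' → ∃ k, π k = 1 ∧ e' = e * k := by
    intro e e' h
    exact ⟨e⁻¹ * e', by simp [h], by simp⟩
  have hconj : ∀ e e', π e = π e' → ∀ y, e * y * e⁻¹ = e' * y * e'⁻¹ := by
    intro e e' h y
    obtain ⟨k, hk, rfl⟩ := hdiff e e' h
    have := hcen k hk y
    rw [mul_assoc e k y, ← this]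
    group
  have huniq : ∀ e e', π e = π e' → e ^ ℓ = 1 → e' ^ ℓ = 1 → e = e' := by
    intro e e' h h1 h2
    obtain ⟨k, hk, rfl⟩ := hdiff e e' h
    have hc : Commute e k := hcen k hk e
    rw [hc.mul_pow, h1, one_mul] at h2
    obtain ⟨m, hm⟩ := hodd
    rw [hm, pow_succ, pow_mul, sq, hsq k hk, one_pow, one_mul] at h2
    rw [h2, mul_one]
  -- unipotent part
  obtain ⟨x, hx_add, hx_pow, hx_pi⟩ : ∃ x : ZMod ℓ → E, (∀ a b, x (a + b) = x a * x b) ∧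
      (∀ a, x a ^ ℓ = 1) ∧ ∀ a, π (x a) = QuotientGroup.mk (matU a) := by
    obtain ⟨e₁, he₁⟩ := hsurj (QuotientGroup.mk (matU 1))
    have hUl : matU (1 : ZMod ℓ) ^ ℓ = 1 := by
      rw [matU_pow, ZMod.natCast_self]
      have := matU_add (0 : ZMod ℓ) 0
      simpa using this
    have hk : π (e₁ ^ ℓ) = 1 := by
      rw [map_pow, he₁, ← QuotientGroup.mk_pow, hUl, QuotientGroup.mk_one]
    have hx1 : (e₁ ^ (ℓ + 1)) ^ ℓ = 1 := by
      rw [← pow_mul, mul_comm, pow_mul]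
      obtain ⟨m, hm⟩ := hodd
      have : ℓ + 1 = 2 * (m + 1) := by omega
      rw [this, pow_mul, sq, hsq _ hk, one_pow]
    have hpx1 : π (e₁ ^ (ℓ + 1)) = QuotientGroup.mk (matU 1) := by
      rw [pow_succ, map_mul, hk, one_mul, he₁]
    refine ⟨fun a => (e₁ ^ (ℓ + 1)) ^ a.val, ?_, ?_, ?_⟩
    · intro a b
      simp only
      rw [ZMod.val_add, ← pow_eq_pow_mod _ hx1, pow_add]
    · intro a
      simp only
      rw [← pow_mul, mul_comm, pow_mul, hx1, one_pow]
    · intro a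
      simp only
      rw [map_pow, hpx1, ← QuotientGroup.mk_pow, matU_pow, ZMod.natCast_zmod_val]
  -- torus part
  obtain ⟨d, hd_pi⟩ : ∃ d : (ZMod ℓ)ˣ →* E, ∀ t, π (d t) = QuotientGroup.mk (matD t 1) := by
    obtain ⟨g, hg⟩ := IsCyclic.exists_generator (α := (ZMod ℓ)ˣ)
    obtain ⟨τ, hτ⟩ := hsurj (QuotientGroup.mk (matD g 1))
    have hord : orderOf g = ℓ - 1 := by
      rw [orderOf_eq_card_of_forall_mem_zpowers hg, Nat.card_eq_fintype_card, ZMod.card_units]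
    have hDpow : ∀ n : ℕ, matD g 1 ^ n = matD (g ^ n) 1 := by
      intro n
      induction n with
      | zero => simp [matD_one]
      | succ n ih => rw [pow_succ, ih, pow_succ, ← matD_mul, one_mul]
    obtain ⟨m, hm⟩ := hodd
    have hgm : g ^ m = -1 := by
      have h1 : (g ^ m) ^ 2 = 1 := by
        rw [← pow_mul, show m * 2 = orderOf g by omega, pow_orderOf_eq_one]
      have h2 : g ^ m ≠ 1 := pow_ne_one_of_lt_orderOf (by omega) (by omega)
      have h3 : ((g ^ m : (ZMod ℓ)ˣ) : ZMod ℓ) ^ 2 = 1 := by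
        rw [← Units.val_pow_eq_pow_val, h1, Units.val_one]
      rcases (mul_self_eq_one_iff.1 ((sq _).symm.trans h3)) with h | h
      · exact absurd (Units.ext h) h2
      · exact Units.ext (by simpa using h)
    have hτ' : τ ^ (ℓ - 1) = 1 := by
      obtain ⟨e, heo, hepi⟩ := he
      have h1 : π e = π (τ ^ m) := by
        rw [hepi, map_pow, hτ, ← QuotientGroup.mk_pow, hDpow, hgm]
        apply mk_eq_of (-1)
        apply Units.ext
        have : (diagOneNegOne (ZMod ℓ)).val = Matrix.diagonal ![1, -1] := rfl
        rw [Units.val_mul, this]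
        simp only [val_matD]
        ext i j; fin_cases i <;> fin_cases j <;> simp [Matrix.mul_apply, Fin.sum_univ_two]
      obtain ⟨k, hk, h2⟩ := hdiff _ _ h1
      have hc : Commute e k := hcen k hk e
      rw [show ℓ - 1 = m * 2 by omega, pow_mul, h2, hc.mul_pow, ← heo, pow_orderOf_eq_one, heo,
        sq, hsq k hk, one_mul]
    refine ⟨monoidHomOfForallMemZpowers hg (g' := τ) (by rw [hord]; exact orderOf_dvd_of_pow_eq_one hτ'), ?_⟩
    intro t
    obtain ⟨n, rfl⟩ := (mem_powers_iff_mem_zpowers.2 (hg t))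
    simp only
    rw [map_pow, monoidHomOfForallMemZpowers_apply_gen, map_pow, hτ, ← QuotientGroup.mk_pow, hDpow]
  -- Weyl element
  obtain ⟨w, hw_pi, hw_eq⟩ : ∃ w : E, π w = QuotientGroup.mk matW ∧
      w = x 1 * (w * x 1 * w⁻¹) * x 1 := by
    obtain ⟨v, hv⟩ := hsurj (QuotientGroup.mk matW)
    have hw : π (x 1 * (v * x 1 * v⁻¹) * x 1) = QuotientGroup.mk matW := by
      simp only [map_mul, map_inv, hv, hx_pi, ← QuotientGroup.mk_mul, ← QuotientGroup.mk_inv]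
      congr 1
      refine Eq.trans ?_ matUWU
      simp only [mul_assoc]
    refine ⟨_, hw, ?_⟩
    rw [← hconj v _ (hv.trans hw.symm)]
  have hx0 : x 0 = 1 := by
    have := hx_add 0 0
    simpa using this
  have hxneg : ∀ a, x (-a) = (x a)⁻¹ := by
    intro a
    rw [eq_inv_iff_mul_eq_one, ← hx_add]
    simpa using hx0
  have hww : π (w * w) = 1 := by
    rw [map_mul, hw_pi, ← QuotientGroup.mk_mul, matW_matW, QuotientGroup.eq_one_iff,
      mem_center_GL_iff]
    exact ⟨_, rfl⟩
  have hR1 : w * x 1 * w⁻¹ = x (-1) * w * x (-1) := by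
    rw [hxneg]
    nth_rw 3 [hw_eq]
    group
  obtain ⟨T, hT⟩ : ∃ T : (ZMod ℓ)ˣ → (ZMod ℓ)ˣ → E, ∀ p q, T p q = d p * (w * d q * w⁻¹) :=
    ⟨_, fun _ _ => rfl⟩
  have hT1 : ∀ p, T p 1 = d p := by intro p; simp [hT]
  have hTpi : ∀ p q, π (T p q) = QuotientGroup.mk (matD p q) := by
    intro p q
    rw [hT]
    simp only [map_mul, map_inv, hw_pi, hd_pi, ← QuotientGroup.mk_mul, ← QuotientGroup.mk_inv]
    rw [matW_conj, ← matD_mul, one_mul, mul_one]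
  have hcomm : ∀ p q, (w * d q * w⁻¹) * d p = d p * (w * d q * w⁻¹) := by
    intro p q
    rw [← mul_inv_eq_iff_eq_mul]
    rw [hconj (w * d q * w⁻¹) (d q)⁻¹]
    · rw [← map_inv, ← map_mul, ← map_inv, ← map_mul]
      congr 1
      rw [mul_comm q⁻¹, mul_assoc, mul_inv_cancel, mul_one]
    · simp only [map_mul, map_inv, hw_pi, hd_pi, ← QuotientGroup.mk_mul, ← QuotientGroup.mk_inv]
      rw [matW_conj]
      apply mk_eq_of q⁻¹
      rw [inv_eq_iff_mul_eq_one, ← mul_assoc, ← matD_mul, ← matD_mul]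
      simp [matD_one]
  have T_mul : ∀ p q p' q', T (p * p') (q * q') = T p q * T p' q' := by
    intro p q p' q'
    simp only [hT]
    calc _ = d p * (d p' * (w * d q * w⁻¹)) * (w * d q' * w⁻¹) := by
          rw [map_mul, map_mul]; group
      _ = _ := by rw [← hcomm]; group
  have T_x : ∀ (p q : (ZMod ℓ)ˣ) (a : ZMod ℓ),
      T p q * x a = x ((p : ZMod ℓ) * (q : ZMod ℓ)⁻¹ * a) * T p q := by
    intro p q a
    rw [← mul_inv_eq_iff_eq_mul]
    apply huniq
    · simp only [map_mul, map_inv, hTpi, hx_pi, ← QuotientGroup.mk_mul, ← QuotientGroup.mk_inv]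
      rw [matD_matU, mul_inv_cancel_right]
    · rw [conj_pow, hx_pow]; simp
    · apply hx_pow
  have w_T : ∀ p q, w * T p q = T q p * w := by
    intro p q
    have h := hconj (w * w) 1 (by simpa using hww) (d q)
    rw [hT, hT, ← hcomm]
    calc _ = (w * w * d q * (w * w)⁻¹) * w * d p := by group
      _ = _ := by rw [h]; group
  have w_w : w * w = T (-1) (-1) := by
    have hd2 : d (-1) * d (-1) = 1 := by rw [← map_mul]; simp
    have hdi : (d (-1))⁻¹ = d (-1) := inv_eq_of_mul_eq_one_left hd2
    have hdx : ∀ a, d (-1) * x a = x (-a) * d (-1) := by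
      intro a
      rw [← hT1, T_x]
      simp
    have h1 : d (-1) * w * (d (-1))⁻¹ = w⁻¹ := by
      have h2 : d (-1) * (w * x 1 * w⁻¹) * (d (-1))⁻¹ = w * x (-1) * w⁻¹ := by
        have h3 := hconj (d (-1) * w) (w * d (-1)) ?_ (x 1)
        · calc _ = d (-1) * w * x 1 * (d (-1) * w)⁻¹ := by group
            _ = w * (d (-1) * x 1) * (d (-1))⁻¹ * w⁻¹ := by rw [h3]; group
            _ = _ := by rw [hdx]; group
        · simp only [map_mul, hw_pi, hd_pi, ← QuotientGroup.mk_mul]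
          rw [matW_matD]
          apply mk_eq_of (-1)
          apply Units.ext
          simp only [Units.val_mul, val_matU, val_matD, val_matW, Matrix.mul_fin_two]
          ext i j; fin_cases i <;> fin_cases j <;> simp
      have h4 : d (-1) * x 1 * (d (-1))⁻¹ = x (-1) := by rw [hdx, mul_inv_cancel_right]
      calc d (-1) * w * (d (-1))⁻¹
          = d (-1) * (x 1 * (w * x 1 * w⁻¹) * x 1) * (d (-1))⁻¹ := by rw [← hw_eq]
        _ = (d (-1) * x 1 * (d (-1))⁻¹) * (d (-1) * (w * x 1 * w⁻¹) * (d (-1))⁻¹) *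
              (d (-1) * x 1 * (d (-1))⁻¹) := by group
        _ = (x 1 * (w * x 1 * w⁻¹) * x 1)⁻¹ := by rw [h4, h2, hxneg]; group
        _ = w⁻¹ := by rw [← hw_eq]
    rw [hT]
    calc w * w = (w * w)⁻¹ := (inv_eq_of_mul_eq_one_left (hsq _ hww)).symm
      _ = w⁻¹ * w⁻¹ := by group
      _ = d (-1) * w * (d (-1))⁻¹ * w⁻¹ := by rw [h1]
      _ = _ := by rw [hdi]; group
  have rel : ∀ r : (ZMod ℓ)ˣ, w * x r * w =
      x (-(r : ZMod ℓ)⁻¹) * w * T (-r) (-r⁻¹) * x (-(r : ZMod ℓ)⁻¹) := by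
    intro r
    have hr := r.ne_zero
    have hdx : ∀ a, d r⁻¹ * x a * (d r⁻¹)⁻¹ = x ((r : ZMod ℓ)⁻¹ * a) := by
      intro a
      rw [← hT1, T_x, mul_inv_cancel_right, Units.val_one, inv_one, mul_one,
        Units.val_inv_eq_inv_val]
    have hc : d r⁻¹ * w * (d r⁻¹)⁻¹ = w * T r r⁻¹ := by
      rw [w_T, hT, ← map_inv, inv_inv]
      group
    have h2 : w * x r * w⁻¹ = x (-(r : ZMod ℓ)⁻¹) * (w * T r r⁻¹) * x (-(r : ZMod ℓ)⁻¹) := by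
      calc w * x r * w⁻¹ = w * (T r r⁻¹ * x ((r : ZMod ℓ)⁻¹)) * (T r r⁻¹)⁻¹ * w⁻¹ := by
            have h3 : (r : ZMod ℓ) * ((r⁻¹ : (ZMod ℓ)ˣ) : ZMod ℓ)⁻¹ * (r : ZMod ℓ)⁻¹ = r := by
              rw [Units.val_inv_eq_inv_val, inv_inv, mul_assoc, mul_inv_cancel₀ hr, mul_one]
            rw [T_x, h3]
            group
        _ = (w * T r r⁻¹) * x ((r : ZMod ℓ)⁻¹ * 1) * (w * T r r⁻¹)⁻¹ := by rw [mul_one]; group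
        _ = d r⁻¹ * (w * x 1 * w⁻¹) * (d r⁻¹)⁻¹ := by rw [← hc, ← hdx]; group
        _ = (d r⁻¹ * x (-1) * (d r⁻¹)⁻¹) * (d r⁻¹ * w * (d r⁻¹)⁻¹) *
              (d r⁻¹ * x (-1) * (d r⁻¹)⁻¹) := by rw [hR1]; group
        _ = _ := by rw [hc, hdx, mul_neg, mul_one]
    calc w * x r * w = (w * x r * w⁻¹) * (w * w) := by group
      _ = x (-(r : ZMod ℓ)⁻¹) * (w * T r r⁻¹) * ((w * w) * x (-(r : ZMod ℓ)⁻¹)) := by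
          rw [h2, ← hcen _ hww]; group
      _ = x (-(r : ZMod ℓ)⁻¹) * w * (T r r⁻¹ * T (-1) (-1)) * x (-(r : ZMod ℓ)⁻¹) := by
          rw [w_w]; group
      _ = _ := by rw [← T_mul, mul_neg_one, mul_neg_one]
  obtain ⟨Φ, hΦ⟩ := exists_liftHom (x := x) (T := T) (w := w) ⟨hx_add, T_mul, T_x, w_T, w_w, rel⟩
  refine ⟨Φ, fun g => ?_⟩
  rcases hΦ g with ⟨b, p, q, h1, h2⟩ | ⟨r, p, q, s, h1, h2⟩
  · rw [h2, h1]
    simp only [map_mul, hx_pi, hTpi, ← QuotientGroup.mk_mul]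
  · rw [h2, h1]
    simp only [map_mul, hx_pi, hTpi, hw_pi, ← QuotientGroup.mk_mul]

/-- Let `ℓ ≥ 5` be a prime, `E` a group, and `π : E → PGL₂(F_ℓ)` a
surjective homomorphism whose kernel has order 2 and is contained in the center of `E`.
If `E` has exactly one subgroup of index 2, and some element `e ∈ E` of order 2 maps to
the class of `diag(1, -1)`, then there is an isomorphism `φ : E ≃ GL₂(F_ℓ)/Z₁` with
`q ∘ φ = π`; in particular `E ≅ GL₂(F_ℓ)/Z₁` as an extension of `PGL₂(F_ℓ)` by a group
of order 2. -/
theorem central_extension_iso_GL_mod_squares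
    (ℓ : ℕ) [Fact ℓ.Prime] (h5 : 5 ≤ ℓ) (E : Type*) [Group E]
    (π : E →* GL (Fin 2) (ZMod ℓ) ⧸ Subgroup.center (GL (Fin 2) (ZMod ℓ)))
    (hsurj : Function.Surjective π)
    (hker2 : Nat.card π.ker = 2)
    (hcentral : π.ker ≤ Subgroup.center E)
    (huniq : ∃! H : Subgroup E, H.index = 2)
    (he : ∃ e : E, orderOf e = 2 ∧ π e = QuotientGroup.mk (diagOneNegOne (ZMod ℓ))) :
    ∃ φ : E ≃* (GL (Fin 2) (ZMod ℓ) ⧸ sqScalarSubgroup ℓ),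
      ∀ x : E, qProj ℓ (φ x) = π x := by
  classical
  obtain ⟨Φ, hΦ⟩ := exists_lift_PGL ℓ h5 E π hsurj hker2 hcentral he
  have hprime : ℓ.Prime := Fact.out
  have hodd : Odd ℓ := hprime.odd_of_ne_two (by omega)
  have hscal : ∀ a, scalarGL ℓ a = matD a a := by
    intro a
    apply Units.ext
    rw [val_matD]
    ext i j; fin_cases i <;> fin_cases j <;> simp [scalarGL]
  have hsq : ∀ k, π k = 1 → k * k = 1 := by
    intro k hk
    have := pow_card_eq_one' (x := (⟨k, hk⟩ : π.ker))
    rw [hker2, sq] at this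
    exact congrArg Subtype.val this
  obtain ⟨z, hz, hz1, hzu⟩ : ∃ z, π z = 1 ∧ z ≠ 1 ∧ ∀ k, π k = 1 → k = 1 ∨ k = z := by
    obtain ⟨y, hy, hyu⟩ := (Nat.card_eq_two_iff' (1 : π.ker)).1 hker2
    refine ⟨y, y.2, fun h => hy (Subtype.ext h), fun k hk => ?_⟩
    by_cases h : k = 1
    · exact Or.inl h
    · right
      exact congrArg Subtype.val (hyu ⟨k, hk⟩ (fun h' => h (congrArg Subtype.val h')))
  have hkerΦ : ∀ g, π (Φ g) = 1 → ∃ a, g = matD a a := by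
    intro g hg
    rwa [hΦ, QuotientGroup.eq_one_iff, mem_center_GL_iff] at hg
  have hscalker : ∀ a, π (Φ (matD a a)) = 1 := by
    intro a
    rw [hΦ, QuotientGroup.eq_one_iff, mem_center_GL_iff]
    exact ⟨a, rfl⟩
  have hSidx : (MonoidHom.range (powMonoidHom 2 : (ZMod ℓ)ˣ →* (ZMod ℓ)ˣ)).index = 2 := by
    rw [IsCyclic.index_powMonoidHom_range, Nat.card_eq_fintype_card, ZMod.card_units]
    obtain ⟨m, hm⟩ := hodd
    exact Nat.gcd_eq_right ⟨m, by omega⟩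
  have hsqker : ∀ a ∈ MonoidHom.range (powMonoidHom 2 : (ZMod ℓ)ˣ →* (ZMod ℓ)ˣ),
      Φ (matD a a) = 1 := by
    rintro _ ⟨a, rfl⟩
    simp only [powMonoidHom_apply]
    rw [sq, matD_mul, map_mul, hsq _ (hscalker a)]
  -- the scalars do not all die
  have hne : ∃ a, Φ (matD a a) ≠ 1 := by
    by_contra hall
    push Not at hall
    have hz_not : z ∉ Φ.range := by
      rintro ⟨g, rfl⟩
      obtain ⟨a, rfl⟩ := hkerΦ g hz
      exact hz1 (hall a)
    have h1 : Φ.range.index = 2 := by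
      rw [Subgroup.index_eq_two_iff]
      refine ⟨z, fun b => ?_⟩
      obtain ⟨g, hg⟩ := QuotientGroup.mk_surjective (π b)
      have hk : π ((Φ g)⁻¹ * b) = 1 := by rw [map_mul, map_inv, hΦ, hg, inv_mul_cancel]
      have hgr : Φ g ∈ Φ.range := ⟨g, rfl⟩
      rcases hzu _ hk with h | h
      · have hb : b = Φ g := by rw [inv_mul_eq_one] at h; exact h.symm
        right
        rw [hb]
        refine ⟨hgr, ?_⟩
        rw [Subgroup.mul_mem_cancel_left _ hgr]
        exact hz_not
      · have hb : b = Φ g * z := by rw [← h]; group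
        left
        rw [hb, mul_assoc, hsq z hz, mul_one, Subgroup.mul_mem_cancel_left _ hgr]
        exact ⟨hgr, hz_not⟩
    let S := MonoidHom.range (powMonoidHom 2 : (ZMod ℓ)ˣ →* (ZMod ℓ)ˣ)
    let δ : GL (Fin 2) (ZMod ℓ) →* (ZMod ℓ)ˣ ⧸ S :=
      (QuotientGroup.mk' S).comp Matrix.GeneralLinearGroup.det
    have hδ : ∀ p q, δ (matD p q) = QuotientGroup.mk (p * q) := by
      intro p q
      change QuotientGroup.mk _ = _
      congr 1
      exact det_matD p q
    have hδc : Subgroup.center (GL (Fin 2) (ZMod ℓ)) ≤ δ.ker := by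
      intro g hg
      obtain ⟨a, rfl⟩ := (mem_center_GL_iff g).1 hg
      rw [MonoidHom.mem_ker, hδ, QuotientGroup.eq_one_iff]
      exact ⟨a, by simp [sq]⟩
    let ψ := (QuotientGroup.lift _ δ hδc).comp π
    have hψ : Function.Surjective ψ := by
      intro y
      obtain ⟨a, rfl⟩ := QuotientGroup.mk_surjective y
      obtain ⟨e, he⟩ := hsurj (QuotientGroup.mk (matD a 1))
      refine ⟨e, ?_⟩
      change QuotientGroup.lift _ δ hδc (π e) = _
      rw [he, QuotientGroup.lift_mk, hδ, mul_one]
    have h2 : ψ.ker.index = 2 := by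
      rw [Subgroup.index_ker, MonoidHom.range_eq_top.2 hψ, Subgroup.card_top]
      exact hSidx
    have h12 := huniq.unique h1 h2
    apply hz_not
    rw [h12, MonoidHom.mem_ker]
    change QuotientGroup.lift _ δ hδc (π z) = _
    rw [hz, map_one]
  obtain ⟨a₀, ha₀⟩ := hne
  have hker : ∀ g, Φ g = 1 → g ∈ sqScalarSubgroup ℓ := by
    intro g hg
    obtain ⟨a, rfl⟩ := hkerΦ g (by rw [hg, map_one])
    refine ⟨a, ?_, hscal a⟩
    by_contra ha
    have ha₀' : a₀ ∉ MonoidHom.range (powMonoidHom 2 : (ZMod ℓ)ˣ →* (ZMod ℓ)ˣ) :=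
      fun h => ha₀ (hsqker _ h)
    have := hsqker (a * a₀) ((Subgroup.mul_mem_iff_of_index_two hSidx).2
      ⟨fun h => absurd h ha, fun h => absurd h ha₀'⟩)
    rw [matD_mul, map_mul, hg, one_mul] at this
    exact ha₀ this
  have hle : sqScalarSubgroup ℓ ≤ Φ.ker := by
    rintro _ ⟨a, ha, rfl⟩
    rw [MonoidHom.mem_ker, hscal]
    exact hsqker a ha
  let θ := QuotientGroup.lift _ Φ hle
  have hθ : ∀ g : GL (Fin 2) (ZMod ℓ), θ (QuotientGroup.mk g) = Φ g := fun g => rfl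
  have hbij : Function.Bijective θ := by
    constructor
    · rw [injective_iff_map_eq_one]
      intro y hy
      obtain ⟨g, rfl⟩ := QuotientGroup.mk_surjective y
      rw [QuotientGroup.eq_one_iff]
      exact hker g hy
    · intro e
      obtain ⟨g, hg⟩ := QuotientGroup.mk_surjective (π e)
      have hk : π ((Φ g)⁻¹ * e) = 1 := by rw [map_mul, map_inv, hΦ, hg, inv_mul_cancel]
      have hz0 : Φ (matD a₀ a₀) = z := (hzu _ (hscalker a₀)).resolve_left ha₀
      rcases hzu _ hk with h | h
      · exact ⟨QuotientGroup.mk g, by rw [hθ]; rwa [inv_mul_eq_one] at h⟩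
      · refine ⟨QuotientGroup.mk (g * matD a₀ a₀), ?_⟩
        rw [hθ, map_mul, hz0, ← h]
        group
  have hqθ : ∀ y, π (θ y) = qProj ℓ y := by
    intro y
    obtain ⟨g, rfl⟩ := QuotientGroup.mk_surjective y
    rw [hθ, hΦ]
    rfl
  refine ⟨(MulEquiv.ofBijective θ hbij).symm, fun e => ?_⟩
  rw [← hqθ]
  congr 1
  exact (MulEquiv.ofBijective θ hbij).apply_symm_apply e
end

section
/- For every prime ℓ ≥ 5 and every integer i ≥ 1, the second group cohomology group H²(PGL₂(F_ℓ), ℤ/2^iℤ), taken with respect to the trivial action of PGL₂(F_ℓ) on ℤ/2^iℤ, is isomorphic as an abelian group to (ℤ/2ℤ) × (ℤ/2ℤ). In particular there are exactly four central extensions of PGL₂(F_ℓ) by the cyclic group of order 2^i up to equivalence. -/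
namespace H2PGL

def IsC {G M : Type*} [Group G] [AddCommGroup M] (f : G → G → M) : Prop :=
  ∀ x y z, f (x * y) z + f x y = f y z + f x (y * z)

def IsB {G M : Type*} [Group G] [AddCommGroup M] (f : G → G → M) : Prop :=
  ∃ ρ : G → M, ∀ x y, f x y = ρ x + ρ y - ρ (x * y)

lemma klein {A : Type*} [AddCommGroup A] (a b : A) (ha : a + a = 0) (hb : b + b = 0)
    (hs : ∀ x : A, ∃ m n : ℕ, x = m • a + n • b)
    (hi : ∀ m n : ℕ, m • a + n • b = 0 → Even m ∧ Even n) :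
    Nonempty (A ≃+ (ZMod 2 × ZMod 2)) := by
  let fa : ZMod 2 →+ A := ZMod.lift 2 ⟨zmultiplesHom A a, by simp [two_zsmul, ha]⟩
  let fb : ZMod 2 →+ A := ZMod.lift 2 ⟨zmultiplesHom A b, by simp [two_zsmul, hb]⟩
  have hfa : ∀ n : ℕ, fa n = n • a := fun n => by
    have := ZMod.lift_coe 2 (⟨zmultiplesHom A a, by simp [two_zsmul, ha]⟩ :
      {f : ℤ →+ A // f (2 : ℕ) = 0}) n
    simpa using this
  have hfb : ∀ n : ℕ, fb n = n • b := fun n => by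
    have := ZMod.lift_coe 2 (⟨zmultiplesHom A b, by simp [two_zsmul, hb]⟩ :
      {f : ℤ →+ A // f (2 : ℕ) = 0}) n
    simpa using this
  let F : ZMod 2 × ZMod 2 →+ A := fa.coprod fb
  have hF : Function.Bijective F := by
    constructor
    · rw [injective_iff_map_eq_zero]
      rintro ⟨p, q⟩ h
      have h' : fa p + fb q = 0 := h
      rw [← ZMod.natCast_zmod_val p, ← ZMod.natCast_zmod_val q, hfa, hfb] at h'
      obtain ⟨h1, h2⟩ := hi _ _ h'
      rw [← ZMod.natCast_eq_zero_iff_even] at h1 h2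
      rw [ZMod.natCast_zmod_val] at h1 h2
      simp [h1, h2]
    · intro x
      obtain ⟨m, n, rfl⟩ := hs x
      exact ⟨((m : ZMod 2), (n : ZMod 2)), by
        show fa m + fb n = _
        rw [hfa, hfb]⟩
  exact ⟨(AddEquiv.ofBijective F hF).symm⟩

open groupCohomology in
lemma reduce {G M : Type} [Group G] [AddCommGroup M] (α β : G → G → M)
    (hα : IsC α) (hβ : IsC β) (hα2 : IsB (α + α)) (hβ2 : IsB (β + β))
    (hs : ∀ f : G → G → M, IsC f → ∃ m n : ℕ, IsB (f - (m • α + n • β)))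
    (hi : ∀ m n : ℕ, IsB (m • α + n • β) → Even m ∧ Even n) :
    Nonempty ((groupCohomology.H2 (Rep.trivial ℤ G M)) ≃+ (ZMod 2 × ZMod 2)) := by
  have aux : ∀ a b c : M, a - b + c = c + a - b := by intros; abel
  have key : ∀ f : cocycles₂ (Rep.trivial ℤ G M),
      H2π _ f = 0 ↔ IsB (fun x y => (f (x, y) : M)) := by
    intro f
    rw [H2π_eq_zero_iff]
    constructor
    · rintro ⟨ρ, hρ⟩
      refine ⟨ρ, fun x y => ?_⟩
      exact (congrFun hρ (x, y)).symm.trans (aux _ _ _)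
    · rintro ⟨ρ, hρ⟩
      refine ⟨ρ, ?_⟩
      ext ⟨x, y⟩
      exact (aux _ _ _).trans (hρ x y).symm
  let mk : ∀ f : G → G → M, IsC f → cocycles₂ (Rep.trivial ℤ G M) := fun f hf =>
    ⟨fun p => f p.1 p.2, (mem_cocycles₂_iff _).2 fun x y z => hf x y z⟩
  refine klein (H2π _ (mk α hα)) (H2π _ (mk β hβ)) ?_ ?_ ?_ ?_
  · rw [← map_add, key]
    exact hα2
  · rw [← map_add, key]
    exact hβ2
  · intro x
    induction x using H2_induction_on with | _ f =>
    obtain ⟨m, n, h⟩ := hs (fun x y => f (x, y)) (fun x y z => (mem_cocycles₂_iff _).1 f.2 x y z)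
    refine ⟨m, n, ?_⟩
    rw [← map_nsmul, ← map_nsmul, ← map_add, ← sub_eq_zero, ← map_sub, key]
    exact h
  · intro m n h
    rw [← map_nsmul, ← map_nsmul, ← map_add, key] at h
    exact hi m n h

end H2PGL


namespace H2PGL

section Steinberg

variable {F E : Type*} [Field F] [Group E] (x y : F → E)

def wS (u : F) : E := x u * y (-u⁻¹) * x u

def hS (u : F) : E := wS x y u * wS x y (-1)

structure St : Prop where
  hx : ∀ a b, x (a + b) = x a * x b
  hy : ∀ a b, y (a + b) = y a * y b
  hwx : ∀ u a, u ≠ 0 → wS x y u * x a = y (-(a / u ^ 2)) * wS x y u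
  hwy : ∀ u a, u ≠ 0 → wS x y u * y a = x (-(u ^ 2 * a)) * wS x y u
  hc : ∀ u v, u ≠ 0 → v ≠ 0 → hS x y u * hS x y v = hS x y v * hS x y u
  sq : ∀ u v : F, ¬ IsSquare u → ¬ IsSquare v → ∃ c, c ≠ 0 ∧ v = u * c ^ 2
  ns : ∃ p q : F, ¬ IsSquare p ∧ ¬ IsSquare q ∧ p + q = 1

variable {x y} (H : St x y)
include H

namespace St

lemma x0 : x 0 = 1 := by
  have := H.hx 0 0
  simpa using this

lemma y0 : y 0 = 1 := by
  have := H.hy 0 0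
  simpa using this

lemma xn (a : F) : x (-a) = (x a)⁻¹ := by
  rw [eq_inv_iff_mul_eq_one, ← H.hx, neg_add_cancel, H.x0]

lemma yn (a : F) : y (-a) = (y a)⁻¹ := by
  rw [eq_inv_iff_mul_eq_one, ← H.hy, neg_add_cancel, H.y0]

lemma wn (u : F) : wS x y (-u) = (wS x y u)⁻¹ := by
  simp only [wS, H.xn, inv_neg, H.yn, mul_inv_rev, mul_assoc, inv_inv]

lemma wy (u : F) (hu : u ≠ 0) : wS x y u = y (-u⁻¹) * x u * y (-u⁻¹) := by
  have h1 := H.hwx u u hu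
  have h2 := H.hwy u (-u⁻¹) hu
  have e1 : -(u / u ^ 2) = -u⁻¹ := by field_simp
  have e2 : -(u ^ 2 * -u⁻¹) = u := by field_simp
  rw [e1] at h1
  rw [e2] at h2
  have : wS x y u * wS x y u = y (-u⁻¹) * x u * y (-u⁻¹) * wS x y u := by
    conv_lhs => rw [show wS x y u * wS x y u = wS x y u * (x u * y (-u⁻¹) * x u) from rfl]
    rw [← mul_assoc, ← mul_assoc, h1, mul_assoc (y (-u⁻¹)), h2, ← mul_assoc, mul_assoc _ _ (x u), h1]
    simp only [mul_assoc]
  exact mul_right_cancel this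

lemma ww (v u : F) (hv : v ≠ 0) (hu : u ≠ 0) :
    wS x y v * wS x y u = wS x y (v ^ 2 / u) * wS x y v := by
  have h1 := H.hwx v u hv
  have h2 := H.hwy v (-u⁻¹) hv
  have e2 : -(v ^ 2 * -u⁻¹) = v ^ 2 / u := by field_simp
  have e1 : -(u / v ^ 2) = -(v ^ 2 / u)⁻¹ := by field_simp
  rw [e1] at h1
  rw [e2] at h2
  conv_lhs => rw [show wS x y v * wS x y u = wS x y v * (x u * y (-u⁻¹) * x u) from rfl]
  rw [H.wy (v ^ 2 / u) (div_ne_zero (pow_ne_zero 2 hv) hu), ← mul_assoc, ← mul_assoc, h1, mul_assoc (y _), h2, ← mul_assoc, mul_assoc _ _ (x u), h1]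
  simp only [mul_assoc]

lemma wn1 : wS x y (-1) = (wS x y 1)⁻¹ := H.wn 1

lemma w_eq (u : F) : wS x y u = hS x y u * wS x y 1 := by
  rw [hS, H.wn1]; group

lemma hw (v u : F) (hv : v ≠ 0) (hu : u ≠ 0) :
    hS x y v * wS x y u = wS x y (v ^ 2 * u) * hS x y v := by
  rw [hS, mul_assoc, H.ww (-1) u (by simp) hu, ← mul_assoc,
    H.ww v _ hv (by simpa using hu), mul_assoc]
  congr 2
  field_simp

lemma h1 : hS x y 1 = 1 := by rw [hS, H.wn1]; group

lemma hsq (u v : F) (hu : u ≠ 0) (hv : v ≠ 0) :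
    hS x y (u * v ^ 2) = hS x y u * hS x y (v ^ 2) := by
  have e1 : hS x y v * hS x y u = wS x y (v ^ 2 * u) * wS x y (-v ^ 2) * hS x y v := by
    conv_lhs => rw [show hS x y u = wS x y u * wS x y (-1) from rfl]
    rw [← mul_assoc, H.hw v u hv hu, mul_assoc, H.hw v (-1) hv (by simp), ← mul_assoc]
    congr 3
    ring
  rw [H.hc v u hv hu] at e1
  have e2 := mul_right_cancel e1
  rw [e2, H.wn, hS, hS, mul_comm u]
  group

lemma steinberg (u v : F) (hu : u ≠ 0) (hv : v ≠ 0) (huv : u + v = 1) :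
    hS x y u * hS x y v = hS x y (u * v) := by
  have key : wS x y u * wS x y (-1) * wS x y v = wS x y (u * v) := by
    have a1 := H.wy (-1) (by simp)
    have e : -(-1 : F)⁻¹ = 1 := by norm_num
    rw [e] at a1
    have a2 := H.hwy u 1 hu
    have a3 := H.hwx v (-v ^ 2) hv
    have e3 : -(-v ^ 2 / v ^ 2) = 1 := by field_simp
    rw [e3] at a3
    have e4 : -(u ^ 2 * 1) + u = u * v := by rw [← eq_sub_iff_add_eq'] at huv; rw [huv]; ring
    have e5 : v + -v ^ 2 = u * v := by rw [← eq_sub_iff_add_eq] at huv; rw [huv]; ring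
    have e6 : u + -1 + v = 0 := by linear_combination huv
    have e7 : -u⁻¹ + -v⁻¹ = -(u * v)⁻¹ := by
      field_simp
      linear_combination -huv
    calc wS x y u * wS x y (-1) * wS x y v
        = (wS x y u * y 1) * x (-1) * (y 1 * wS x y v) := by rw [a1]; group
      _ = x (-(u ^ 2 * 1)) * wS x y u * x (-1) * (wS x y v * x (-v ^ 2)) := by rw [a2, a3]
      _ = (x (-(u ^ 2 * 1)) * x u) * y (-u⁻¹) * (x u * x (-1) * x v) * y (-v⁻¹)
            * (x v * x (-v ^ 2)) := by simp only [wS, mul_assoc]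
      _ = x (u * v) * (y (-u⁻¹) * y (-v⁻¹)) * x (u * v) := by
          rw [← H.hx, ← H.hx, ← H.hx, ← H.hx, e4, e5, e6, H.x0]; group
      _ = wS x y (u * v) := by rw [← H.hy, e7]; rfl
  rw [hS, hS, ← mul_assoc, key]; rfl

lemma hmul (u v : F) (hu : u ≠ 0) (hv : v ≠ 0) :
    hS x y (u * v) = hS x y u * hS x y v := by
  by_cases su : IsSquare u
  · obtain ⟨c, rfl⟩ := su
    have hc : c ≠ 0 := by rintro rfl; simp at hu
    rw [H.hc _ _ hu hv, ← pow_two, ← H.hsq _ _ hv hc, mul_comm]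
  by_cases sv : IsSquare v
  · obtain ⟨c, rfl⟩ := sv
    have hc : c ≠ 0 := by rintro rfl; simp at hv
    rw [← pow_two, ← H.hsq _ _ hu hc]
  obtain ⟨p, q, hp, hq, hpq⟩ := H.ns
  obtain ⟨c, hc, rfl⟩ := H.sq p u hp su
  obtain ⟨d, hd, rfl⟩ := H.sq q v hq sv
  have hp0 : p ≠ 0 := by rintro rfl; simp at hp
  have hq0 : q ≠ 0 := by rintro rfl; simp at hq
  have hpq0 : p * q ≠ 0 := mul_ne_zero hp0 hq0
  have e : p * c ^ 2 * (q * d ^ 2) = (p * q * c ^ 2) * d ^ 2 := by ring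
  rw [e, H.hsq _ _ (mul_ne_zero hpq0 (pow_ne_zero 2 hc)) hd, H.hsq _ _ hpq0 hc,
    H.hsq _ _ hp0 hc, H.hsq _ _ hq0 hd, ← H.steinberg p q hp0 hq0 hpq]
  have := H.hc (c ^ 2) q (pow_ne_zero 2 hc) hq0
  simp only [mul_assoc]
  rw [← mul_assoc (hS x y q), ← this]
  simp only [mul_assoc]

lemma hxa (u a : F) (hu : u ≠ 0) : hS x y u * x a = x (u ^ 2 * a) * hS x y u := by
  rw [hS, mul_assoc, H.hwx (-1) a (by simp), ← mul_assoc, H.hwy u _ hu, mul_assoc]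
  congr 2
  field_simp

lemma w1h (u : F) (hu : u ≠ 0) : wS x y 1 * hS x y u = hS x y u⁻¹ * wS x y 1 := by
  rw [← H.w_eq, hS, ← mul_assoc, H.ww 1 u one_ne_zero hu, mul_assoc, H.wn1]
  simp

lemma w1w1 : wS x y 1 * wS x y 1 = hS x y (-1) := by
  have h2 : hS x y (-1) * hS x y (-1) = 1 := by
    rw [← H.hmul _ _ (by simp) (by simp)]; simp [H.h1]
  have h3 : wS x y 1 * wS x y 1 * hS x y (-1) = 1 := by
    rw [hS, H.wn1]; group
  rw [mul_eq_one_iff_eq_inv] at h2 h3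
  rw [h3, ← h2]

variable (x y) in
omit H in
def NF (e : E) : Prop :=
  (∃ a u, u ≠ 0 ∧ e = x a * hS x y u) ∨
  (∃ a u c, u ≠ 0 ∧ e = x a * hS x y u * wS x y 1 * x c)

lemma nx (b : F) (e : E) (he : NF x y e) : NF x y (x b * e) := by
  rcases he with ⟨a, u, hu, rfl⟩ | ⟨a, u, c, hu, rfl⟩
  · exact .inl ⟨b + a, u, hu, by rw [H.hx]; simp only [mul_assoc]⟩
  · exact .inr ⟨b + a, u, c, hu, by rw [H.hx]; simp only [mul_assoc]⟩

lemma nh (v : F) (hv : v ≠ 0) (e : E) (he : NF x y e) : NF x y (hS x y v * e) := by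
  rcases he with ⟨a, u, hu, rfl⟩ | ⟨a, u, c, hu, rfl⟩
  · exact .inl ⟨v ^ 2 * a, v * u, mul_ne_zero hv hu, by
      rw [H.hmul _ _ hv hu, ← mul_assoc, H.hxa _ _ hv, mul_assoc]⟩
  · exact .inr ⟨v ^ 2 * a, v * u, c, mul_ne_zero hv hu, by
      rw [H.hmul _ _ hv hu, ← mul_assoc, ← mul_assoc, ← mul_assoc, H.hxa _ _ hv]
      simp only [mul_assoc]⟩

lemma nw (e : E) (he : NF x y e) : NF x y (wS x y 1 * e) := by
  rcases he with ⟨a, u, hu, rfl⟩ | ⟨a, u, c, hu, rfl⟩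
  · refine .inr ⟨0, u⁻¹, a / u ^ 2, inv_ne_zero hu, ?_⟩
    rw [H.x0, one_mul, ← H.w1h u hu, mul_assoc, H.hxa u _ hu]
    congr 3
    field_simp
  · have hu' : -u⁻¹ ≠ 0 := neg_ne_zero.2 (inv_ne_zero hu)
    have k : wS x y 1 * hS x y u * wS x y 1 = hS x y (-u⁻¹) := by
      rw [H.w1h u hu, mul_assoc, H.w1w1, ← H.hmul _ _ (inv_ne_zero hu) (by simp), mul_neg_one]
    by_cases ha : a = 0
    · subst ha
      refine .inl ⟨(-u⁻¹) ^ 2 * c, -u⁻¹, hu', ?_⟩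
      rw [H.x0, one_mul, ← H.hxa _ _ hu', ← k]
      simp only [mul_assoc]
    · have ha' := inv_ne_zero ha
      have hb : (-u⁻¹)⁻¹ ≠ 0 := inv_ne_zero hu'
      refine .inr ⟨-a⁻¹, a⁻¹ * (-u⁻¹)⁻¹, -a⁻¹ / (-u⁻¹) ^ 2 + c, mul_ne_zero ha' hb, ?_⟩
      have e1 : y (-a) = x (-a⁻¹) * (hS x y a⁻¹ * wS x y 1) * x (-a⁻¹) := by
        rw [← H.w_eq, wS, H.xn, inv_inv]; group
      have e2 := H.hwx 1 a one_ne_zero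
      rw [one_pow, div_one] at e2
      have e3 : x (-a⁻¹) * hS x y (-u⁻¹) = hS x y (-u⁻¹) * x (-a⁻¹ / (-u⁻¹) ^ 2) := by
        rw [H.hxa _ _ hu']
        congr 2
        field_simp
      calc wS x y 1 * (x a * hS x y u * wS x y 1 * x c)
          = (wS x y 1 * x a) * hS x y u * wS x y 1 * x c := by simp only [mul_assoc]
        _ = y (-a) * (wS x y 1 * hS x y u * wS x y 1) * x c := by rw [e2]; simp only [mul_assoc]
        _ = x (-a⁻¹) * hS x y a⁻¹ * wS x y 1 * (x (-a⁻¹) * hS x y (-u⁻¹)) * x c := by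
            rw [k, e1]; simp only [mul_assoc]
        _ = x (-a⁻¹) * hS x y a⁻¹ * (wS x y 1 * hS x y (-u⁻¹)) * x (-a⁻¹ / (-u⁻¹) ^ 2) * x c := by
            rw [e3]; simp only [mul_assoc]
        _ = _ := by
            rw [H.w1h _ hu', H.hx, H.hmul _ _ ha' hb]; simp only [mul_assoc]

lemma ny (b : F) (e : E) (he : NF x y e) : NF x y (y b * e) := by
  have e1 : y b = wS x y 1 * x (-b) * (hS x y (-1) * wS x y 1) := by
    rw [← H.w_eq, H.wn1, H.hwx 1 _ one_ne_zero]
    simp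
  rw [e1, mul_assoc, mul_assoc, mul_assoc]
  exact H.nw _ (H.nx _ _ (H.nh _ (by simp) _ (H.nw _ he)))

lemma nf_of_mem (e : E) (he : e ∈ Subgroup.closure (Set.range x ∪ Set.range y)) : NF x y e := by
  induction he using Subgroup.closure_induction_left with
  | one => exact .inl ⟨0, 1, one_ne_zero, by rw [H.x0, H.h1, one_mul]⟩
  | mul_left g hg e _ ih =>
    rcases hg with ⟨a, rfl⟩ | ⟨a, rfl⟩
    · exact H.nx _ _ ih
    · exact H.ny _ _ ih
  | inv_mul_cancel g hg e _ ih =>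
    rcases hg with ⟨a, rfl⟩ | ⟨a, rfl⟩
    · rw [← H.xn]; exact H.nx _ _ ih
    · rw [← H.yn]; exact H.ny _ _ ih

end St
end Steinberg
end H2PGL


namespace H2PGL

open Matrix

section SL
variable {F : Type*} [Field F]

lemma sl_ext {A B : SpecialLinearGroup (Fin 2) F}
    (h : (A : Matrix (Fin 2) (Fin 2) F) = (B : Matrix (Fin 2) (Fin 2) F)) : A = B := Subtype.ext h

lemma sl_val {A B : SpecialLinearGroup (Fin 2) F} (h : A = B) :
    (A : Matrix (Fin 2) (Fin 2) F) = (B : Matrix (Fin 2) (Fin 2) F) := by rw [h]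

def X (a : F) : SpecialLinearGroup (Fin 2) F := ⟨!![1, a; 0, 1], by simp⟩
def Y (a : F) : SpecialLinearGroup (Fin 2) F := ⟨!![1, 0; a, 1], by simp⟩
def D (u : Fˣ) : SpecialLinearGroup (Fin 2) F :=
  ⟨!![(u : F), 0; 0, (u⁻¹ : Fˣ)], by simp⟩

lemma X_val (a : F) : (X a : Matrix (Fin 2) (Fin 2) F) = !![1, a; 0, 1] := rfl
lemma Y_val (a : F) : (Y a : Matrix (Fin 2) (Fin 2) F) = !![1, 0; a, 1] := rfl
lemma D_val (u : Fˣ) :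
    (D u : Matrix (Fin 2) (Fin 2) F) = !![(u : F), 0; 0, (u⁻¹ : Fˣ)] := rfl

lemma X_add (a b : F) : X (a + b) = X a * X b := by
  apply sl_ext
  simp [X_val, add_comm]

lemma Y_add (a b : F) : Y (a + b) = Y a * Y b := by
  apply sl_ext
  simp [Y_val]

lemma D_mul (u v : Fˣ) : D (u * v) = D u * D v := by
  apply sl_ext
  simp [D_val, mul_comm]

def DHom : Fˣ →* SpecialLinearGroup (Fin 2) F := MonoidHom.mk' D D_mul

lemma X_pow (a : F) (n : ℕ) : X a ^ n = X (n * a) := by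
  induction n with
  | zero => apply sl_ext; simp [X_val, one_fin_two]
  | succ n ih => rw [pow_succ, ih, ← X_add]; congr 1; push_cast; ring

lemma Y_pow (a : F) (n : ℕ) : Y a ^ n = Y (n * a) := by
  induction n with
  | zero => apply sl_ext; simp [Y_val, one_fin_two]
  | succ n ih => rw [pow_succ, ih, ← Y_add]; congr 1; push_cast; ring

lemma W_val (u : F) (hu : u ≠ 0) :
    ((wS X Y u : SpecialLinearGroup (Fin 2) F) : Matrix (Fin 2) (Fin 2) F) = !![0, u; -u⁻¹, 0] := by
  simp [wS, X_val, Y_val, hu]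

lemma H_eq (u : F) (hu : u ≠ 0) : hS X Y u = D (Units.mk0 u hu) := by
  apply sl_ext
  rw [hS]
  simp only [Matrix.SpecialLinearGroup.coe_mul]
  rw [W_val u hu, W_val (-1) (by simp)]
  simp [D_val]

lemma W_X (u a : F) (hu : u ≠ 0) : wS X Y u * X a = Y (-(a / u ^ 2)) * wS X Y u := by
  apply sl_ext
  simp only [Matrix.SpecialLinearGroup.coe_mul]
  rw [W_val u hu]
  simp [X_val, Y_val]
  field_simp

lemma W_Y (u a : F) (hu : u ≠ 0) : wS X Y u * Y a = X (-(u ^ 2 * a)) * wS X Y u := by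
  apply sl_ext
  simp only [Matrix.SpecialLinearGroup.coe_mul]
  rw [W_val u hu]
  simp [X_val, Y_val]
  field_simp

lemma gen_aux (g : SpecialLinearGroup (Fin 2) F) (hc : g.1 1 0 ≠ 0) :
    g = X ((g.1 0 0 - 1) / g.1 1 0) * Y (g.1 1 0) * X ((g.1 1 1 - 1) / g.1 1 0) := by
  have hd := g.2
  rw [det_fin_two] at hd
  apply sl_ext
  rw [eta_fin_two g.1] 
  simp [X_val, Y_val]
  field_simp
  refine ⟨⟨by ring, ?_⟩, by ring⟩
  linear_combination -hd

lemma gen_top : Subgroup.closure (Set.range (X (F := F)) ∪ Set.range Y) = ⊤ := by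
  rw [eq_top_iff]
  have hX : ∀ a : F, X a ∈ Subgroup.closure (Set.range (X (F := F)) ∪ Set.range Y) :=
    fun a => Subgroup.subset_closure (.inl ⟨a, rfl⟩)
  have hY : ∀ a : F, Y a ∈ Subgroup.closure (Set.range (X (F := F)) ∪ Set.range Y) :=
    fun a => Subgroup.subset_closure (.inr ⟨a, rfl⟩)
  have h1 : ∀ g : SpecialLinearGroup (Fin 2) F, g.1 1 0 ≠ 0 →
      g ∈ Subgroup.closure (Set.range (X (F := F)) ∪ Set.range Y) := by
    intro g hg
    rw [gen_aux g hg]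
    exact mul_mem (mul_mem (hX _) (hY _)) (hX _)
  intro g _
  by_cases hg : g.1 1 0 = 0
  · have : Y 1 * g ∈ Subgroup.closure (Set.range (X (F := F)) ∪ Set.range Y) := by
      apply h1
      have hd := g.2
      rw [det_fin_two, hg] at hd
      have : g.1 0 0 ≠ 0 := by intro h; rw [h] at hd; simp at hd
      simpa [Y_val, mul_apply, Fin.sum_univ_two, hg] using this
    have h2 := mul_mem (inv_mem (hY 1)) this
    rwa [inv_mul_cancel_left] at h2
  · exact h1 g hg

end SL

section A
variable {ℓ : ℕ} [Fact ℓ.Prime]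

lemma ns_sq (hℓ : ℓ ≠ 2) (u v : ZMod ℓ) (hu : ¬ IsSquare u) (hv : ¬ IsSquare v) :
    ∃ c, c ≠ 0 ∧ v = u * c ^ 2 := by
  have hu0 : u ≠ 0 := by rintro rfl; simp at hu
  have hv0 : v ≠ 0 := by rintro rfl; simp at hv
  have h : IsSquare (u * v) := by
    have h2 : ringChar (ZMod ℓ) ≠ 2 := by rwa [ZMod.ringChar_zmod_n]
    have a := (quadraticChar_neg_one_iff_not_isSquare (a := u)).2 hu
    have b := (quadraticChar_neg_one_iff_not_isSquare (a := v)).2 hv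
    rw [← quadraticChar_one_iff_isSquare (mul_ne_zero hu0 hv0), map_mul, a, b]
    norm_num
  obtain ⟨c, hc⟩ := h
  have hc0 : c ≠ 0 := by rintro rfl; simp [hu0, hv0] at hc
  refine ⟨c / u, div_ne_zero hc0 hu0, ?_⟩
  field_simp
  linear_combination hc

lemma exists_ns (hℓ : ℓ ≠ 2) : ∃ n : ZMod ℓ, ¬ IsSquare n :=
  FiniteField.exists_nonsquare (by rwa [ZMod.ringChar_zmod_n])

lemma ns_add (hℓ : ℓ ≠ 2) : ∃ p q : ZMod ℓ, ¬ IsSquare p ∧ ¬ IsSquare q ∧ p + q = 1 := by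
  obtain ⟨n, hn⟩ := exists_ns hℓ
  have hn0 : n ≠ 0 := by rintro rfl; simp at hn
  obtain ⟨a, b, hab⟩ := ZMod.sq_add_sq ℓ n⁻¹
  have key : ∀ c : ZMod ℓ, c ≠ 0 → ¬ IsSquare (n * c ^ 2) := by
    rintro c hc ⟨d, hd⟩
    exact hn ⟨d / c, by field_simp; linear_combination hd⟩
  have ha : a ≠ 0 := by
    rintro rfl
    exact hn ⟨b⁻¹, by rw [← mul_inv, ← pow_two, ← inv_inv n, ← hab]; simp⟩
  have hb : b ≠ 0 := by
    rintro rfl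
    exact hn ⟨a⁻¹, by rw [← mul_inv, ← pow_two, ← inv_inv n, ← hab]; simp⟩
  refine ⟨n * a ^ 2, n * b ^ 2, key a ha, key b hb, ?_⟩
  rw [← mul_add, hab, mul_inv_cancel₀ hn0]

theorem splitSL (hℓ : ℓ ≠ 2) {E : Type*} [Group E]
    (φ : E →* SpecialLinearGroup (Fin 2) (ZMod ℓ)) (hs : Function.Surjective φ)
    (hc : ∀ k, φ k = 1 → ∀ e, k * e = e * k) (N : ℕ) (hN : Nat.Coprime N ℓ)
    (hk : ∀ k, φ k = 1 → k ^ N = 1) :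
    ∃ s : SpecialLinearGroup (Fin 2) (ZMod ℓ) →* E, ∀ g, φ (s g) = g := by
  -- exponent
  obtain ⟨T, hT1, hT2⟩ : ∃ T : ℕ, (T : ZMod ℓ) = 1 ∧ N ∣ T := by
    have hN0 : (N : ZMod ℓ) ≠ 0 := by
      rw [Ne, ZMod.natCast_eq_zero_iff]
      exact (Nat.Prime.coprime_iff_not_dvd Fact.out).1 hN.symm
    exact ⟨N * ((N : ZMod ℓ)⁻¹).val, by simp [hN0], dvd_mul_right _ _⟩
  have hkT : ∀ k, φ k = 1 → k ^ T = 1 := by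
    intro k h
    obtain ⟨c, rfl⟩ := hT2
    rw [pow_mul, hk k h, one_pow]
  have indep : ∀ e e', φ e = φ e' → e ^ T = e' ^ T := by
    intro e e' h
    have h1 : φ (e * e'⁻¹) = 1 := by simp [h]
    have h2 : e = (e * e'⁻¹) * e' := by group
    rw [h2, Commute.mul_pow (hc _ h1 e'), hkT _ h1, one_mul]
  choose lift hlift using hs
  let c : SpecialLinearGroup (Fin 2) (ZMod ℓ) → E := fun g => lift g ^ T
  have c_conj : ∀ e g, e * c g * e⁻¹ = c (φ e * g * (φ e)⁻¹) := by
    intro e g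
    show e * lift g ^ T * e⁻¹ = lift _ ^ T
    rw [← conj_pow]
    apply indep
    simp [hlift]
  have c_pow : ∀ g n, c (g ^ n) = c g ^ n := by
    intro g n
    show lift _ ^ T = (lift g ^ T) ^ n
    rw [← pow_mul, mul_comm, pow_mul]
    apply indep
    simp [hlift]
  have φc : ∀ g, φ (c g) = g ^ T := by
    intro g
    show φ (lift g ^ T) = _
    rw [map_pow, hlift]
  let x : ZMod ℓ → E := fun a => c (X a)
  let y : ZMod ℓ → E := fun a => c (Y a)
  have φx : ∀ a, φ (x a) = X a := by
    intro a
    show φ (c _) = _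
    rw [φc, X_pow, hT1, one_mul]
  have φy : ∀ a, φ (y a) = Y a := by
    intro a
    show φ (c _) = _
    rw [φc, Y_pow, hT1, one_mul]
  have φw : ∀ u, φ (wS x y u) = wS X Y u := by
    intro u
    simp only [wS, map_mul, φx, φy]
  have φh : ∀ u, φ (hS x y u) = hS X Y u := by
    intro u
    simp only [hS, map_mul, φw]
  have xn : ∀ n : ℕ, x n = x 1 ^ n := by
    intro n
    show c _ = c _ ^ n
    rw [← c_pow, X_pow, mul_one]
  have yn : ∀ n : ℕ, y n = y 1 ^ n := by
    intro n
    show c _ = c _ ^ n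
    rw [← c_pow, Y_pow, mul_one]
  have H : St x y := by
    refine ⟨?_, ?_, ?_, ?_, ?_, ns_sq hℓ, ns_add hℓ⟩
    · intro a b
      rw [← ZMod.natCast_zmod_val a, ← ZMod.natCast_zmod_val b, ← Nat.cast_add, xn, xn, xn, pow_add]
    · intro a b
      rw [← ZMod.natCast_zmod_val a, ← ZMod.natCast_zmod_val b, ← Nat.cast_add, yn, yn, yn, pow_add]
    · intro u a hu
      rw [← mul_inv_eq_iff_eq_mul]
      show _ * c _ * _ = c _
      rw [c_conj, φw, W_X _ _ hu, mul_inv_cancel_right]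
    · intro u a hu
      rw [← mul_inv_eq_iff_eq_mul]
      show _ * c _ * _ = c _
      rw [c_conj, φw, W_Y _ _ hu, mul_inv_cancel_right]
    · intro u v hu hv
      obtain ⟨ν, hν⟩ := IsCyclic.exists_generator (α := (ZMod ℓ)ˣ)
      have key : ∀ u, u ≠ 0 → ∃ (n : ℤ) (k : E), φ k = 1 ∧ hS x y u = k * lift (D ν) ^ n := by
        intro u hu
        obtain ⟨n, hn⟩ := hν (Units.mk0 u hu)
        refine ⟨n, hS x y u * (lift (D ν) ^ n)⁻¹, ?_, by group⟩
        rw [map_mul, φh, H_eq u hu, map_inv, map_zpow, hlift, ← hn, mul_inv_eq_one]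
        exact map_zpow DHom ν n
      obtain ⟨n, k, h1, h2⟩ := key u hu
      obtain ⟨n', k', h1', h2'⟩ := key v hv
      rw [h2, h2']
      have a1 : Commute k (k' * lift (D ν) ^ n') := hc k h1 _
      have a2 : Commute (lift (D ν) ^ n) k' := (hc k' h1' _).symm
      exact a1.mul_left (a2.mul_right ((Commute.refl _).zpow_zpow n n'))
  let S := Subgroup.closure (Set.range x ∪ Set.range y)
  have inj : ∀ e ∈ S, φ e = 1 → e = 1 := by
    intro e he h1
    rcases H.nf_of_mem e he with ⟨a, u, hu, rfl⟩ | ⟨a, u, b, hu, rfl⟩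
    · rw [map_mul, φx, φh, H_eq u hu] at h1
      have h2 := sl_val h1
      have e1 := congrFun (congrFun h2 0) 0
      have e2 := congrFun (congrFun h2 0) 1
      simp [X_val, D_val] at e1 e2
      have hu1 : u = 1 := by simpa using e1
      have ha : a = 0 := by
        rcases e2 with h | h
        · exact h
        · exact absurd h hu
      rw [hu1, ha, H.x0, H.h1, one_mul]
    · exfalso
      rw [map_mul, map_mul, map_mul, φx, φx, φh, φw, H_eq u hu] at h1
      have h2 := sl_val h1
      simp only [Matrix.SpecialLinearGroup.coe_mul] at h2
      rw [W_val 1 one_ne_zero] at h2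
      have e1 := congrFun (congrFun h2 1) 0
      simp [X_val, D_val, hu] at e1
  have surj : ∀ g, ∃ e ∈ S, φ e = g := by
    have : S.map φ = ⊤ := by
      rw [MonoidHom.map_closure, ← gen_top, Set.image_union, ← Set.range_comp, ← Set.range_comp]
      congr 3 <;> ext a : 1 
      · exact φx a
      · exact φy a
    intro g
    have hg : g ∈ S.map φ := this ▸ Subgroup.mem_top g
    exact hg
  choose s hsS hsφ using surj
  refine ⟨MonoidHom.mk' s ?_, hsφ⟩
  intro g g'
  have h : s (g * g') * (s g * s g')⁻¹ ∈ S :=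
    mul_mem (hsS _) (inv_mem (mul_mem (hsS _) (hsS _)))
  have := inj _ h (by simp [hsφ])
  rwa [mul_inv_eq_one] at this

/-- Two lifts of the same map from `SL₂` agree. -/
theorem lift_unique {E Q : Type*} [Group E] [Group Q]
    (φ : E →* Q) (hc : ∀ k, φ k = 1 → ∀ e, k * e = e * k) (N : ℕ) (hN : Nat.Coprime N ℓ)
    (hk : ∀ k, φ k = 1 → k ^ N = 1)
    (s s' : SpecialLinearGroup (Fin 2) (ZMod ℓ) →* E) (h : ∀ g, φ (s g) = φ (s' g)) : s = s' := by
  have key : ∀ g : SpecialLinearGroup (Fin 2) (ZMod ℓ), g ^ ℓ = 1 → s g = s' g := by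
    intro g hg
    have h1 : φ (s g * (s' g)⁻¹) = 1 := by simp [h]
    have h2 : s g = (s g * (s' g)⁻¹) * s' g := by group
    have h3 : (s g * (s' g)⁻¹) ^ ℓ = 1 := by
      have : (s g) ^ ℓ = (s g * (s' g)⁻¹) ^ ℓ * (s' g) ^ ℓ := by
        rw [← Commute.mul_pow (hc _ h1 _), ← h2]
      rw [← map_pow, ← map_pow, hg, map_one, map_one, mul_one] at this
      exact this.symm
    have h4 := hk _ h1
    have h5 : (s g * (s' g)⁻¹) ^ (Nat.gcd N ℓ) = 1 := pow_gcd_eq_one.2 ⟨h4, h3⟩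
    rw [hN.gcd_eq_one, pow_one] at h5
    rwa [mul_inv_eq_one] at h5
  apply MonoidHom.eq_of_eqOn_dense gen_top
  rintro _ (⟨a, rfl⟩ | ⟨a, rfl⟩)
  · apply key
    rw [X_pow]; simp; apply sl_ext; simp [X_val, one_fin_two]
  · apply key
    rw [Y_pow]; simp; apply sl_ext; simp [Y_val, one_fin_two]

end A
end H2PGL


namespace H2PGL

open Matrix

section Ext
variable {G M : Type*} [Group G] [AddCommGroup M]

lemma IsC.one_left {f : G → G → M} (hf : IsC f) (x : G) : f 1 x = f 1 1 := by
  have := hf 1 1 x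
  simp only [one_mul] at this
  exact (add_left_cancel this).symm

lemma IsC.one_right {f : G → G → M} (hf : IsC f) (x : G) : f x 1 = f 1 1 := by
  have := hf x 1 1
  simp only [mul_one] at this
  exact add_right_cancel this

@[ext]
structure Ext (f : G → G → M) (hf : IsC f) where
  m : M
  g : G

variable {f : G → G → M} {hf : IsC f}

instance : Mul (Ext f hf) := ⟨fun p q => ⟨p.m + q.m + f p.g q.g, p.g * q.g⟩⟩
instance : One (Ext f hf) := ⟨⟨-f 1 1, 1⟩⟩
instance : Inv (Ext f hf) := ⟨fun p => ⟨-p.m - f 1 1 - f p.g⁻¹ p.g, p.g⁻¹⟩⟩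

lemma Ext.mul_m (p q : Ext f hf) : (p * q).m = p.m + q.m + f p.g q.g := rfl
lemma Ext.mul_g (p q : Ext f hf) : (p * q).g = p.g * q.g := rfl
lemma Ext.one_m : (1 : Ext f hf).m = -f 1 1 := rfl
lemma Ext.one_g : (1 : Ext f hf).g = 1 := rfl
lemma Ext.inv_m (p : Ext f hf) : (p⁻¹).m = -p.m - f 1 1 - f p.g⁻¹ p.g := rfl
lemma Ext.inv_g (p : Ext f hf) : (p⁻¹).g = p.g⁻¹ := rfl

instance : Group (Ext f hf) := Group.ofLeftAxioms
  (by
    intro p q r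
    apply Ext.ext
    · simp only [Ext.mul_m, Ext.mul_g]
      have := hf p.g q.g r.g
      calc _ = p.m + q.m + r.m + (f (p.g * q.g) r.g + f p.g q.g) := by abel
        _ = _ := by rw [this]; abel
    · simp only [Ext.mul_g, mul_assoc])
  (by
    intro p
    apply Ext.ext
    · simp only [Ext.mul_m, Ext.one_m, Ext.one_g, hf.one_left]; abel
    · simp only [Ext.mul_g, Ext.one_g, one_mul])
  (by
    intro p
    apply Ext.ext
    · simp only [Ext.mul_m, Ext.one_m, Ext.inv_m, Ext.inv_g]; abel
    · simp only [Ext.mul_g, Ext.one_g, Ext.inv_g, inv_mul_cancel])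

def Ext.proj : Ext f hf →* G where
  toFun := Ext.g
  map_one' := rfl
  map_mul' _ _ := rfl

lemma Ext.proj_apply (p : Ext f hf) : Ext.proj p = p.g := rfl

lemma Ext.proj_surj : Function.Surjective (Ext.proj (f := f) (hf := hf)) := fun g => ⟨⟨0, g⟩, rfl⟩

lemma Ext.central (k : Ext f hf) (hk : Ext.proj k = 1) (e : Ext f hf) : k * e = e * k := by
  rw [Ext.proj_apply] at hk
  apply Ext.ext
  · simp only [Ext.mul_m, hk, hf.one_left, hf.one_right]; abel
  · simp only [Ext.mul_g, hk, one_mul, mul_one]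

lemma Ext.pow_ker (k : Ext f hf) (hk : Ext.proj k = 1) (n : ℕ) :
    (k ^ n).m = n • (k.m + f 1 1) - f 1 1 ∧ (k ^ n).g = 1 := by
  rw [Ext.proj_apply] at hk
  induction n with
  | zero => simp [Ext.one_m, Ext.one_g]
  | succ n ih =>
    rw [pow_succ]
    refine ⟨?_, by rw [Ext.mul_g, ih.2, hk, one_mul]⟩
    rw [Ext.mul_m, ih.1, ih.2, hk, succ_nsmul]; abel

lemma Ext.pow_eq_one (N : ℕ) (hM : ∀ m : M, N • m = 0) (k : Ext f hf) (hk : Ext.proj k = 1) :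
    k ^ N = 1 := by
  obtain ⟨h1, h2⟩ := Ext.pow_ker k hk N
  apply Ext.ext
  · rw [h1, hM, zero_sub, Ext.one_m]
  · rw [h2, Ext.one_g]

end Ext

section pull
variable {ℓ : ℕ} [Fact ℓ.Prime] {G M : Type*} [Group G] [AddCommGroup M]

lemma pull (hℓ : ℓ ≠ 2) (N : ℕ) (hN : Nat.Coprime N ℓ) (hM : ∀ m : M, N • m = 0)
    (π : SpecialLinearGroup (Fin 2) (ZMod ℓ) →* G) (f : G → G → M) (hf : IsC f) :
    ∃ σ : SpecialLinearGroup (Fin 2) (ZMod ℓ) → M,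
      ∀ A B, f (π A) (π B) = σ A + σ B - σ (A * B) := by
  have hf' : IsC (fun A B => f (π A) (π B)) := by
    intro A B C
    simp only [map_mul]
    exact hf _ _ _
  obtain ⟨s, hs⟩ := splitSL hℓ (Ext.proj (hf := hf')) Ext.proj_surj Ext.central N hN
    (Ext.pow_eq_one N hM)
  refine ⟨fun A => -(s A).m, fun A B => ?_⟩
  have h := congrArg Ext.m (map_mul s A B)
  have hs' : ∀ A, (s A).g = A := hs
  rw [Ext.mul_m, hs', hs'] at h
  beta_reduce
  rw [h]
  abel

lemma core (N : ℕ) (hN : Nat.Coprime N ℓ) (hM : ∀ m : M, N • m = 0)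
    (π : SpecialLinearGroup (Fin 2) (ZMod ℓ) →* G) (f : G → G → M) (hf : IsC f)
    (σ : SpecialLinearGroup (Fin 2) (ZMod ℓ) → M)
    (hσ : ∀ A B, f (π A) (π B) = σ A + σ B - σ (A * B)) (hz : σ (-1) = σ 1)
    (t : G) (ht : t * t = 1) (c : M) (hc : f t t + f 1 1 = c + c)
    (θ : SpecialLinearGroup (Fin 2) (ZMod ℓ) →* SpecialLinearGroup (Fin 2) (ZMod ℓ))
    (hθ : ∀ A, t * π A = π (θ A) * t)
    (hcov : ∀ g, ∃ A, g = π A ∨ g = π A * t)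
    (htn : ∀ A, π A ≠ t)
    (hker : ∀ A, π A = 1 → A = 1 ∨ A = -1) (hneg : π (-1) = 1) : IsB f := by
  let s : SpecialLinearGroup (Fin 2) (ZMod ℓ) →* Ext f hf := MonoidHom.mk'
    (fun A => ⟨-σ A, π A⟩) (by
      intro A B
      apply Ext.ext
      · rw [Ext.mul_m]
        show -σ (A * B) = -σ A + -σ B + f (π A) (π B)
        rw [hσ]; abel
      · exact map_mul π A B)
  have sg : ∀ A, (s A).g = π A := fun A => rfl
  have s1 : s (-1) = 1 := by
    rw [← map_one s]
    apply Ext.ext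
    · show -σ (-1) = -σ 1
      rw [hz]
    · rw [sg, sg, hneg, map_one]
  let T : Ext f hf := ⟨-c, t⟩
  have hT : T * T = 1 := by
    apply Ext.ext
    · rw [Ext.mul_m, Ext.one_m]
      show -c + -c + f t t = _
      rw [← neg_add, ← hc]; abel
    · exact ht
  have hTi : T⁻¹ = T := by rw [inv_eq_iff_mul_eq_one, hT]
  have hconj : (MulAut.conj T).toMonoidHom.comp s = s.comp θ := by
    apply lift_unique (ℓ := ℓ) (Ext.proj (hf := hf)) Ext.central N hN (Ext.pow_eq_one N hM)
    intro A
    show t * π A * t⁻¹ = π (θ A)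
    rw [hθ, mul_inv_cancel_right]
  have hTs : ∀ A, T * s A = s (θ A) * T := by
    intro A
    rw [← mul_inv_eq_iff_eq_mul]
    exact DFunLike.congr_fun hconj A
  let R : Ext f hf → Prop := fun e => ∃ A, e = s A ∨ e = s A * T
  have hRmul : ∀ e e', R e → R e' → R (e * e') := by
    rintro e e' ⟨A, rfl | rfl⟩ ⟨B, rfl | rfl⟩
    · exact ⟨A * B, .inl (map_mul s A B).symm⟩
    · exact ⟨A * B, .inr (by rw [map_mul, mul_assoc])⟩
    · exact ⟨A * θ B, .inr (by rw [mul_assoc, hTs, map_mul, mul_assoc])⟩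
    · refine ⟨A * θ B, .inl ?_⟩
      rw [mul_assoc, ← mul_assoc T, hTs, mul_assoc, hT, mul_one, map_mul]
  have hss : ∀ A B, π A = π B → s A = s B := by
    intro A B h
    have h1 : π (A * B⁻¹) = 1 := by rw [map_mul, map_inv, h, mul_inv_cancel]
    have h2 : s (A * B⁻¹) = 1 := by
      rcases hker _ h1 with h | h
      · rw [h, map_one]
      · rw [h, s1]
    rwa [map_mul, map_inv, mul_inv_eq_one] at h2
  have hno : ∀ A B, π A ≠ π B * t := by
    intro A B h
    apply htn (B⁻¹ * A)
    rw [map_mul, h, map_inv, inv_mul_cancel_left]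
  have huniq : ∀ e e', R e → R e' → e.g = e'.g → e = e' := by
    rintro e e' ⟨A, rfl | rfl⟩ ⟨B, rfl | rfl⟩ h
    · exact hss _ _ h
    · exact absurd h (hno A B)
    · exact absurd h.symm (hno B A)
    · rw [hss A B (mul_right_cancel (b := t) h)]
  have hex : ∀ g : G, ∃ e : Ext f hf, R e ∧ e.g = g := by
    intro g
    obtain ⟨A, rfl | rfl⟩ := hcov g
    · exact ⟨s A, ⟨A, .inl rfl⟩, rfl⟩
    · exact ⟨s A * T, ⟨A, .inr rfl⟩, rfl⟩
  choose e he heg using hex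
  refine ⟨fun g => -(e g).m, fun x y => ?_⟩
  have h : e (x * y) = e x * e y := by
    apply huniq _ _ (he _) (hRmul _ _ (he _) (he _))
    rw [heg, Ext.mul_g, heg, heg]
  beta_reduce
  rw [h, Ext.mul_m, heg, heg]
  abel

lemma hom_zero (N : ℕ) (hN : Nat.Coprime N ℓ) (hM : ∀ m : M, N • m = 0)
    (ψ : SpecialLinearGroup (Fin 2) (ZMod ℓ) → M) (hψ : ∀ A B, ψ (A * B) = ψ A + ψ B) (A) :
    ψ A = 0 := by
  let Ψ : SpecialLinearGroup (Fin 2) (ZMod ℓ) →* Multiplicative M :=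
    MonoidHom.mk' (fun A => Multiplicative.ofAdd (ψ A)) (fun A B => by rw [hψ]; rfl)
  have h := lift_unique (ℓ := ℓ) (1 : Multiplicative M →* Unit) (fun k _ e => mul_comm k e) N hN
    (fun k _ => hM (Multiplicative.toAdd k)) Ψ 1 (fun _ => rfl)
  exact DFunLike.congr_fun h A

end pull
end H2PGL


namespace H2PGL

open Matrix

section PGL
variable (ℓ : ℕ) [Fact ℓ.Prime]

abbrev PG := GL (Fin 2) (ZMod ℓ) ⧸ Subgroup.center (GL (Fin 2) (ZMod ℓ))

variable {ℓ}

abbrev mkG (A : GL (Fin 2) (ZMod ℓ)) : PG ℓ := QuotientGroup.mk A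

lemma mkG_eq (A B : GL (Fin 2) (ZMod ℓ)) (h : mkG A = mkG B) :
    ∃ c : ZMod ℓ, c ≠ 0 ∧ (A : Matrix (Fin 2) (Fin 2) (ZMod ℓ)) = c • (B : Matrix (Fin 2) (Fin 2) (ZMod ℓ)) := by
  have h1 := QuotientGroup.eq.1 h.symm
  rw [GeneralLinearGroup.center_eq_range_scalar] at h1
  obtain ⟨c, hc⟩ := h1
  refine ⟨c, c.ne_zero, ?_⟩
  have h2 : A = B * GeneralLinearGroup.scalar (Fin 2) c := by rw [hc]; group
  rw [h2]
  ext i j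
  simp [Matrix.mul_apply, Matrix.scalar, Matrix.diagonal, mul_comm]

lemma eq_mkG (A B : GL (Fin 2) (ZMod ℓ)) (c : ZMod ℓ) (hc : c ≠ 0)
    (h : (A : Matrix (Fin 2) (Fin 2) (ZMod ℓ)) = c • (B : Matrix (Fin 2) (Fin 2) (ZMod ℓ))) :
    mkG A = mkG B := by
  symm
  apply QuotientGroup.eq.2
  rw [GeneralLinearGroup.center_eq_range_scalar]
  refine ⟨Units.mk0 c hc, ?_⟩
  rw [eq_inv_mul_iff_mul_eq]
  apply Units.ext
  rw [h]
  ext i j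
  simp [Matrix.mul_apply, Matrix.scalar, Matrix.diagonal, mul_comm]

def piG : SpecialLinearGroup (Fin 2) (ZMod ℓ) →* PG ℓ :=
  (QuotientGroup.mk' _).comp SpecialLinearGroup.toGL

lemma piG_apply (A : SpecialLinearGroup (Fin 2) (ZMod ℓ)) :
    piG A = mkG (SpecialLinearGroup.toGL A) := rfl

lemma toGL_val (A : SpecialLinearGroup (Fin 2) (ZMod ℓ)) :
    ((SpecialLinearGroup.toGL A : GL (Fin 2) (ZMod ℓ)) : Matrix (Fin 2) (Fin 2) (ZMod ℓ)) =
      (A : Matrix (Fin 2) (Fin 2) (ZMod ℓ)) := rfl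

lemma piG_neg : piG (-1 : SpecialLinearGroup (Fin 2) (ZMod ℓ)) = 1 := by
  rw [← map_one piG, piG_apply, piG_apply]
  apply eq_mkG _ _ (-1) (by simp)
  rw [toGL_val, toGL_val]
  simp

lemma piG_ker (A : SpecialLinearGroup (Fin 2) (ZMod ℓ)) (h : piG A = 1) : A = 1 ∨ A = -1 := by
  rw [← map_one piG, piG_apply, piG_apply] at h
  obtain ⟨c, _, h⟩ := mkG_eq _ _ h
  rw [toGL_val, toGL_val] at h
  have hd := A.2
  rw [h] at hd
  have hc : c ^ 2 = 1 := by simpa [det_smul] using hd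
  rcases mul_self_eq_one_iff.1 ((sq c).symm.trans hc) with rfl | rfl
  · left; apply sl_ext; rw [h]; simp
  · right; apply sl_ext; rw [h]; simp

def chi : PG ℓ →* ℤˣ := QuotientGroup.lift _
  ((Units.map (quadraticChar (ZMod ℓ)).toMonoidHom).comp GeneralLinearGroup.det) (by
    intro A hA
    rw [GeneralLinearGroup.center_eq_range_scalar] at hA
    obtain ⟨c, rfl⟩ := hA
    apply Units.ext
    have : (c : ZMod ℓ) ≠ 0 := c.ne_zero
    simp [quadraticChar_sq_one this, ← pow_two]
    )

lemma chi_mk (A : GL (Fin 2) (ZMod ℓ)) :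
    ((chi (mkG A) : ℤˣ) : ℤ) = quadraticChar (ZMod ℓ) (A : Matrix (Fin 2) (Fin 2) (ZMod ℓ)).det := rfl

lemma chi_pi (A : SpecialLinearGroup (Fin 2) (ZMod ℓ)) : chi (piG A) = 1 := by
  apply Units.ext
  rw [piG_apply, chi_mk, toGL_val, A.2]
  simp

lemma exists_pi (g : PG ℓ) (h : chi g = 1) : ∃ A, g = piG A := by
  obtain ⟨B, rfl⟩ := QuotientGroup.mk_surjective g
  have h1 := chi_mk B
  have hd : (B : Matrix (Fin 2) (Fin 2) (ZMod ℓ)).det ≠ 0 :=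
    ((Matrix.isUnit_iff_isUnit_det _).1 B.isUnit).ne_zero
  have h' : chi (mkG B) = 1 := h
  rw [h', Units.val_one] at h1
  obtain ⟨c, hc⟩ := (quadraticChar_one_iff_isSquare hd).1 h1.symm
  have hc0 : c ≠ 0 := by rintro rfl; simp [hc] at hd
  have hdA : (c⁻¹ • (B : Matrix (Fin 2) (Fin 2) (ZMod ℓ))).det = 1 := by
    rw [det_smul, hc, Fintype.card_fin]; field_simp
  let A : SpecialLinearGroup (Fin 2) (ZMod ℓ) := ⟨c⁻¹ • (B : Matrix (Fin 2) (Fin 2) (ZMod ℓ)), hdA⟩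
  refine ⟨A, ?_⟩
  show mkG B = mkG (SpecialLinearGroup.toGL A)
  apply eq_mkG _ _ c hc0
  rw [toGL_val]
  show _ = c • (c⁻¹ • (B : Matrix (Fin 2) (Fin 2) (ZMod ℓ)))
  rw [smul_smul, mul_inv_cancel₀ hc0, one_smul]

/-- conjugation by the antidiagonal matrix -/
def theta (n : ZMod ℓ) (hn : n ≠ 0) :
    SpecialLinearGroup (Fin 2) (ZMod ℓ) →* SpecialLinearGroup (Fin 2) (ZMod ℓ) := MonoidHom.mk'
  (fun A => ⟨!![(A : Matrix (Fin 2) (Fin 2) (ZMod ℓ)) 1 1, (A : Matrix (Fin 2) (Fin 2) (ZMod ℓ)) 1 0 / n;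
      n * (A : Matrix (Fin 2) (Fin 2) (ZMod ℓ)) 0 1, (A : Matrix (Fin 2) (Fin 2) (ZMod ℓ)) 0 0], by
    have hd := A.2
    rw [det_fin_two] at hd ⊢
    simp
    field_simp
    linear_combination hd⟩) (by
    intro A B
    apply sl_ext
    show !![(A.1 * B.1) 1 1, (A.1 * B.1) 1 0 / n; n * (A.1 * B.1) 0 1, (A.1 * B.1) 0 0] =
      !![A.1 1 1, A.1 1 0 / n; n * A.1 0 1, A.1 0 0] * !![B.1 1 1, B.1 1 0 / n; n * B.1 0 1, B.1 0 0]
    ext i j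
    fin_cases i <;> fin_cases j <;> simp [Matrix.mul_apply, Fin.sum_univ_two] <;> field_simp <;> ring)

lemma exists_t (hℓ : ℓ ≠ 2) : ∃ (t : PG ℓ)
    (θ : SpecialLinearGroup (Fin 2) (ZMod ℓ) →* SpecialLinearGroup (Fin 2) (ZMod ℓ)),
    t * t = 1 ∧ chi t = -1 ∧ ∀ A, t * piG A = piG (θ A) * t := by
  obtain ⟨ν, hν⟩ := exists_ns hℓ
  have hν0 : ν ≠ 0 := by rintro rfl; simp at hν
  have hn : -ν ≠ 0 := neg_ne_zero.2 hν0
  have hdet : (!![0, 1; -ν, 0] : Matrix (Fin 2) (Fin 2) (ZMod ℓ)).det = ν := by simp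
  let T : GL (Fin 2) (ZMod ℓ) := GeneralLinearGroup.mkOfDetNeZero !![0, 1; -ν, 0] (by rw [hdet]; exact hν0)
  have hT : (T : Matrix (Fin 2) (Fin 2) (ZMod ℓ)) = !![0, 1; -ν, 0] := rfl
  refine ⟨mkG T, theta (-ν) hn, ?_, ?_, ?_⟩
  · show mkG (T * T) = mkG 1
    apply eq_mkG _ _ (-ν) hn
    rw [Units.val_mul, hT]
    simp [one_fin_two]
  · apply Units.ext
    rw [chi_mk, hT, hdet, quadraticChar_neg_one_iff_not_isSquare.2 hν]
    rfl
  · intro A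
    show mkG (T * SpecialLinearGroup.toGL A) = mkG (SpecialLinearGroup.toGL (theta (-ν) hn A) * T)
    apply eq_mkG _ _ 1 one_ne_zero
    rw [Units.val_mul, Units.val_mul, hT, toGL_val, toGL_val, one_smul]
    have : (theta (-ν) hn A : Matrix (Fin 2) (Fin 2) (ZMod ℓ)) =
      !![(A : Matrix (Fin 2) (Fin 2) (ZMod ℓ)) 1 1, (A : Matrix (Fin 2) (Fin 2) (ZMod ℓ)) 1 0 / (-ν);
      (-ν) * (A : Matrix (Fin 2) (Fin 2) (ZMod ℓ)) 0 1, (A : Matrix (Fin 2) (Fin 2) (ZMod ℓ)) 0 0] := rfl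
    rw [this]
    rw [eta_fin_two (A : Matrix (Fin 2) (Fin 2) (ZMod ℓ))]
    simp
    field_simp
    exact ⟨trivial, trivial⟩

end PGL
end H2PGL


namespace H2PGL

open Matrix

section Alpha
variable {ℓ : ℕ} [Fact ℓ.Prime]

lemma smul_cancel (A : GL (Fin 2) (ZMod ℓ)) (a b : ZMod ℓ)
    (h : a • (A : Matrix (Fin 2) (Fin 2) (ZMod ℓ)) = b • (A : Matrix (Fin 2) (Fin 2) (ZMod ℓ))) :
    a = b := by
  have h1 := congrArg (fun B => B * ((A⁻¹ : GL (Fin 2) (ZMod ℓ)) : Matrix (Fin 2) (Fin 2) (ZMod ℓ))) h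
  simp only [smul_mul, Units.mul_inv] at h1
  have h2 := congrFun (congrFun h1 0) 0
  simpa using h2

lemma exists_eps (hℓ : ℓ ≠ 2) : ∃ (K : Type) (_ : Field K) (ε : PG ℓ → PG ℓ → K)
    (η : SpecialLinearGroup (Fin 2) (ZMod ℓ) → K), (1 : K) ≠ -1 ∧
    (∀ x y, ε x y = 1 ∨ ε x y = -1) ∧ (∀ A, η A = 1 ∨ η A = -1) ∧
    (∀ x y z, ε (x*y) z * ε x y = ε y z * ε x (y*z)) ∧
    (∀ A B, ε (piG A) (piG B) * η (A*B) = η A * η B) ∧ η (-1) = - η 1 := by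
  let K := AlgebraicClosure (ZMod ℓ)
  let φ : ZMod ℓ →+* K := algebraMap _ _
  have hφ : ∀ c, c ≠ 0 → φ c ≠ 0 := fun c hc => (map_ne_zero φ).2 hc
  have h2 : (1 : K) ≠ -1 := by
    intro h
    have h' : φ 1 = φ (-1) := by simpa using h
    have h'' := φ.injective h'
    have : Fact (2 < ℓ) := ⟨lt_of_le_of_ne (Fact.out : ℓ.Prime).two_le (Ne.symm hℓ)⟩
    exact ZMod.neg_one_ne_one h''.symm
  let rep : PG ℓ → GL (Fin 2) (ZMod ℓ) := fun x => Quotient.out x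
  have hrep : ∀ x, mkG (rep x) = x := fun x => Quotient.out_eq x
  let d : PG ℓ → ZMod ℓ := fun x => (rep x : Matrix (Fin 2) (Fin 2) (ZMod ℓ)).det
  have hd : ∀ x, d x ≠ 0 := fun x => ((Matrix.isUnit_iff_isUnit_det _).1 (rep x).isUnit).ne_zero
  have hr : ∀ x, ∃ r : K, r ^ 2 = φ (d x) := fun x => IsAlgClosed.exists_pow_nat_eq _ (by norm_num)
  choose r hr using hr
  have hr0 : ∀ x, r x ≠ 0 := by
    intro x h
    have := hr x
    rw [h] at this
    exact hφ _ (hd x) (by rw [← this]; simp)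
  have hl : ∀ x y, ∃ c : ZMod ℓ, c ≠ 0 ∧ ((rep x * rep y : GL (Fin 2) (ZMod ℓ)) : Matrix (Fin 2) (Fin 2) (ZMod ℓ)) =
      c • (rep (x*y) : Matrix (Fin 2) (Fin 2) (ZMod ℓ)) := by
    intro x y
    apply mkG_eq
    rw [hrep]
    show mkG (rep x) * mkG (rep y) = _
    rw [hrep, hrep]
  choose l hl0 hl using hl
  have hm : ∀ A : SpecialLinearGroup (Fin 2) (ZMod ℓ), ∃ c : ZMod ℓ, c ≠ 0 ∧
      (rep (piG A) : Matrix (Fin 2) (Fin 2) (ZMod ℓ)) =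
      c • ((SpecialLinearGroup.toGL A : GL (Fin 2) (ZMod ℓ)) : Matrix (Fin 2) (Fin 2) (ZMod ℓ)) := by
    intro A
    apply mkG_eq
    rw [hrep, piG_apply]
  choose m hm0 hm using hm
  -- scalar cocycle identity
  have hlc : ∀ x y z, l (x*y) z * l x y = l y z * l x (y*z) := by
    intro x y z
    apply smul_cancel (rep (x*y*z))
    have e1 := hl (x*y) z
    have e2 := hl x y
    have e3 := hl y z
    have e4 := hl x (y*z)
    rw [Units.val_mul] at e1 e2 e3 e4
    rw [← mul_assoc] at e4
    rw [mul_comm (l (x*y) z), mul_smul, mul_smul, ← e1, ← e4, ← smul_mul, ← mul_smul_comm, ← e2, ← e3, Matrix.mul_assoc]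
  have hld : ∀ x y, d x * d y = l x y ^ 2 * d (x*y) := by
    intro x y
    have := congrArg Matrix.det (hl x y)
    rw [Units.val_mul, det_mul, det_smul, Fintype.card_fin] at this
    exact this
  have hmd : ∀ A, d (piG A) = m A ^ 2 := by
    intro A
    have := congrArg Matrix.det (hm A)
    rw [det_smul, Fintype.card_fin, toGL_val, A.2, mul_one] at this
    exact this
  have hlm : ∀ A B, l (piG A) (piG B) * m (A*B) = m A * m B := by
    intro A B
    apply smul_cancel (SpecialLinearGroup.toGL (A*B))
    have e1 := hl (piG A) (piG B)
    rw [← map_mul, Units.val_mul, hm A, hm B, hm (A*B), smul_mul, mul_smul_comm, smul_smul, smul_smul] at e1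
    rw [← e1, map_mul, Units.val_mul]
  have hmn : m (-1) = - m 1 := by
    apply smul_cancel (SpecialLinearGroup.toGL 1)
    have e1 := hm (-1)
    have e2 := hm 1
    rw [piG_neg, toGL_val] at e1
    rw [map_one, e1] at e2
    rw [toGL_val] at e2 ⊢
    rw [neg_smul, ← e2]
    simp
  refine ⟨K, inferInstance, fun x y => r x * r y / (φ (l x y) * r (x*y)), fun A => r (piG A) / φ (m A),
    h2, ?_, ?_, ?_, ?_, ?_⟩
  · intro x y
    apply mul_self_eq_one_iff.1
    have e := congrArg φ (hld x y)
    rw [map_mul, map_mul, map_pow, ← hr, ← hr, ← hr] at e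
    have a1 := hφ _ (hl0 x y)
    have b1 := hr0 (x*y)
    rw [div_mul_div_comm, div_eq_one_iff_eq (by simp [*])]
    linear_combination e
  · intro A
    apply mul_self_eq_one_iff.1
    have e := congrArg φ (hmd A)
    rw [map_pow, ← hr] at e
    have a1 := hφ _ (hm0 A)
    rw [div_mul_div_comm, div_eq_one_iff_eq (by simp [*])]
    linear_combination e
  · intro x y z
    have e := congrArg φ (hlc x y z)
    rw [map_mul, map_mul] at e
    have a1 := hφ _ (hl0 (x*y) z)
    have a2 := hφ _ (hl0 x y)
    have a3 := hφ _ (hl0 y z)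
    have a4 := hφ _ (hl0 x (y*z))
    have b1 := hr0 x
    have b2 := hr0 (x*y)
    have b3 := hr0 (y*z)
    have b4 := hr0 (x*y*z)
    show r (x*y) * r z / (φ (l (x*y) z) * r (x*y*z)) * (r x * r y / (φ (l x y) * r (x*y))) =
      r y * r z / (φ (l y z) * r (y*z)) * (r x * r (y*z) / (φ (l x (y*z)) * r (x*(y*z))))
    rw [← mul_assoc x y z]
    rw [div_mul_div_comm, div_mul_div_comm, div_eq_div_iff (by simp [*]) (by simp [*])]
    linear_combination (-(r (x*y) * r z * r x * r y * r (y*z) * r (x*y*z))) * e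
  · intro A B
    have e := congrArg φ (hlm A B)
    rw [map_mul, map_mul] at e
    have a1 := hφ _ (hl0 (piG A) (piG B))
    have a2 := hφ _ (hm0 A)
    have a3 := hφ _ (hm0 B)
    have a4 := hφ _ (hm0 (A*B))
    have b1 := hr0 (piG (A*B))
    show r (piG A) * r (piG B) / (φ (l (piG A) (piG B)) * r (piG A * piG B)) * (r (piG (A*B)) / φ (m (A*B))) =
      r (piG A) / φ (m A) * (r (piG B) / φ (m B))
    rw [← map_mul piG]
    rw [div_mul_div_comm, div_mul_div_comm, div_eq_div_iff (by simp [*]) (by simp [*])]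
    linear_combination (-(r (piG A) * r (piG B) * r (piG (A*B)))) * e
  · show r (piG (-1)) / φ (m (-1)) = - (r (piG 1) / φ (m 1))
    rw [hmn, piG_neg, map_one, map_neg, div_neg]

lemma exists_alpha (hℓ : ℓ ≠ 2) {M : Type} [AddCommGroup M] (h : M) (hh : h + h = 0) :
    ∃ (α : PG ℓ → PG ℓ → M) (σ : SpecialLinearGroup (Fin 2) (ZMod ℓ) → M), IsC α ∧ α + α = 0 ∧
    (∀ A B, α (piG A) (piG B) = σ A + σ B - σ (A*B)) ∧ σ (-1) = σ 1 + h := by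
  classical
  obtain ⟨K, _, ε, η, h2, h3, h4, h5, h6, h7⟩ := exists_eps (ℓ := ℓ) hℓ
  let ι : K → M := fun e => if e = 1 then 0 else h
  have i1 : ι 1 = 0 := by simp [ι]
  have i2 : ι (-1) = h := by simp [ι, h2.symm]
  have hn : -h = h := neg_eq_of_add_eq_zero_left hh
  have im : ∀ a b, (a = 1 ∨ a = -1) → (b = 1 ∨ b = -1) → ι (a*b) = ι a + ι b := by
    rintro a b (rfl | rfl) (rfl | rfl) <;> simp [i1, i2, hh]
  refine ⟨fun x y => ι (ε x y), fun A => ι (η A), ?_, ?_, ?_, ?_⟩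
  · intro x y z
    show ι _ + ι _ = ι _ + ι _
    rw [← im _ _ (h3 _ _) (h3 _ _), ← im _ _ (h3 _ _) (h3 _ _), h5]
  · funext x y
    show ι (ε x y) + ι (ε x y) = 0
    rcases h3 x y with e | e <;> simp [e, i1, i2, hh]
  · intro A B
    show ι (ε _ _) = ι _ + ι _ - ι _
    rw [eq_sub_iff_add_eq, ← im _ _ (h3 _ _) (h4 _), h6, im _ _ (h4 _) (h4 _)]
  · show ι (η (-1)) = ι (η 1) + h
    rw [h7]
    rcases h4 1 with e | e <;> simp [e, i1, i2, hh]

end Alpha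
end H2PGL


namespace H2PGL

open Matrix

lemma half_facts (i : ℕ) (hi : 1 ≤ i) : ∃ h : ZMod (2^i), h + h = 0 ∧ (∀ m : ℕ, m • h = 0 → Even m) ∧
    (∀ z : ZMod (2^i), z + z = 0 → ∃ m : ℕ, z = m • h) ∧
    (∀ z : ZMod (2^i), ∃ (n : ℕ) (c : ZMod (2^i)), z = n • 1 + (c + c)) ∧
    (∀ (n : ℕ) (c : ZMod (2^i)), n • (1 : ZMod (2^i)) = c + c → Even n) := by
  obtain ⟨k, rfl⟩ : ∃ k, i = k + 1 := ⟨i - 1, by omega⟩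
  have key : ∀ n : ℕ, (n : ZMod (2^(k+1))) = 0 ↔ 2^(k+1) ∣ n := fun n => ZMod.natCast_eq_zero_iff n _
  have hz : ∀ z : ZMod (2^(k+1)), ∃ n : ℕ, z = n := fun z => ⟨z.val, by simp⟩
  refine ⟨((2^k : ℕ) : ZMod (2^(k+1))), ?_, ?_, ?_, ?_, ?_⟩
  · rw [← Nat.cast_add, key]; exact ⟨1, by ring⟩
  · intro m hm
    rw [nsmul_eq_mul, ← Nat.cast_mul, key, pow_succ, mul_comm m] at hm
    exact (even_iff_two_dvd).2 (Nat.dvd_of_mul_dvd_mul_left (by positivity) hm)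
  · intro z h
    obtain ⟨n, rfl⟩ := hz z
    rw [← Nat.cast_add, key, pow_succ, ← mul_two] at h
    obtain ⟨m, rfl⟩ := Nat.dvd_of_mul_dvd_mul_right (by norm_num) h
    exact ⟨m, by rw [nsmul_eq_mul]; push_cast; ring⟩
  · intro z
    obtain ⟨n, rfl⟩ := hz z
    exact ⟨n, 0, by simp⟩
  · intro n c h
    obtain ⟨a, rfl⟩ := hz c
    rw [nsmul_eq_mul, mul_one, ← Nat.cast_add, ZMod.natCast_eq_natCast_iff] at h
    have h' := h.of_dvd (dvd_pow_self 2 (Nat.succ_ne_zero k))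
    unfold Nat.ModEq at h'
    rw [Nat.even_iff]; omega

section Final
variable {ℓ : ℕ} [Fact ℓ.Prime]

lemma IsC.lin {G M : Type} [Group G] [AddCommGroup M] {f a b : G → G → M} (hf : IsC f) (ha : IsC a)
    (hb : IsC b) (m n : ℕ) : IsC (f - (m • a + n • b)) := by
  intro x y z
  have h1 := hf x y z
  have h2 := congrArg (fun w => m • w) (ha x y z)
  have h3 := congrArg (fun w => n • w) (hb x y z)
  simp only [nsmul_add] at h2 h3
  simp only [Pi.sub_apply, Pi.add_apply, Pi.smul_apply]
  have e : ∀ p q r s t u : M, p - (q + r) + (s - (t + u)) = (p + s) - (q + t) - (r + u) := by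
    intros; abel
  rw [e, e, h1, h2, h3]

theorem main (hℓ : 5 ≤ ℓ) (i : ℕ) (hi : 1 ≤ i) :
    Nonempty ((groupCohomology.H2 (Rep.trivial ℤ (PG ℓ) (ZMod (2 ^ i)))) ≃+ (ZMod 2 × ZMod 2)) := by
  classical
  have hl2 : ℓ ≠ 2 := by omega
  have hN : (2^i).Coprime ℓ := Nat.Coprime.pow_left _
    ((Nat.coprime_primes Nat.prime_two Fact.out).2 (by omega))
  have hM : ∀ m : ZMod (2^i), (2^i) • m = 0 := by
    intro m
    rw [nsmul_eq_mul, ZMod.natCast_self, zero_mul]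
  obtain ⟨h, hh, he, hm2, hdec, hodd⟩ := half_facts i hi
  obtain ⟨α, σα, hα, hα2, hασ, hσα⟩ := exists_alpha (ℓ := ℓ) hl2 h hh
  obtain ⟨t, θ, ht, hχt, hθ⟩ := exists_t hl2
  let e : PG ℓ → ZMod (2^i) := fun x => if chi x = 1 then 0 else 1
  let β : PG ℓ → PG ℓ → ZMod (2^i) := fun x y => e x * e y
  have e1 : ∀ x, chi x = 1 → e x = 0 := fun x h => by simp [e, h]
  have e2 : ∀ x, chi x = -1 → e x = 1 := fun x h => by simp [e, h]
  have hcases : ∀ x : PG ℓ, chi x = 1 ∨ chi x = -1 := fun x => Int.units_eq_one_or _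
  have hb2 : ∀ x y, β x y + β x y = e x + e y - e (x*y) := by
    intro x y
    rcases hcases x with hx | hx <;> rcases hcases y with hy | hy
    · have hxy : chi (x*y) = 1 := by rw [map_mul, hx, hy]; rfl
      simp [β, e1 _ hx, e1 _ hy, e1 _ hxy]
    · have hxy : chi (x*y) = -1 := by rw [map_mul, hx, hy]; rfl
      simp [β, e1 _ hx, e2 _ hy, e2 _ hxy]
    · have hxy : chi (x*y) = -1 := by rw [map_mul, hx, hy]; rfl
      simp [β, e2 _ hx, e1 _ hy, e2 _ hxy]
    · have hxy : chi (x*y) = 1 := by rw [map_mul, hx, hy]; rfl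
      simp [β, e2 _ hx, e2 _ hy, e1 _ hxy]
  have hβ : IsC β := by
    intro x y z
    have hxy : e (x*y) = e x + e y - (β x y + β x y) := by rw [hb2]; ring
    have hyz : e (y*z) = e y + e z - (β y z + β y z) := by rw [hb2]; ring
    show e (x*y) * e z + e x * e y = e y * e z + e x * e (y*z)
    rw [hxy, hyz]
    show (e x + e y - (e x * e y + e x * e y)) * e z + e x * e y =
      e y * e z + e x * (e y + e z - (e y * e z + e y * e z))
    ring
  have hβπ : ∀ A B, β (piG A) (piG B) = 0 := by
    intro A B; simp [β, e1 _ (chi_pi A)]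
  have hβ1 : β 1 1 = 0 := by
    have := hβπ 1 1
    rwa [map_one] at this
  have hβt : β t t = 1 := by simp [β, e2 _ hχt]
  have hcov : ∀ g : PG ℓ, ∃ A, g = piG A ∨ g = piG A * t := by
    intro g
    rcases hcases g with hg | hg
    · obtain ⟨A, hA⟩ := exists_pi g hg
      exact ⟨A, Or.inl hA⟩
    · obtain ⟨A, hA⟩ := exists_pi (g*t) (by rw [map_mul, hg, hχt]; rfl)
      exact ⟨A, Or.inr (by rw [← hA, mul_assoc, ht, mul_one])⟩
  have htn : ∀ A, piG A ≠ t := by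
    intro A hA
    have h1 := chi_pi A
    rw [hA, hχt] at h1
    exact absurd h1 (by decide)
  refine reduce α β hα hβ ⟨0, ?_⟩ ⟨e, hb2⟩ ?_ ?_
  · intro x y; rw [hα2]; simp
  · intro f hf
    obtain ⟨σ, hσ⟩ := pull hl2 (2^i) hN hM piG f hf
    have hz : (σ (-1) - σ 1) + (σ (-1) - σ 1) = 0 := by
      have a1 := hσ (-1) (-1)
      have a2 := hσ 1 1
      rw [piG_neg, neg_mul_neg, one_mul] at a1
      rw [map_one, one_mul] at a2
      rw [a2] at a1
      linear_combination -a1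
    obtain ⟨m, hm⟩ := hm2 _ hz
    obtain ⟨n, c, hc⟩ := hdec ((f - m • α) t t + (f - m • α) 1 1)
    refine ⟨m, n, ?_⟩
    refine core (2^i) hN hM piG _ (hf.lin hα hβ m n) (σ - m • σα) ?_ ?_ t ht c ?_ θ hθ hcov htn piG_ker piG_neg
    · intro A B
      simp only [Pi.sub_apply, Pi.add_apply, Pi.smul_apply]
      rw [hσ, hασ, hβπ, smul_zero, add_zero, nsmul_sub, nsmul_add]
      abel
    · simp only [Pi.sub_apply, Pi.smul_apply]
      rw [hσα, nsmul_add, ← hm]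
      abel
    · simp only [Pi.sub_apply, Pi.add_apply, Pi.smul_apply] at hc ⊢
      rw [hβ1, hβt, smul_zero, add_zero]
      simp only [nsmul_eq_mul] at hc ⊢
      linear_combination hc
  · rintro m n ⟨ρ, hρ⟩
    have hψ := hom_zero (2^i) hN hM (fun A => ρ (piG A) - m • σα A) (by
      intro A B
      have a1 := hρ (piG A) (piG B)
      simp only [Pi.add_apply, Pi.smul_apply] at a1
      rw [hασ, hβπ, smul_zero, add_zero, nsmul_sub, nsmul_add] at a1
      show ρ (piG (A*B)) - m • σα (A*B) = _
      rw [map_mul]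
      linear_combination a1)
    have b1 := hψ (-1)
    have b2 := hψ 1
    simp only [piG_neg, map_one] at b1 b2
    rw [hσα, nsmul_add] at b1
    have hme : Even m := he m (by
      simp only [nsmul_eq_mul] at b1 b2 ⊢
      linear_combination b2 - b1)
    refine ⟨hme, ?_⟩
    obtain ⟨k, rfl⟩ := hme
    have hk : (k + k) • α = 0 := by
      rw [add_nsmul, ← nsmul_add, hα2, smul_zero]
    rw [hk, zero_add] at hρ
    have c1 := hρ 1 1
    have c2 := hρ t t
    simp only [Pi.smul_apply] at c1 c2
    rw [hβ1, smul_zero, one_mul] at c1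
    rw [hβt, ht] at c2
    exact hodd n (ρ t) (by linear_combination c2 + c1)

end Final
end H2PGL


/-- For every prime `ℓ ≥ 5` and every `i ≥ 1`, the second group
cohomology `H²(PGL₂(F_ℓ), ℤ/2^iℤ)` with trivial action is isomorphic to
`(ℤ/2ℤ) × (ℤ/2ℤ)`. Here `PGL₂(F_ℓ)` is the quotient of `GL₂(F_ℓ)` by its center. -/
theorem h2_PGL2_zmod_two_pow (ℓ : ℕ) [Fact ℓ.Prime] (hℓ : 5 ≤ ℓ) (i : ℕ) (hi : 1 ≤ i) :
    Nonempty
      ((groupCohomology.H2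
        (Rep.trivial ℤ
          (GL (Fin 2) (ZMod ℓ) ⧸ Subgroup.center (GL (Fin 2) (ZMod ℓ)))
          (ZMod (2 ^ i)))) ≃+ (ZMod 2 × ZMod 2)) := H2PGL.main hℓ i hi
end

section
/- Let ℓ ≥ 5 be a prime, let F be the field with ℓ² elements (containing F_ℓ = ℤ/ℓℤ), let ε be a generator of F_ℓ^* (in particular a nonsquare in F_ℓ^*), and let s ∈ F with s² = ε. Then the subset H = SL₂(F_ℓ) ∪ diag(s, s⁻¹)·SL₂(F_ℓ) of SL₂(F) is a subgroup of SL₂(F); the matrix −I is the unique element of H of order 2 and is central in H; and the image of H under the natural projection SL₂(F) → PGL₂(F) is isomorphic to PGL₂(F_ℓ), with the projection H → PGL₂(F_ℓ) having kernel {I, −I}. Thus H is a central extension of PGL₂(F_ℓ) by a group of order 2 in which no element lifting an involution of PGL₂(F_ℓ) has order 2. -/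
open Matrix

/-- The projection `SL₂(F) → PGL₂(F)`, the composite of the inclusion `SL₂(F) → GL₂(F)`
with the quotient by the scalar matrices (the center of `GL₂(F)`). -/
noncomputable def projSLtoPGL (F : Type*) [Field F] :
    Matrix.SpecialLinearGroup (Fin 2) F →*
      (GL (Fin 2) F ⧸ Subgroup.center (GL (Fin 2) F)) :=
  (QuotientGroup.mk' (Subgroup.center (GL (Fin 2) F))).comp
    Matrix.SpecialLinearGroup.toGL

def unionSubgroup {G : Type*} [Group G] (K : Subgroup G) (d : G) (h1 : d * d ∈ K)
    (h2 : ∀ k ∈ K, d⁻¹ * k * d ∈ K) : Subgroup G where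
  carrier := {A | A ∈ K ∨ ∃ k ∈ K, d * k = A}
  one_mem' := Or.inl K.one_mem
  mul_mem' := by
    rintro a b (ha | ⟨k, hk, rfl⟩) (hb | ⟨k', hk', rfl⟩)
    · exact Or.inl (K.mul_mem ha hb)
    · exact Or.inr ⟨_, K.mul_mem (h2 a ha) hk', by group⟩
    · exact Or.inr ⟨_, K.mul_mem hk hb, by group⟩
    · left
      have := K.mul_mem (K.mul_mem h1 (h2 k hk)) hk'
      convert this using 1
      group
  inv_mem' := by
    rintro a (ha | ⟨k, hk, rfl⟩)
    · exact Or.inl (K.inv_mem ha)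
    · exact Or.inr ⟨_, K.mul_mem (h2 _ (K.inv_mem hk)) (K.inv_mem h1), by group⟩

theorem sl_sq_one {F : Type*} [Field F] (h2 : (2 : F) ≠ 0)
    (A : Matrix.SpecialLinearGroup (Fin 2) F) (h : A ^ 2 = 1) :
    A = 1 ∨ (A : Matrix (Fin 2) (Fin 2) F) = -1 := by
  have hd := A.det_coe
  rw [Matrix.det_fin_two] at hd
  have hm : (A : Matrix (Fin 2) (Fin 2) F) * (A : Matrix (Fin 2) (Fin 2) F) = 1 := by
    rw [← Matrix.SpecialLinearGroup.coe_mul, ← sq, h]; rfl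
  have e00 := congrFun (congrFun hm 0) 0
  have e01 := congrFun (congrFun hm 0) 1
  have e10 := congrFun (congrFun hm 1) 0
  have e11 := congrFun (congrFun hm 1) 1
  simp only [Matrix.mul_apply, Fin.sum_univ_two, Matrix.one_apply_eq] at e00 e01 e10 e11
  rw [Matrix.one_apply_ne (by decide)] at e01 e10
  have ht : A 0 0 + A 1 1 ≠ 0 := by
    intro ht
    apply h2
    linear_combination A 0 0 * ht - e00 - hd
  have b0 : A 0 1 = 0 := by
    apply (mul_eq_zero.mp (_ : A 0 1 * (A 0 0 + A 1 1) = 0)).resolve_right ht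
    linear_combination e01
  have c0 : A 1 0 = 0 := by
    apply (mul_eq_zero.mp (_ : A 1 0 * (A 0 0 + A 1 1) = 0)).resolve_right ht
    linear_combination e10
  rw [b0] at hd e00
  have ha : (A 0 0 - 1) * (A 0 0 + 1) = 0 := by linear_combination e00
  rcases mul_eq_zero.mp ha with ha | ha
  · left
    have ha : A 0 0 = 1 := by linear_combination ha
    rw [ha] at hd
    ext i j
    fin_cases i <;> fin_cases j <;> simp [ha, b0, c0]
    linear_combination hd
  · right
    have ha : A 0 0 = -1 := by linear_combination ha
    rw [ha] at hd
    ext i j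
    fin_cases i <;> fin_cases j <;> simp [ha, b0, c0]
    linear_combination -hd

theorem proj_eq_of_smul {F : Type*} [Field F] (g g' : GL (Fin 2) F) (c : F) (hc : c ≠ 0)
    (h : (g : Matrix (Fin 2) (Fin 2) F) = c • (g' : Matrix (Fin 2) (Fin 2) F)) :
    QuotientGroup.mk' (Subgroup.center (GL (Fin 2) F)) g
      = QuotientGroup.mk' (Subgroup.center (GL (Fin 2) F)) g' := by
  have : g = g' * Matrix.GeneralLinearGroup.scalar (Fin 2) (Units.mk0 c hc) := by
    rw [← Matrix.GeneralLinearGroup.scalar_commute]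
    apply Units.ext
    rw [h, Units.val_mul, Matrix.GeneralLinearGroup.coe_scalar]
    ext i j
    simp [Matrix.scalar_apply]
  rw [this]
  rw [map_mul]
  convert mul_one _
  rw [← MonoidHom.mem_ker, QuotientGroup.ker_mk', Matrix.GeneralLinearGroup.center_eq_range_scalar]
  exact ⟨_, rfl⟩

theorem proj_one_iff {F : Type*} [Field F] (A : Matrix.SpecialLinearGroup (Fin 2) F) :
    projSLtoPGL F A = 1 ↔ (A = 1 ∨ (A : Matrix (Fin 2) (Fin 2) F) = -1) := by
  rw [projSLtoPGL, MonoidHom.comp_apply, ← MonoidHom.mem_ker, QuotientGroup.ker_mk',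
    Matrix.GeneralLinearGroup.mem_center_iff_val_mem_range_scalar,
    Matrix.SpecialLinearGroup.coe_GL_coe_matrix]
  constructor
  · rintro ⟨a, ha⟩
    have hd := A.det_coe
    rw [← ha] at hd
    simp [Matrix.scalar_apply] at hd
    rcases hd with hd | hd
    · left
      apply Subtype.ext
      rw [← ha, hd]; simp
    · right
      rw [← ha, hd, map_neg, map_one]
  · rintro (rfl | h)
    · exact ⟨1, by simp⟩
    · exact ⟨-1, by rw [h, map_neg, map_one]⟩

theorem ker_eq {K F : Type*} [Field K] [Field F] (φ : K →+* F) :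
    ((QuotientGroup.mk' (Subgroup.center (GL (Fin 2) F))).comp
      (Matrix.GeneralLinearGroup.map φ)).ker = Subgroup.center (GL (Fin 2) K) := by
  ext g
  rw [MonoidHom.mem_ker, MonoidHom.comp_apply, ← MonoidHom.mem_ker, QuotientGroup.ker_mk',
    Matrix.GeneralLinearGroup.mem_center_iff_val_mem_range_scalar,
    Matrix.GeneralLinearGroup.mem_center_iff_val_mem_range_scalar]
  constructor
  · rintro ⟨a, ha⟩
    have h (i j) : (Matrix.scalar (Fin 2) a) i j = φ (g i j) := by
      rw [ha]; exact Matrix.GeneralLinearGroup.map_apply φ i j g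
    have h00 := h 0 0
    have h01 := h 0 1
    have h10 := h 1 0
    have h11 := h 1 1
    simp [Matrix.scalar_apply] at h00 h01 h10 h11
    have : g 0 0 = g 1 1 := φ.injective (h00.symm.trans h11)
    have g01 : g 0 1 = 0 := φ.injective (h01.symm.trans (map_zero φ).symm)
    have g10 : g 1 0 = 0 := φ.injective (h10.symm.trans (map_zero φ).symm)
    refine ⟨g 0 0, ?_⟩
    ext i j
    fin_cases i <;> fin_cases j <;> simp [Matrix.scalar_apply, g01, g10, this]
  · rintro ⟨a, ha⟩
    refine ⟨φ a, ?_⟩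
    ext i j
    rw [Matrix.GeneralLinearGroup.map_apply φ i j g, ← ha]
    fin_cases i <;> fin_cases j <;> simp [Matrix.scalar_apply]

/-- A matrix in `GL₂` over `K` divided by a square root. -/
theorem exists_sl {K : Type*} [Field K] (ε : Kˣ) (hε : ∀ u : Kˣ, u ∈ Subgroup.zpowers ε)
    (g : GL (Fin 2) K) : ∃ (c : Kˣ) (B : Matrix.SpecialLinearGroup (Fin 2) K),
      (g : Matrix (Fin 2) (Fin 2) K) = (c : K) • (B : Matrix (Fin 2) (Fin 2) K) ∨
      (g : Matrix (Fin 2) (Fin 2) K) =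
        (c : K) • (Matrix.diagonal ![(ε : K), 1] * (B : Matrix (Fin 2) (Fin 2) K)) := by
  obtain ⟨n, hn⟩ := hε (Matrix.GeneralLinearGroup.det g)
  have hdet : (g : Matrix (Fin 2) (Fin 2) K).det = ((ε ^ n : Kˣ) : K) := by
    rw [← Matrix.GeneralLinearGroup.val_det_apply, ← hn]
  have hε0 : (ε : K) ≠ 0 := ε.ne_zero
  rcases Int.even_or_odd' n with ⟨k, rfl | rfl⟩
  · have hc : ((ε ^ k : Kˣ) : K) ≠ 0 := Units.ne_zero _
    have h : ((ε ^ (2 * k) : Kˣ) : K) = ((ε ^ k : Kˣ) : K) ^ 2 := by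
      rw [mul_comm, _root_.zpow_mul]; norm_cast
    refine ⟨ε ^ k, ⟨((ε ^ k : Kˣ) : K)⁻¹ • (g : Matrix (Fin 2) (Fin 2) K), ?_⟩, Or.inl ?_⟩
    · rw [Matrix.det_smul, hdet, h]
      simp only [Fintype.card_fin]
      field_simp
    · simp only [smul_smul, mul_inv_cancel₀ hc, one_smul]
  · have hc : ((ε ^ k : Kˣ) : K) ≠ 0 := Units.ne_zero _
    have h : ((ε ^ (2 * k + 1) : Kˣ) : K) = ((ε ^ k : Kˣ) : K) ^ 2 * ε := by
      rw [_root_.zpow_add, mul_comm 2, _root_.zpow_mul]; norm_cast; simp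
    refine ⟨ε ^ k, ⟨((ε ^ k : Kˣ) : K)⁻¹ • (Matrix.diagonal ![(ε : K)⁻¹, 1] *
      (g : Matrix (Fin 2) (Fin 2) K)), ?_⟩, Or.inr ?_⟩
    · rw [Matrix.det_smul, Matrix.det_mul, hdet, h, Matrix.det_diagonal]
      simp only [Fintype.card_fin, Fin.prod_univ_two, Matrix.cons_val_zero, Matrix.cons_val_one]
      field_simp
    · have hdd : Matrix.diagonal ![(ε : K), 1] * Matrix.diagonal ![(ε : K)⁻¹, 1] = 1 := by
        rw [Matrix.diagonal_mul_diagonal, ← Matrix.diagonal_one]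
        congr 1
        ext i; fin_cases i <;> simp
      simp only [Matrix.mul_smul, smul_smul, mul_inv_cancel₀ hc, one_smul, ← Matrix.mul_assoc, hdd,
        Matrix.one_mul]

theorem dd_mem {K F : Type*} [Field K] [Field F] (φ : K →+* F) (e : K) (he : e ≠ 0) (s : F)
    (hs : s ^ 2 = φ e) (d : Matrix.SpecialLinearGroup (Fin 2) F)
    (hd : (d : Matrix (Fin 2) (Fin 2) F) = Matrix.diagonal ![s, s⁻¹]) :
    d * d ∈ (Matrix.SpecialLinearGroup.map (n := Fin 2) φ).range := by
  have h : (Matrix.diagonal ![e, e⁻¹]).det = 1 := by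
    simp [Matrix.det_diagonal, Fin.prod_univ_two, he]
  refine ⟨⟨_, h⟩, ?_⟩
  apply Subtype.ext
  rw [Matrix.SpecialLinearGroup.coe_mul, hd]
  change (Matrix.diagonal ![e, e⁻¹]).map φ = _
  ext i j
  fin_cases i <;> fin_cases j <;>
    simp [Matrix.mul_apply, Fin.sum_univ_two, ← hs, sq]

theorem conj_mem {K F : Type*} [Field K] [Field F] (φ : K →+* F) (e : K) (he : e ≠ 0) (s : F)
    (hs : s ^ 2 = φ e) (hs0 : s ≠ 0) (d : Matrix.SpecialLinearGroup (Fin 2) F)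
    (hd : (d : Matrix (Fin 2) (Fin 2) F) = Matrix.diagonal ![s, s⁻¹]) :
    ∀ k ∈ (Matrix.SpecialLinearGroup.map (n := Fin 2) φ).range,
      d⁻¹ * k * d ∈ (Matrix.SpecialLinearGroup.map (n := Fin 2) φ).range := by
  rintro _ ⟨B, rfl⟩
  have h : (!![B 0 0, e⁻¹ * B 0 1; e * B 1 0, B 1 1]).det = 1 := by
    have := B.det_coe
    rw [Matrix.det_fin_two] at this
    rw [Matrix.det_fin_two_of]
    refine Eq.trans ?_ this
    field_simp
  refine ⟨⟨_, h⟩, ?_⟩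
  rw [mul_assoc, eq_inv_mul_iff_mul_eq]
  apply Subtype.ext
  rw [Matrix.SpecialLinearGroup.coe_mul, Matrix.SpecialLinearGroup.coe_mul, hd]
  change _ * (!![B 0 0, e⁻¹ * B 0 1; e * B 1 0, B 1 1]).map φ =
    (B : Matrix (Fin 2) (Fin 2) K).map φ * _
  ext i j
  fin_cases i <;> fin_cases j <;>
    simp [Matrix.mul_apply, Fin.sum_univ_two, ← hs] <;> field_simp

/-- Let `ℓ ≥ 5` be a prime, `F` the field with `ℓ²` elements
(containing `F_ℓ`), `ε` a generator of `F_ℓ^*`, and `s ∈ F` with `s² = ε`. Then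
`H = SL₂(F_ℓ) ∪ diag(s, s⁻¹)·SL₂(F_ℓ)` is a subgroup of `SL₂(F)`; the matrix `-I` is the
unique element of `H` of order 2 and is central in `H`; and the image of `H` in
`PGL₂(F)` is isomorphic to `PGL₂(F_ℓ)`, the projection `H → PGL₂(F_ℓ)` having kernel
`{I, -I}`. Thus `H` is a central extension of `PGL₂(F_ℓ)` by a group of order 2 in which
no lift of an involution of `PGL₂(F_ℓ)` has order 2. -/
theorem two_minus_PGL_extension
    (ℓ : ℕ) [Fact ℓ.Prime] (h5 : 5 ≤ ℓ)
    (F : Type*) [Field F] [Fintype F] [Algebra (ZMod ℓ) F]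
    (hcard : Fintype.card F = ℓ ^ 2)
    (ε : (ZMod ℓ)ˣ) (hε : ∀ u : (ZMod ℓ)ˣ, u ∈ Subgroup.zpowers ε)
    (s : F) (hs : s ^ 2 = algebraMap (ZMod ℓ) F (ε : ZMod ℓ)) :
    ∃ d : Matrix.SpecialLinearGroup (Fin 2) F,
      (d : Matrix (Fin 2) (Fin 2) F) = Matrix.diagonal ![s, s⁻¹] ∧
      ∃ H : Subgroup (Matrix.SpecialLinearGroup (Fin 2) F),
        ((H : Set (Matrix.SpecialLinearGroup (Fin 2) F)) =
          {A | (∃ B : Matrix.SpecialLinearGroup (Fin 2) (ZMod ℓ),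
                  Matrix.SpecialLinearGroup.map (algebraMap (ZMod ℓ) F) B = A) ∨
               (∃ B : Matrix.SpecialLinearGroup (Fin 2) (ZMod ℓ),
                  d * Matrix.SpecialLinearGroup.map (algebraMap (ZMod ℓ) F) B = A)}) ∧
        (∃ z ∈ H, (z : Matrix (Fin 2) (Fin 2) F) = -(1 : Matrix (Fin 2) (Fin 2) F) ∧
          (∀ A ∈ H, orderOf A = 2 ↔ A = z) ∧
          (∀ A ∈ H, z * A = A * z)) ∧
        Nonempty (↥(H.map (projSLtoPGL F)) ≃*
          (GL (Fin 2) (ZMod ℓ) ⧸ Subgroup.center (GL (Fin 2) (ZMod ℓ)))) ∧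
        (∀ A ∈ H, projSLtoPGL F A = 1 ↔
          (A = 1 ∨ (A : Matrix (Fin 2) (Fin 2) F) = -(1 : Matrix (Fin 2) (Fin 2) F))) := by
  generalize algebraMap (ZMod ℓ) F = φ at *
  have hε0 : (ε : ZMod ℓ) ≠ 0 := ε.ne_zero
  have hφε : φ (ε : ZMod ℓ) ≠ 0 := by simp
  have hs0 : s ≠ 0 := by
    rintro rfl
    apply hφε
    rw [← hs]; simp
  have h2 : (2 : F) ≠ 0 := by
    have h2' : (2 : ZMod ℓ) ≠ 0 := by
      intro h
      have : ((2 : ℕ) : ZMod ℓ) = 0 := by exact_mod_cast h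
      rw [ZMod.natCast_eq_zero_iff] at this
      have := Nat.le_of_dvd (by norm_num) this
      omega
    intro h
    apply h2'
    apply φ.injective
    rw [map_ofNat, map_zero]; exact h
  let d : Matrix.SpecialLinearGroup (Fin 2) F := ⟨Matrix.diagonal ![s, s⁻¹], by
    simp [Matrix.det_diagonal, Fin.prod_univ_two, hs0]⟩
  let K := (Matrix.SpecialLinearGroup.map (n := Fin 2) φ).range
  have h1 : d * d ∈ K := dd_mem φ _ hε0 s hs d rfl
  have h3 : ∀ k ∈ K, d⁻¹ * k * d ∈ K := conj_mem φ _ hε0 s hs hs0 d rfl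
  let H := unionSubgroup K d h1 h3
  have hz : ∀ A : Matrix.SpecialLinearGroup (Fin 2) F,
      (A : Matrix (Fin 2) (Fin 2) F) = -1 ↔ A = -1 := by
    intro A
    exact ⟨fun h => Subtype.ext (by rw [h]; simp), fun h => by rw [h]; simp⟩
  have hH : (H : Set (Matrix.SpecialLinearGroup (Fin 2) F)) =
          {A | (∃ B : Matrix.SpecialLinearGroup (Fin 2) (ZMod ℓ),
                  Matrix.SpecialLinearGroup.map φ B = A) ∨
               (∃ B : Matrix.SpecialLinearGroup (Fin 2) (ZMod ℓ),
                  d * Matrix.SpecialLinearGroup.map φ B = A)} := by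
    ext A
    constructor
    · rintro (⟨B, rfl⟩ | ⟨_, ⟨B, rfl⟩, rfl⟩)
      · exact Or.inl ⟨B, rfl⟩
      · exact Or.inr ⟨B, rfl⟩
    · rintro (⟨B, rfl⟩ | ⟨B, rfl⟩)
      · exact Or.inl ⟨B, rfl⟩
      · exact Or.inr ⟨_, ⟨B, rfl⟩, rfl⟩
  have hne : (-1 : Matrix.SpecialLinearGroup (Fin 2) F) ≠ 1 := by
    intro h
    have := congrArg (fun A : Matrix.SpecialLinearGroup (Fin 2) F => A 0 0) h
    simp at this
    apply h2
    linear_combination -this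
  have hdiag : (d : Matrix (Fin 2) (Fin 2) F) =
      s⁻¹ • Matrix.diagonal ![φ (ε : ZMod ℓ), 1] := by
    ext i j
    fin_cases i <;> fin_cases j <;> simp [d, ← hs] <;> field_simp
  have hB : ∀ B : Matrix.SpecialLinearGroup (Fin 2) (ZMod ℓ),
      ((Matrix.SpecialLinearGroup.map φ B : Matrix.SpecialLinearGroup (Fin 2) F) :
        Matrix (Fin 2) (Fin 2) F) = (B : Matrix (Fin 2) (Fin 2) (ZMod ℓ)).map φ := fun _ => rfl
  have hG : ∀ g : GL (Fin 2) (ZMod ℓ), ((Matrix.GeneralLinearGroup.map φ g : GL (Fin 2) F) :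
      Matrix (Fin 2) (Fin 2) F) = (g : Matrix (Fin 2) (Fin 2) (ZMod ℓ)).map φ := fun _ => rfl
  have hD : (Matrix.diagonal ![(ε : ZMod ℓ), 1]).map φ =
      Matrix.diagonal ![φ (ε : ZMod ℓ), 1] := by
    ext i j
    fin_cases i <;> fin_cases j <;> simp
  refine ⟨d, rfl, H, hH, ⟨-1, ?_, by simp, ?_, ?_⟩, ?_, ?_⟩
  · left
    refine ⟨-1, ?_⟩
    ext i j
    fin_cases i <;> fin_cases j <;> simp
  · intro A _
    constructor
    · intro h
      have := pow_orderOf_eq_one A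
      rw [h] at this
      rcases sl_sq_one h2 A this with rfl | h'
      · simp at h
      · exact (hz A).mp h'
    · rintro rfl
      exact orderOf_eq_prime (by simp) hne
  · intro A _
    simp
  · have hr : ((QuotientGroup.mk' (Subgroup.center (GL (Fin 2) F))).comp
      (Matrix.GeneralLinearGroup.map φ)).range = H.map (projSLtoPGL F) := by
      apply le_antisymm
      · rintro _ ⟨g, rfl⟩
        obtain ⟨c, B, h | h⟩ := exists_sl ε hε g
        · refine ⟨_, Or.inl ⟨B, rfl⟩, Eq.symm ?_⟩
          apply proj_eq_of_smul _ _ (φ c) (by simp)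
          rw [Matrix.SpecialLinearGroup.coe_GL_coe_matrix, hB, hG, h]
          ext i j; simp
        · refine ⟨_, Or.inr ⟨_, ⟨B, rfl⟩, rfl⟩, Eq.symm ?_⟩
          apply proj_eq_of_smul _ _ (φ c * s) (by simp [hs0])
          rw [Matrix.SpecialLinearGroup.coe_GL_coe_matrix, Matrix.SpecialLinearGroup.coe_mul, hB,
            hG, h, hdiag, Matrix.smul_mul, smul_smul, mul_assoc, mul_inv_cancel₀ hs0, mul_one, ← hD,
            ← Matrix.map_mul]
          ext i j; simp
      · rintro _ ⟨A, hA, rfl⟩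
        have hA' : A ∈ (H : Set (Matrix.SpecialLinearGroup (Fin 2) F)) := hA
        rw [hH] at hA'
        rcases hA' with ⟨B, rfl⟩ | ⟨B, rfl⟩
        · exact ⟨Matrix.SpecialLinearGroup.toGL B, by
            apply proj_eq_of_smul _ _ 1 one_ne_zero
            rw [one_smul]; rfl⟩
        · refine ⟨Matrix.GeneralLinearGroup.mkOfDetNeZero (Matrix.diagonal ![(ε : ZMod ℓ), 1]) (by
            simp [Matrix.det_diagonal, Fin.prod_univ_two]) * Matrix.SpecialLinearGroup.toGL B,
            Eq.symm ?_⟩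
          apply proj_eq_of_smul _ _ s⁻¹ (inv_ne_zero hs0)
          rw [Matrix.SpecialLinearGroup.coe_GL_coe_matrix, Matrix.SpecialLinearGroup.coe_mul, hB,
            hG, hdiag, Matrix.smul_mul, ← hD, ← Matrix.map_mul]
          rfl
    exact ⟨(MulEquiv.subgroupCongr hr.symm).trans ((QuotientGroup.quotientKerEquivRange _).symm.trans
      (QuotientGroup.quotientMulEquivOfEq (ker_eq φ)))⟩
  · intro A _
    exact proj_one_iff A
end

section
/- For every prime ℓ ≥ 5 and every integer i ≥ 1, the second group cohomology group H²(PSL₂(F_ℓ), ℤ/2^iℤ), taken with respect to the trivial action of PSL₂(F_ℓ) on ℤ/2^iℤ, is isomorphic as an abelian group to ℤ/2ℤ. -/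
namespace SLTwo

/-- Steinberg data -/
structure Stein (F E : Type*) [Field F] [Group E] where
  x : F → E
  y : F → E
  w : F → E
  hx : ∀ a b, x (a + b) = x a * x b
  hy : ∀ a b, y (a + b) = y a * y b
  hw : ∀ t, w t = x t * y (-t⁻¹) * x t
  wx : ∀ t r, t ≠ 0 → w t * x r = y (-r / t ^ 2) * w t
  wy : ∀ t r, t ≠ 0 → w t * y r = x (-t ^ 2 * r) * w t

namespace Stein
variable {F E : Type*} [Field F] [Group E] (S : Stein F E)

/-- torus -/
def h (t : F) : E := S.w t * S.w (-1)

lemma x0 : S.x 0 = 1 := by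
  have := S.hx 0 0
  simpa using this

lemma y0 : S.y 0 = 1 := by
  have := S.hy 0 0
  simpa using this

lemma xinv (a : F) : (S.x a)⁻¹ = S.x (-a) := by
  rw [inv_eq_iff_mul_eq_one, ← S.hx, add_neg_cancel, S.x0]

lemma yinv (a : F) : (S.y a)⁻¹ = S.y (-a) := by
  rw [inv_eq_iff_mul_eq_one, ← S.hy, add_neg_cancel, S.y0]

lemma winv (t : F) : (S.w t)⁻¹ = S.w (-t) := by
  rw [S.hw, S.hw, mul_inv_rev, mul_inv_rev, S.xinv, S.yinv, inv_neg, mul_assoc]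

lemma wmul (t : F) : S.w t * S.w (-t) = 1 := by
  rw [← S.winv, mul_inv_cancel]

lemma h_one : S.h 1 = 1 := S.wmul 1

lemma conj_w {t s : F} (ht : t ≠ 0) :
    S.w t * S.w s = S.y (-s / t ^ 2) * S.x (t ^ 2 * s⁻¹) * S.y (-s / t ^ 2) * S.w t := by
  rw [S.hw s, ← mul_assoc, ← mul_assoc, S.wx t _ ht, mul_assoc (S.y _) (S.w t), S.wy t _ ht,
    mul_assoc, mul_assoc (S.x _), S.wx t _ ht]
  simp only [mul_assoc, neg_mul_neg]

lemma w_alt {t : F} (ht : t ≠ 0) : S.w t = S.y (-t⁻¹) * S.x t * S.y (-t⁻¹) := by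
  have := S.conj_w (s := t) ht
  rw [mul_left_inj] at this
  rw [this]
  congr <;> field_simp

lemma w_conj {t s : F} (ht : t ≠ 0) (hs : s ≠ 0) :
    S.w t * S.w s = S.w (t ^ 2 / s) * S.w t := by
  rw [S.conj_w ht, S.w_alt (t := t ^ 2 / s) (by positivity)]
  have e1 : -(t ^ 2 / s)⁻¹ = -s / t ^ 2 := by field_simp
  rw [e1, div_eq_mul_inv (t ^ 2) s]

lemma hw_conj {t s : F} (ht : t ≠ 0) (hs : s ≠ 0) :
    S.h t * S.w s = S.w (t ^ 2 * s) * S.h t := by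
  rw [h, mul_assoc, S.w_conj (by simp) hs, ← mul_assoc, S.w_conj ht (by simp [hs]), mul_assoc]
  congr 2
  field_simp

lemma hh {t s : F} (ht : t ≠ 0) (hs : s ≠ 0) :
    S.h t * S.h s = S.h (t ^ 2 * s) * (S.h (t ^ 2))⁻¹ * S.h t := by
  have h1 : S.h t * S.h s = S.w (t ^ 2 * s) * S.w (t ^ 2 * (-1)) * S.h t := by
    conv_lhs => rw [h.eq_def S s]
    rw [← mul_assoc, S.hw_conj ht hs, mul_assoc, S.hw_conj ht (by simp), mul_assoc]
  rw [h1]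
  congr 1
  rw [h, h, mul_inv_rev, S.winv (-1), S.winv, mul_assoc (S.w _), ← mul_assoc (S.w (-1)),
    S.wmul, one_mul]
  congr 2
  ring

lemma w_mul_w_mul {t : F} (ht : t ≠ 0) (ht1 : 1 - t ≠ 0) :
    S.w t * S.w (-1) * S.w (1 - t) = S.w (t * (1 - t)) := by
  have a1 : S.x (t * (1 - t)) * S.y (-t⁻¹) = S.w t * S.y 1 * S.x (-t) := by
    rw [S.wy t 1 ht, S.hw t, mul_assoc, mul_assoc, mul_assoc, ← S.hx t (-t), add_neg_cancel, S.x0,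
      mul_one, ← mul_assoc, ← S.hx]
    rw [mul_one]
    congr 2
    ring
  have a2 : S.y (-(1 - t)⁻¹) * S.x (t * (1 - t)) = S.x (t - 1) * S.y 1 * S.w (1 - t) := by
    have : S.y 1 * S.w (1 - t) = S.w (1 - t) * S.x (- (1 - t) ^ 2) := by
      rw [S.wx _ _ ht1]
      congr 2
      field_simp
    rw [mul_assoc, this, S.hw (1 - t), ← mul_assoc, ← mul_assoc, ← mul_assoc, ← S.hx]
    rw [show t - 1 + (1 - t) = 0 by ring, S.x0, one_mul, mul_assoc, ← S.hx]
    congr 2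
    ring
  rw [S.hw (t * (1 - t)), show -(t * (1 - t))⁻¹ = -t⁻¹ + -(1 - t)⁻¹ by field_simp; ring, S.hy,
    ← mul_assoc, a1, mul_assoc (_ * S.x (-t)), a2, S.w_alt (t := -1) (by simp)]
  simp only [mul_assoc]
  congr 1
  rw [← mul_assoc (S.x (-t)), ← S.hx]
  simp only [inv_neg, inv_one, neg_neg]
  congr 3
  ring

lemma h_pair {t : F} (ht : t ≠ 0) (ht1 : 1 - t ≠ 0) :
    S.h t * S.h (1 - t) = S.h (t * (1 - t)) := by
  rw [h, h, h, ← mul_assoc, S.w_mul_w_mul ht ht1]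

section comm
variable (hc : ∀ s t : F, s ≠ 0 → t ≠ 0 → S.h s * S.h t = S.h t * S.h s)
include hc

lemma h_sq {t s : F} (ht : t ≠ 0) (hs : s ≠ 0) : S.h (t ^ 2 * s) = S.h (t ^ 2) * S.h s := by
  have := S.hh ht hs
  rw [hc t s ht hs, mul_left_inj, eq_mul_inv_iff_mul_eq] at this
  rw [← this, hc _ _ hs (by positivity)]

variable (hp : ∃ t : F, ¬ IsSquare t ∧ ¬ IsSquare (1 - t))
  (hn : ∀ s t : F, ¬ IsSquare s → ¬ IsSquare t → ∃ a, a ≠ 0 ∧ s = a ^ 2 * t)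
include hp hn

lemma h_mul {s t : F} (hs : s ≠ 0) (ht : t ≠ 0) : S.h (s * t) = S.h s * S.h t := by
  by_cases h1 : IsSquare s
  · obtain ⟨a, rfl⟩ := h1
    have ha : a ≠ 0 := by rintro rfl; simp at hs
    rw [← pow_two, S.h_sq hc ha ht]
  by_cases h2 : IsSquare t
  · obtain ⟨a, rfl⟩ := h2
    have ha : a ≠ 0 := by rintro rfl; simp at ht
    rw [mul_comm, ← pow_two, S.h_sq hc ha hs, hc _ _ hs (by positivity)]
  obtain ⟨p, hp1, hp2⟩ := hp
  obtain ⟨a, ha, rfl⟩ := hn s p h1 hp1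
  obtain ⟨b, hb, rfl⟩ := hn t (1 - p) h2 hp2
  have hp0 : p ≠ 0 := by rintro rfl; simp at hp1
  have hp0' : 1 - p ≠ 0 := by intro h; simp [h] at hp2
  rw [show a ^ 2 * p * (b ^ 2 * (1 - p)) = a ^ 2 * (b ^ 2 * (p * (1 - p))) by ring,
    S.h_sq hc ha (by positivity), S.h_sq hc hb (by positivity), S.h_sq hc ha hp0,
    S.h_sq hc hb hp0', ← S.h_pair hp0 hp0', ← mul_assoc (S.h (b ^ 2)),
    hc (b ^ 2) p (by positivity) hp0]
  simp only [mul_assoc]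

lemma h_inv {s : F} (hs : s ≠ 0) : (S.h s)⁻¹ = S.h s⁻¹ := by
  rw [inv_eq_iff_mul_eq_one, ← S.h_mul hc hp hn hs (by positivity), mul_inv_cancel₀ hs, S.h_one]

lemma h_w {s t : F} (hs : s ≠ 0) (ht : t ≠ 0) : S.h s * S.w t = S.w (s * t) := by
  have key : ∀ r, S.w r = S.h r * S.w 1 := by
    intro r
    have := S.wmul (-1)
    rw [neg_neg] at this
    rw [h, mul_assoc, this, mul_one]
  rw [key t, key (s * t), S.h_mul hc hp hn hs ht, mul_assoc]

lemma w1_w {t : F} (ht : t ≠ 0) : S.w 1 * S.w t = S.h (-t⁻¹) := by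
  have : S.h (-t⁻¹) = (S.h (-t))⁻¹ := by rw [S.h_inv hc hp hn (by simpa), inv_neg]
  rw [this, h, mul_inv_rev, S.winv, S.winv, neg_neg, neg_neg]

omit hp hn hc in
lemma w1_h {t : F} (ht : t ≠ 0) : S.w 1 * S.h t = S.w t⁻¹ := by
  rw [h, ← mul_assoc, S.w_conj one_ne_zero ht, mul_assoc, S.wmul, mul_one]
  congr 1
  simp

lemma w1_x_w {p t : F} (hp0 : p ≠ 0) (ht : t ≠ 0) :
    S.w 1 * (S.x p * S.w t) = S.x (-p⁻¹) * S.w (-(t / p)) * S.x (-t ^ 2 / p) := by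
  have e : S.x p = S.y p⁻¹ * S.w p * S.y p⁻¹ := by
    rw [S.w_alt hp0, ← S.yinv]; group
  have e2 : S.y p⁻¹ * S.w t = S.w t * S.x (-t ^ 2 / p) := by
    rw [S.wx t _ ht]
    congr 2
    field_simp
  rw [e, mul_assoc, mul_assoc, e2, ← mul_assoc, S.wy 1 _ one_ne_zero, ← mul_assoc, mul_assoc,
    mul_assoc, ← mul_assoc (S.w 1), S.w1_w hc hp hn hp0, ← mul_assoc (S.h _),
    S.h_w hc hp hn (by simpa) ht, mul_assoc]
  congr 3
  · ring
  · ring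

omit hp hn hc in
lemma h_x {t : F} (ht : t ≠ 0) (r : F) : S.h t * S.x r = S.x (t ^ 2 * r) * S.h t := by
  rw [h, mul_assoc, S.wx _ _ (by simp), ← mul_assoc, S.wy _ _ ht, mul_assoc]
  congr 2
  ring
end comm
end Stein
end SLTwo
set_option linter.unusedSimpArgs false
namespace SLTwo
open Matrix

section
variable {F : Type*} [Field F]

/-- upper -/
def u (r : F) : SpecialLinearGroup (Fin 2) F := ⟨!![1, r; 0, 1], by simp⟩
/-- lower -/
def v (r : F) : SpecialLinearGroup (Fin 2) F := ⟨!![1, 0; r, 1], by simp⟩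
/-- Weyl -/
def w1 : SpecialLinearGroup (Fin 2) F := ⟨!![0, 1; -1, 0], by simp⟩

lemma mul_ij (A B : SpecialLinearGroup (Fin 2) F) (i j : Fin 2) :
    (A * B) i j = A i 0 * B 0 j + A i 1 * B 1 j := by
  have := Matrix.mul_apply (M := A.1) (N := B.1) (i := i) (k := j)
  rw [Fin.sum_univ_two] at this
  exact this

lemma u_coe (r : F) : (u r).1 = !![1, r; 0, 1] := rfl
lemma v_coe (r : F) : (v r).1 = !![1, 0; r, 1] := rfl
lemma w1_coe : (w1 : SpecialLinearGroup (Fin 2) F).1 = !![0, 1; -1, 0] := rfl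

lemma u_add (a b : F) : u (a + b) = u a * u b := by
  ext i j; fin_cases i <;> fin_cases j <;> simp [mul_ij, u_coe, v_coe, w1_coe, add_comm]

lemma v_add (a b : F) : v (a + b) = v a * v b := by
  ext i j; fin_cases i <;> fin_cases j <;> simp [mul_ij, u_coe, v_coe, w1_coe, add_comm]

lemma v_eq (r : F) : v r = w1 * u (-r) * w1⁻¹ := by
  rw [eq_mul_inv_iff_mul_eq]
  ext i j; fin_cases i <;> fin_cases j <;> simp [mul_ij, u_coe, v_coe, w1_coe]

lemma w1_eq : (w1 : SpecialLinearGroup (Fin 2) F) = u 1 * v (-1) * u 1 := by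
  ext i j; fin_cases i <;> fin_cases j <;> simp [mul_ij, u_coe, v_coe, w1_coe]

lemma w1_inv : (w1 : SpecialLinearGroup (Fin 2) F)⁻¹ = w1 * (w1 * w1) := by
  rw [inv_eq_iff_mul_eq_one]
  ext i j; fin_cases i <;> fin_cases j <;> simp [mul_ij, u_coe, v_coe, w1_coe]

lemma g_det (g : SpecialLinearGroup (Fin 2) F) : g 0 0 * g 1 1 - g 0 1 * g 1 0 = 1 := by
  have := g.2
  rwa [Matrix.det_fin_two] at this

lemma g_eq1 (g : SpecialLinearGroup (Fin 2) F) (hg : g 1 0 ≠ 0) :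
    g = u (g 0 0 / g 1 0) * (u (-1 / g 1 0) * v (g 1 0) * u (-1 / g 1 0)) * u (g 1 1 / g 1 0) := by
  have := g_det g
  ext i j; fin_cases i <;> fin_cases j <;> simp [mul_ij, u_coe, v_coe, w1_coe] <;> field_simp
  · ring
  · linear_combination -this
  · ring

lemma g_eq0 (g : SpecialLinearGroup (Fin 2) F) (hg : g 1 0 = 0) :
    g = (u (g 0 0) * v (-1 / g 0 0) * u (g 0 0)) * w1⁻¹ * u (g 0 1 / g 0 0) := by
  have := g_det g
  rw [hg, mul_zero, sub_zero] at this
  have h0 : g 0 0 ≠ 0 := by intro h; simp [h] at this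
  have h1 : g 1 1 = (g 0 0)⁻¹ := by field_simp; linear_combination this
  rw [w1_inv]
  ext i j; fin_cases i <;> fin_cases j <;> simp [mul_ij, u_coe, v_coe, w1_coe, hg, h1] <;> field_simp <;> simp

lemma gen (P : Submonoid (SpecialLinearGroup (Fin 2) F)) (hu : ∀ r, u r ∈ P) (hw : w1 ∈ P) (g) :
    g ∈ P := by
  have hwi : (w1 : SpecialLinearGroup (Fin 2) F)⁻¹ ∈ P := by
    rw [w1_inv]; exact P.mul_mem hw (P.mul_mem hw hw)
  have hv : ∀ r, v r ∈ P := fun r => by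
    rw [v_eq]; exact P.mul_mem (P.mul_mem hw (hu _)) hwi
  by_cases hg : g 1 0 = 0
  · rw [g_eq0 g hg]
    exact P.mul_mem (P.mul_mem (P.mul_mem (P.mul_mem (hu _) (hv _)) (hu _)) hwi) (hu _)
  · rw [g_eq1 g hg]
    exact P.mul_mem (P.mul_mem (hu _) (P.mul_mem (P.mul_mem (hu _) (hv _)) (hu _))) (hu _)

end

namespace Stein
variable {F E : Type*} [Field F] [Group E] (S : Stein F E)

open Classical in
/-- section -/
noncomputable def sig (g : SpecialLinearGroup (Fin 2) F) : E :=
  if g 1 0 = 0 then S.h (g 0 0) * S.x (g 0 1 / g 0 0) else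
    S.x (g 0 0 / g 1 0) * S.w (-1 / g 1 0) * S.x (g 1 1 / g 1 0)

lemma sig_u (r : F) (g : SpecialLinearGroup (Fin 2) F) : S.sig (u r * g) = S.x r * S.sig g := by
  have hd := g_det g
  have e1 : (u r * g) 0 0 = g 0 0 + r * g 1 0 := by simp [mul_ij, u_coe, v_coe, w1_coe]
  have e2 : (u r * g) 0 1 = g 0 1 + r * g 1 1 := by simp [mul_ij, u_coe, v_coe, w1_coe]
  have e3 : (u r * g) 1 0 = g 1 0 := by simp [mul_ij, u_coe, v_coe, w1_coe]
  have e4 : (u r * g) 1 1 = g 1 1 := by simp [mul_ij, u_coe, v_coe, w1_coe]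
  rw [sig, sig, e1, e2, e3, e4]
  generalize g 0 0 = a at *
  generalize g 0 1 = b at *
  generalize g 1 0 = c at *
  generalize g 1 1 = d at *
  split_ifs with hc
  · subst hc
    have ha : a ≠ 0 := by rintro rfl; simp at hd
    have : S.x r * S.h a = S.h a * S.x (r / a ^ 2) := by
      rw [S.h_x ha]; congr 2; field_simp
    rw [← mul_assoc, this, mul_assoc, ← S.hx, mul_zero, add_zero]
    congr 2
    field_simp
    linear_combination r * hd
  · rw [← mul_assoc, ← mul_assoc, ← S.hx]
    congr 3
    field_simp
    ring

section comm
variable (hc : ∀ s t : F, s ≠ 0 → t ≠ 0 → S.h s * S.h t = S.h t * S.h s)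
  (hp : ∃ t : F, ¬ IsSquare t ∧ ¬ IsSquare (1 - t))
  (hn : ∀ s t : F, ¬ IsSquare s → ¬ IsSquare t → ∃ a, a ≠ 0 ∧ s = a ^ 2 * t)
include hc hp hn

lemma sig_w (g : SpecialLinearGroup (Fin 2) F) : S.sig ((w1 : SpecialLinearGroup (Fin 2) F) * g) = S.w 1 * S.sig g := by
  have hd := g_det g
  have e1 : ((w1 : SpecialLinearGroup (Fin 2) F) * g) 0 0 = g 1 0 := by simp [mul_ij, u_coe, v_coe, w1_coe]
  have e2 : ((w1 : SpecialLinearGroup (Fin 2) F) * g) 0 1 = g 1 1 := by simp [mul_ij, u_coe, v_coe, w1_coe]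
  have e3 : ((w1 : SpecialLinearGroup (Fin 2) F) * g) 1 0 = - g 0 0 := by simp [mul_ij, u_coe, v_coe, w1_coe]
  have e4 : ((w1 : SpecialLinearGroup (Fin 2) F) * g) 1 1 = - g 0 1 := by simp [mul_ij, u_coe, v_coe, w1_coe]
  rw [sig, sig, e1, e2, e3, e4]
  generalize g 0 0 = a at *
  generalize g 0 1 = b at *
  generalize g 1 0 = c at *
  generalize g 1 1 = d at *
  by_cases hc0 : c = 0
  · subst hc0
    have ha : a ≠ 0 := by rintro rfl; simp at hd
    rw [if_neg (by simpa), if_pos rfl, ← mul_assoc, S.w1_h ha, zero_div, S.x0, one_mul, neg_div_neg_eq,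
      neg_div_neg_eq, one_div]
  · rw [if_neg hc0]
    by_cases ha : a = 0
    · subst ha
      rw [if_pos (by simp), zero_div, S.x0, one_mul, ← mul_assoc, S.w1_w hc hp hn (by simpa)]
      congr 2
      field_simp
    · rw [if_neg (by simpa), ← mul_assoc, S.w1_x_w hc hp hn (by positivity) (by simpa), mul_assoc,
        mul_assoc, ← S.hx, mul_assoc]
      congr 2
      · field_simp
      · congr 1
        field_simp
      · congr 1
        field_simp
        linear_combination -hd

lemma exists_hom : ∃ σ : SpecialLinearGroup (Fin 2) F →* E,
    (∀ r, σ (u r) = S.x r) ∧ σ w1 = S.w 1 := by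
  have h1 : S.sig 1 = 1 := by simp [sig, S.h_one, S.x0]
  have hu : ∀ r, S.sig (u r) = S.x r := fun r => by
    have := S.sig_u r 1
    rwa [mul_one, h1, mul_one] at this
  have hw : S.sig w1 = S.w 1 := by
    have := S.sig_w hc hp hn 1
    rwa [mul_one, h1, mul_one] at this
  let P : Submonoid (SpecialLinearGroup (Fin 2) F) :=
    { carrier := {g | ∀ s, S.sig (g * s) = S.sig g * S.sig s}
      one_mem' := by simp [h1]
      mul_mem' := by
        intro a b ha hb s
        simp only [Set.mem_ofPred_eq] at ha hb
        rw [mul_assoc, ha, hb, ha, mul_assoc] }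
  have key := gen P (fun r s => by rw [S.sig_u, hu]) (fun s => by rw [S.sig_w hc hp hn, hw])
  exact ⟨⟨⟨S.sig, h1⟩, fun a b => key a b⟩, hu, hw⟩
end comm
end Stein
end SLTwo
namespace SLTwo
open Matrix

section squares
variable {ℓ : ℕ} [Fact ℓ.Prime]

lemma nonsq_mul (h2 : ℓ ≠ 2) (s t : ZMod ℓ) (hs : ¬ IsSquare s) (ht : ¬ IsSquare t) :
    ∃ a, a ≠ 0 ∧ s = a ^ 2 * t := by
  have hF : ringChar (ZMod ℓ) ≠ 2 := by rwa [ZMod.ringChar_zmod_n]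
  have hs0 : s ≠ 0 := by rintro rfl; simp at hs
  have ht0 : t ≠ 0 := by rintro rfl; simp at ht
  have h1 := (quadraticChar_neg_one_iff_not_isSquare (F := ZMod ℓ)).2 hs
  have h3 := (quadraticChar_neg_one_iff_not_isSquare (F := ZMod ℓ)).2 ht
  have h4 : quadraticChar (ZMod ℓ) (s * t) = 1 := by rw [map_mul, h1, h3]; rfl
  rw [quadraticChar_one_iff_isSquare (by positivity)] at h4
  obtain ⟨b, hb⟩ := h4
  have hb0 : b ≠ 0 := by rintro rfl; simp [hs0, ht0] at hb
  refine ⟨b / t, by positivity, ?_⟩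
  field_simp
  linear_combination hb

lemma exists_pair (h2 : ℓ ≠ 2) : ∃ t : ZMod ℓ, ¬ IsSquare t ∧ ¬ IsSquare (1 - t) := by
  by_contra! hcon
  have hF : ringChar (ZMod ℓ) ≠ 2 := by rwa [ZMod.ringChar_zmod_n]
  have hm1 : ¬ IsSquare (-1 : ZMod ℓ) := by
    rintro ⟨c, hc⟩
    obtain ⟨t, ht⟩ := FiniteField.exists_nonsquare hF
    have ht0 : t ≠ 0 := by rintro rfl; simp at ht
    obtain ⟨b, hb⟩ := hcon t ht
    have hb0 : b ≠ 0 := by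
      rintro rfl
      apply ht
      exact ⟨1, by linear_combination -hb⟩
    obtain ⟨d, hd⟩ := hcon t⁻¹ (by
      rintro ⟨e, he⟩
      apply ht
      refine ⟨e⁻¹, ?_⟩
      rw [← mul_inv, ← he, inv_inv])
    have hd' : t * (d * d) = t - 1 := by rw [← hd]; field_simp
    have hd0 : d ≠ 0 := by
      rintro rfl
      apply hb0
      have : b * b = 0 := by rw [← hb]; linear_combination hd'
      simpa using this
    apply ht
    refine ⟨c * b / d, ?_⟩
    field_simp
    linear_combination hd' - hb + b ^ 2 * hc
  have key : ∀ n : ℕ, IsSquare (n : ZMod ℓ) := by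
    intro n
    induction n with
    | zero => simp
    | succ n ih =>
      obtain ⟨b, hb⟩ := ih
      by_cases hb0 : b = 0
      · subst hb0
        rw [Nat.cast_succ, hb]
        exact ⟨1, by ring⟩
      · have := hcon (-(b * b)) (by
          rintro ⟨c, hc⟩
          apply hm1
          refine ⟨c / b, ?_⟩
          field_simp
          linear_combination hc)
        rwa [sub_neg_eq_add, ← hb, add_comm, ← Nat.cast_succ] at this
  apply hm1
  have := key (-1 : ZMod ℓ).val
  rwa [ZMod.natCast_zmod_val] at this
end squares

section ext
variable {ℓ : ℕ} [Fact ℓ.Prime] {E : Type*} [Group E]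

lemma u_pow (r : ZMod ℓ) (n : ℕ) : u r ^ n = u (n * r) := by
  induction n with
  | zero => 
    have := u_add (0 : ZMod ℓ) 0
    simp only [add_zero, left_eq_mul] at this
    simp [this]
  | succ n ih => rw [pow_succ, ih, ← u_add]; congr 1; push_cast; ring

lemma v_pow (r : ZMod ℓ) (n : ℕ) : v r ^ n = v (n * r) := by
  induction n with
  | zero => 
    have := v_add (0 : ZMod ℓ) 0
    simp only [add_zero, left_eq_mul] at this
    simp [this]
  | succ n ih => rw [pow_succ, ih, ← v_add]; congr 1; push_cast; ring

lemma u_prime (r : ZMod ℓ) : u r ^ ℓ = 1 := by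
  rw [u_pow, ← pow_zero (u r), u_pow]; simp

lemma v_prime (r : ZMod ℓ) : v r ^ ℓ = 1 := by
  rw [v_pow, ← pow_zero (v r), v_pow]; simp

/-- diagonal -/
def D (ℓ : ℕ) [Fact ℓ.Prime] : (ZMod ℓ)ˣ →* SpecialLinearGroup (Fin 2) (ZMod ℓ) where
  toFun t := ⟨!![(t : ZMod ℓ), 0; 0, (t⁻¹ : (ZMod ℓ)ˣ)], by
    rw [Matrix.det_fin_two_of, Units.mul_inv, mul_zero, sub_zero]⟩
  map_one' := by ext i j; fin_cases i <;> fin_cases j <;> simp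
  map_mul' a b := by
    ext i j
    refine Eq.trans ?_ (mul_ij _ _ _ _).symm
    fin_cases i <;> fin_cases j
    · change ((a * b : (ZMod ℓ)ˣ) : ZMod ℓ) = a * b + 0 * 0
      rw [Units.val_mul, mul_zero, add_zero]
    · change (0 : ZMod ℓ) = a * 0 + 0 * (b⁻¹ : (ZMod ℓ)ˣ)
      rw [mul_zero, zero_mul, add_zero]
    · change (0 : ZMod ℓ) = 0 * b + (a⁻¹ : (ZMod ℓ)ˣ) * 0
      rw [mul_zero, zero_mul, add_zero]
    · change (((a * b)⁻¹ : (ZMod ℓ)ˣ) : ZMod ℓ) = 0 * 0 + (a⁻¹ : (ZMod ℓ)ˣ) * (b⁻¹ : (ZMod ℓ)ˣ)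
      rw [mul_inv, Units.val_mul, mul_zero, zero_add]

lemma D_coe (t : (ZMod ℓ)ˣ) : (D ℓ t).1 = !![(t : ZMod ℓ), 0; 0, (t⁻¹ : (ZMod ℓ)ˣ)] := rfl

lemma D_eq {t : ZMod ℓ} (ht : t ≠ 0) :
    u t * v (-t⁻¹) * u t * (u (-1) * v (-(-1)⁻¹) * u (-1)) = D ℓ (Units.mk0 t ht) := by
  ext i j
  fin_cases i <;> fin_cases j <;> simp [mul_ij, u_coe, v_coe, D_coe, ht]

lemma wu {t : ZMod ℓ} (ht : t ≠ 0) (r : ZMod ℓ) :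
    (u t * v (-t⁻¹) * u t) * u r * (u t * v (-t⁻¹) * u t)⁻¹ = v (-r / t ^ 2) := by
  rw [mul_inv_eq_iff_eq_mul]
  ext i j
  fin_cases i <;> fin_cases j <;> simp [mul_ij, u_coe, v_coe, ht]
  field_simp

lemma wv {t : ZMod ℓ} (ht : t ≠ 0) (r : ZMod ℓ) :
    (u t * v (-t⁻¹) * u t) * v r * (u t * v (-t⁻¹) * u t)⁻¹ = u (-t ^ 2 * r) := by
  rw [mul_inv_eq_iff_eq_mul]
  ext i j
  fin_cases i <;> fin_cases j <;> simp [mul_ij, u_coe, v_coe, ht]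
  field_simp

theorem split (h2 : ℓ ≠ 2) (π : E →* SpecialLinearGroup (Fin 2) (ZMod ℓ))
    (hs : Function.Surjective π) (N : ℕ) (hN : ℓ.Coprime N)
    (hcen : ∀ k, π k = 1 → ∀ e, k * e = e * k) (hpow : ∀ k, π k = 1 → k ^ N = 1) :
    ∃ σ : SpecialLinearGroup (Fin 2) (ZMod ℓ) →* E, ∀ g, π (σ g) = g := by
  obtain ⟨m, hm1, hm0⟩ := Nat.chineseRemainder hN 1 0
  obtain ⟨j, rfl⟩ : N ∣ m := (Nat.modEq_zero_iff_dvd).1 hm0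
  set m := N * j with hm
  let L : SpecialLinearGroup (Fin 2) (ZMod ℓ) → E := fun g => (Function.surjInv hs g) ^ m
  have Leq : ∀ e, L (π e) = e ^ m := by
    intro e
    set f := Function.surjInv hs (π e) with hf
    have hfe : π f = π e := Function.surjInv_eq hs _
    have hk : π (f⁻¹ * e) = 1 := by rw [map_mul, map_inv, hfe, inv_mul_cancel]
    have : e = f * (f⁻¹ * e) := by group
    rw [this, (show Commute f (f⁻¹ * e) from (hcen _ hk f).symm).mul_pow, hm, pow_mul (f⁻¹ * e),
      hpow _ hk, one_pow, mul_one, ← this]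
  have Lpow : ∀ g n, L (g ^ n) = L g ^ n := by
    intro g n
    obtain ⟨e, rfl⟩ := hs g
    rw [← map_pow, Leq, Leq, pow_right_comm]
  have Lconj : ∀ e g, e * L g * e⁻¹ = L (π e * g * (π e)⁻¹) := by
    intro e g
    obtain ⟨f, rfl⟩ := hs g
    rw [← map_inv, ← map_mul, ← map_mul, Leq, Leq, conj_pow]
  have πL : ∀ g, g ^ ℓ = 1 → π (L g) = g := by
    intro g hg
    obtain ⟨e, rfl⟩ := hs g
    rw [Leq, map_pow]
    conv_rhs => rw [← pow_one (π e)]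
    rw [pow_eq_pow_iff_modEq]
    exact hm1.of_dvd (orderOf_dvd_of_pow_eq_one hg)
  have hu1 : ∀ r : ZMod ℓ, u r = u 1 ^ r.val := fun r => by simp [u_pow]
  have hv1 : ∀ r : ZMod ℓ, v r = v 1 ^ r.val := fun r => by simp [v_pow]
  let S : Stein (ZMod ℓ) E :=
    { x := fun r => L (u r)
      y := fun r => L (v r)
      w := fun t => L (u t) * L (v (-t⁻¹)) * L (u t)
      hx := fun a b => by rw [u_add, hu1 a, hu1 b, ← pow_add, Lpow, Lpow, Lpow, pow_add]
      hy := fun a b => by rw [v_add, hv1 a, hv1 b, ← pow_add, Lpow, Lpow, Lpow, pow_add]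
      hw := fun t => rfl
      wx := fun t r ht => by
        rw [← mul_inv_eq_iff_eq_mul, Lconj, map_mul, map_mul, πL _ (u_prime _), πL _ (v_prime _),
          wu ht]
      wy := fun t r ht => by
        rw [← mul_inv_eq_iff_eq_mul, Lconj, map_mul, map_mul, πL _ (u_prime _), πL _ (v_prime _),
          wv ht] }
  have πw : ∀ t, π (S.w t) = u t * v (-t⁻¹) * u t := by
    intro t
    change π (L (u t) * L (v (-t⁻¹)) * L (u t)) = _
    rw [map_mul, map_mul, πL _ (u_prime _), πL _ (v_prime _)]
  have πh : ∀ t (ht : t ≠ 0), π (S.h t) = D ℓ (Units.mk0 t ht) := by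
    intro t ht
    rw [Stein.h, map_mul, πw, πw, D_eq]
  have hc : ∀ s t : ZMod ℓ, s ≠ 0 → t ≠ 0 → S.h s * S.h t = S.h t * S.h s := by
    obtain ⟨γ, hγ⟩ := IsCyclic.exists_generator (α := (ZMod ℓ)ˣ)
    obtain ⟨e, he⟩ := hs (D ℓ γ)
    have : ∀ t : ZMod ℓ, t ≠ 0 → ∃ (k : ℤ) (c : E), π c = 1 ∧ S.h t = e ^ k * c := by
      intro t ht
      obtain ⟨k, hk⟩ := Subgroup.mem_zpowers_iff.1 (hγ (Units.mk0 t ht))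
      refine ⟨k, (e ^ k)⁻¹ * S.h t, ?_, by group⟩
      rw [map_mul, map_inv, map_zpow, he, πh t ht, ← hk, map_zpow, inv_mul_cancel]
    intro s t hs0 ht0
    obtain ⟨k, c, hc, h1⟩ := this s hs0
    obtain ⟨k', c', hc', h2⟩ := this t ht0
    have C1 : ∀ e, Commute c e := fun e => hcen c hc e
    have C2 : ∀ e, Commute c' e := fun e => hcen c' hc' e
    rw [h1, h2]
    exact (((Commute.refl e).zpow_zpow k k').mul_left (C1 _)).mul_right (C2 _).symm
  obtain ⟨σ, hσ1, hσ2⟩ := S.exists_hom hc (exists_pair h2) (nonsq_mul h2)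
  refine ⟨σ, fun g => ?_⟩
  refine gen ((π.comp σ).eqLocusM (MonoidHom.id _)) (fun r => ?_) ?_ g
  · change π (σ (u r)) = u r
    rw [hσ1]
    exact πL _ (u_prime r)
  · change π (σ w1) = w1
    rw [hσ2, πw, w1_eq, inv_one]

lemma hom_trivial (N : ℕ) (hN : ℓ.Coprime N) {A : Type*} [CommGroup A] (hA : ∀ a : A, a ^ N = 1)
    (φ : SpecialLinearGroup (Fin 2) (ZMod ℓ) →* A) (g) : φ g = 1 := by
  have hu : ∀ r, φ (u r) = 1 := fun r => by
    have h1 : φ (u r) ^ ℓ = 1 := by rw [← map_pow, u_prime, map_one]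
    have := Nat.dvd_gcd (orderOf_dvd_of_pow_eq_one h1) (orderOf_dvd_of_pow_eq_one (hA (φ (u r))))
    rw [hN.gcd_eq_one] at this
    exact orderOf_eq_one_iff.1 (Nat.dvd_one.1 this)
  refine gen (MonoidHom.mker φ) hu ?_ g
  rw [MonoidHom.mem_mker, w1_eq, v_eq]
  simp [hu]
end ext
end SLTwo
namespace SLTwo
open Matrix

/-- central extension attached to a cocycle -/
@[ext] structure CExt {G A : Type*} (c : G × G → A) where
  a : A
  g : G

namespace CExt
variable {G A : Type*} [Group G] [AddCommGroup A] (c : G × G → A)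

/-- group structure -/
def grp (hc : ∀ g h j, c (g * h, j) + c (g, h) = c (h, j) + c (g, h * j)) : Group (CExt c) :=
  letI : Mul (CExt c) := ⟨fun x y => ⟨x.a + y.a + c (x.g, y.g), x.g * y.g⟩⟩
  letI : One (CExt c) := ⟨⟨-c (1, 1), 1⟩⟩
  letI : Inv (CExt c) := ⟨fun x => ⟨-x.a - c (x.g⁻¹, x.g) - c (1, 1), x.g⁻¹⟩⟩
  Group.ofLeftAxioms
    (by
      intro x y z
      apply CExt.ext
      · change x.a + y.a + c (x.g, y.g) + z.a + c (x.g * y.g, z.g) =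
          x.a + (y.a + z.a + c (y.g, z.g)) + c (x.g, y.g * z.g)
        have := hc x.g y.g z.g
        rw [← sub_eq_zero] at this ⊢
        rw [← this]; abel
      · exact mul_assoc _ _ _)
    (by
      intro x
      have := hc 1 1 x.g
      simp only [one_mul, add_right_inj] at this
      apply CExt.ext
      · change -c (1, 1) + x.a + c (1, x.g) = x.a
        rw [← this]; abel
      · exact one_mul _)
    (by
      intro x
      apply CExt.ext
      · change -x.a - c (x.g⁻¹, x.g) - c (1, 1) + x.a + c (x.g⁻¹, x.g) = -c (1, 1)
        abel
      · exact inv_mul_cancel _)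
end CExt

variable {ℓ : ℕ} [Fact ℓ.Prime]

theorem cobound (h2 : ℓ ≠ 2) {A : Type*} [AddCommGroup A] (N : ℕ) (hN : ℓ.Coprime N)
    (hA : ∀ a : A, N • a = 0)
    (c : SpecialLinearGroup (Fin 2) (ZMod ℓ) × SpecialLinearGroup (Fin 2) (ZMod ℓ) → A)
    (hc : ∀ g h j, c (g * h, j) + c (g, h) = c (h, j) + c (g, h * j)) :
    ∃ f : SpecialLinearGroup (Fin 2) (ZMod ℓ) → A, ∀ s t, f s + f t - f (s * t) = c (s, t) := by
  letI := CExt.grp c hc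
  have mul_a : ∀ x y : CExt c, (x * y).a = x.a + y.a + c (x.g, y.g) := fun _ _ => rfl
  have mul_g : ∀ x y : CExt c, (x * y).g = x.g * y.g := fun _ _ => rfl
  have one_eq : (1 : CExt c) = ⟨-c (1, 1), 1⟩ := rfl
  have c1 : ∀ g, c (1, g) = c (1, 1) := fun g => by
    have := hc 1 1 g
    simp only [one_mul, add_right_inj] at this
    exact this.symm
  have c2 : ∀ g, c (g, 1) = c (1, 1) := fun g => by
    have := hc g 1 1
    simp only [mul_one, add_left_inj] at this
    exact this
  let π : CExt c →* SpecialLinearGroup (Fin 2) (ZMod ℓ) :=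
    { toFun := fun x => x.g, map_one' := rfl, map_mul' := fun _ _ => rfl }
  obtain ⟨σ, hσ⟩ := split h2 π (fun g => ⟨⟨0, g⟩, rfl⟩) N hN
    (by
      rintro ⟨a, g⟩ hk ⟨b, h⟩
      have hk : g = 1 := hk
      subst hk
      apply CExt.ext
      · rw [mul_a, mul_a]
        simp only [c1, c2]
        abel
      · rw [mul_g, mul_g]; simp)
    (by
      rintro ⟨a, g⟩ hk
      have hk : g = 1 := hk
      subst hk
      have key : ∀ n : ℕ, (⟨a, 1⟩ : CExt c) ^ n = ⟨n • (a + c (1, 1)) - c (1, 1), 1⟩ := by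
        intro n
        induction n with
        | zero => rw [pow_zero, one_eq]; simp
        | succ n ih =>
          rw [pow_succ, ih]
          apply CExt.ext
          · rw [mul_a, succ_nsmul]; generalize n • (a + c (1, 1)) = q; simp only; abel
          · rw [mul_g]; simp
      rw [key, hA, one_eq, zero_sub])
  have hσ : ∀ g, (σ g).g = g := hσ
  refine ⟨fun s => -(σ s).a, fun s t => ?_⟩
  simp only
  rw [map_mul, mul_a, hσ, hσ]
  abel

local notation "SL" => SpecialLinearGroup (Fin 2) (ZMod ℓ)

lemma mem_center (s : SL) : s ∈ Subgroup.center SL ↔ s = 1 ∨ s = -1 := by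
  rw [Matrix.SpecialLinearGroup.mem_center_iff]
  constructor
  · rintro ⟨r, hr, h⟩
    rw [Fintype.card_fin, sq_eq_one_iff] at hr
    rcases hr with rfl | rfl
    · left; apply Subtype.ext; rw [← h]; simp
    · right; apply Subtype.ext; rw [← h, map_neg, map_one]; rfl
  · rintro (rfl | rfl)
    · exact ⟨1, by simp, by simp⟩
    · exact ⟨-1, by simp, by rw [map_neg, map_one]; rfl⟩

lemma neg_ne (h2 : ℓ ≠ 2) : (-1 : SL) ≠ 1 := by
  intro h
  have h3 : ((-1 : SL) 0 0) = (1 : SL) 0 0 := by rw [h]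
  simp only [SpecialLinearGroup.coe_neg, SpecialLinearGroup.coe_one, Matrix.neg_apply,
    Matrix.one_apply_eq] at h3
  have hF : ringChar (ZMod ℓ) ≠ 2 := by rwa [ZMod.ringChar_zmod_n]
  exact Ring.neg_one_ne_one_of_char_ne_two hF h3

section main
variable {A : Type*} [AddCommGroup A]
local notation "PSL" => SL ⧸ Subgroup.center SL

lemma descend (c : PSL × PSL → A) (f : SL → A)
    (hf : ∀ s t : SL, f s + f t - f (s * t) = c (s, t)) (h1 : f (-1) = f 1) :
    ∃ F : PSL → A, ∀ g h, F h - F (g * h) + F g = c (g, h) := by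
  have hz : ∀ ζ ∈ Subgroup.center SL, f ζ = f 1 := by
    intro ζ hζ
    rcases (mem_center ζ).1 hζ with rfl | rfl
    · rfl
    · exact h1
  have hs : ∀ s t : SL, (s : PSL) = t → f s = f t := by
    intro s t hst
    have hm := QuotientGroup.eq.1 hst
    have e1 := hf s (s⁻¹ * t)
    have e2 := hf s 1
    have e3 : ((s⁻¹ * t : SL) : PSL) = (1 : SL) := by
      rw [QuotientGroup.mk_one]; exact (QuotientGroup.eq_one_iff _).2 hm
    rw [e3, ← e2, hz _ hm, mul_inv_cancel_left, mul_one] at e1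
    exact (sub_right_inj.1 e1).symm
  refine ⟨fun g => f g.out, fun g h => ?_⟩
  have e1 := hf g.out h.out
  have e2 : f (g * h).out = f (g.out * h.out) := hs _ _ (by
    rw [QuotientGroup.mk_mul, QuotientGroup.out_eq', QuotientGroup.out_eq', QuotientGroup.out_eq'])
  rw [QuotientGroup.out_eq', QuotientGroup.out_eq'] at e1
  simp only
  rw [← e1, e2]
  abel

lemma two_tors (c : PSL × PSL → A) (f : SL → A)
    (hf : ∀ s t : SL, f s + f t - f (s * t) = c (s, t)) : 2 • (f (-1) - f 1) = 0 := by
  have e0 : (((-1 : SL) : SL) : PSL) = (1 : SL) := by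
    rw [QuotientGroup.mk_one]; exact (QuotientGroup.eq_one_iff _).2 ((mem_center _).2 (Or.inr rfl))
  have e1 := hf (-1) (-1)
  have e2 := hf 1 1
  rw [e0, ← e2] at e1
  simp only [mul_neg, mul_one, neg_neg] at e1
  rw [← sub_eq_zero] at e1
  rw [← e1]
  abel

lemma exists_nontriv (h2 : ℓ ≠ 2) (N : ℕ) (hN : ℓ.Coprime N)
    (hA : ∀ a : A, N • a = 0) (z : A) (hz : z ≠ 0) (hz2 : z + z = 0) :
    ∃ c : PSL × PSL → A, (∀ g h j, c (g * h, j) + c (g, h) = c (h, j) + c (g, h * j)) ∧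
      ¬ ∃ F : PSL → A, ∀ g h, F h - F (g * h) + F g = c (g, h) := by
  classical
  let φ : SL → A := fun s => if s = 1 then 0 else z
  have φ1 : φ 1 = 0 := if_pos rfl
  have φm : φ (-1) = z := if_neg (neg_ne h2)
  have φmul : ∀ s ∈ Subgroup.center SL, ∀ t ∈ Subgroup.center SL, φ (s * t) = φ s + φ t := by
    intro s hs t ht
    rcases (mem_center s).1 hs with rfl | rfl <;> rcases (mem_center t).1 ht with rfl | rfl <;>
      simp [φ1, φm, hz2]
  let r : PSL → SL := fun g => g.out
  have hr : ∀ g : PSL, ((r g : SL) : PSL) = g := fun g => QuotientGroup.out_eq' g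
  let ε : PSL → PSL → SL := fun g h => r g * r h * (r (g * h))⁻¹
  have hε : ∀ g h, ε g h ∈ Subgroup.center SL := by
    intro g h
    rw [← QuotientGroup.eq_one_iff]
    simp only [ε, QuotientGroup.mk_mul, QuotientGroup.mk_inv, hr]
    group
  have hεr : ∀ g h, r g * r h = ε g h * r (g * h) := fun g h => by simp [ε]
  have hcomm : ∀ s ∈ Subgroup.center SL, ∀ t, t * s = s * t := fun s hs t =>
    Subgroup.mem_center_iff.1 hs t
  refine ⟨fun p => φ (ε p.1 p.2), ?_, ?_⟩
  · intro g h j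
    simp only
    rw [← φmul _ (hε _ _) _ (hε _ _), ← φmul _ (hε _ _) _ (hε _ _)]
    congr 1
    have e1 : r g * r h * r j = ε (g * h) j * ε g h * r (g * h * j) := by
      rw [hεr, mul_assoc, hεr, ← mul_assoc, hcomm _ (hε (g * h) j)]
    have e2 : r g * r h * r j = ε h j * ε g (h * j) * r (g * h * j) := by
      rw [mul_assoc, hεr, ← mul_assoc, hcomm _ (hε h j), mul_assoc, hεr, ← mul_assoc, mul_assoc g]
    exact mul_right_cancel (e1.symm.trans e2)
  · rintro ⟨F, hF⟩
    simp only at hF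
    let q : SL → SL := fun s => s * (r (s : PSL))⁻¹
    have hq : ∀ s, q s ∈ Subgroup.center SL := by
      intro s
      rw [← QuotientGroup.eq_one_iff]
      simp only [q, QuotientGroup.mk_mul, QuotientGroup.mk_inv, hr]
      group
    have hqr : ∀ s, s = q s * r (s : PSL) := fun s => by simp [q]
    have hqm : ∀ s t, q (s * t) = q s * q t * ε s t := by
      intro s t
      apply mul_right_cancel (b := r ((s * t : SL) : PSL))
      rw [← hqr, QuotientGroup.mk_mul, mul_assoc _ (ε _ _), ← hεr, mul_assoc, ← mul_assoc (q t),
        ← hcomm _ (hq t), mul_assoc (r _), ← hqr, ← mul_assoc, ← hqr]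
    let ψ : SL →* Multiplicative A := MonoidHom.mk' (fun s => Multiplicative.ofAdd (F s + φ (q s)))
      (by
        intro s t
        rw [← ofAdd_add, hqm, φmul _ (Subgroup.mul_mem _ (hq _) (hq _)) _ (hε _ _),
          φmul _ (hq _) _ (hq _), ← hF, QuotientGroup.mk_mul]
        congr 1
        abel)
    have hψ : ∀ s : SL, F (s : PSL) + φ (q s) = 0 := fun s =>
      hom_trivial (A := Multiplicative A) N hN (fun a => hA a) ψ s
    have e0 : (((-1 : SL) : SL) : PSL) = (1 : SL) := by
      rw [QuotientGroup.mk_one]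
      exact (QuotientGroup.eq_one_iff _).2 ((mem_center _).2 (Or.inr rfl))
    have h3 := hψ (-1)
    rw [← hψ 1, e0, add_right_inj] at h3
    have : q (-1) = -1 * q 1 := by simp only [q, e0, one_mul]
    rw [this, φmul _ ((mem_center _).2 (Or.inr rfl)) _ (hq _), φm] at h3
    exact hz (by simpa using h3)
end main

lemma zmod_tors {i : ℕ} (hi : 1 ≤ i) (d : ZMod (2 ^ i)) (hd : d ≠ 0) (h : 2 • d = 0) :
    d = ((2 ^ (i - 1) : ℕ) : ZMod (2 ^ i)) := by
  obtain ⟨k, rfl⟩ := Nat.exists_eq_add_of_le' hi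
  rw [Nat.add_sub_cancel]
  have h1 : ((2 * d.val : ℕ) : ZMod (2 ^ (k + 1))) = 0 := by
    push_cast
    rw [ZMod.natCast_zmod_val, ← h]
    simp
  have hlt := d.val_lt
  rw [ZMod.natCast_eq_zero_iff] at h1
  obtain ⟨j, hj⟩ : 2 ^ k ∣ d.val := by
    generalize d.val = e at h1
    rwa [pow_succ', Nat.mul_dvd_mul_iff_left (by norm_num)] at h1
  have h0 : d.val ≠ 0 := by simpa using hd
  have : j = 1 := by
    rw [hj, pow_succ] at hlt
    have := Nat.lt_of_mul_lt_mul_left hlt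
    have : j ≠ 0 := by rintro rfl; simp at hj; contradiction
    omega
  subst this
  rw [← ZMod.natCast_zmod_val d, hj, mul_one]

end SLTwo

open SLTwo in
/-- For every prime `ℓ ≥ 5` and every `i ≥ 1`, the second group
cohomology `H²(PSL₂(F_ℓ), ℤ/2^iℤ)` with trivial action is isomorphic to `ℤ/2ℤ`.
Here `PSL₂(F_ℓ)` is the quotient of `SL₂(F_ℓ)` by its center. -/
theorem h2_PSL2_zmod_two_pow (ℓ : ℕ) [Fact ℓ.Prime] (hℓ : 5 ≤ ℓ) (i : ℕ) (hi : 1 ≤ i) :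
    Nonempty
      ((groupCohomology.H2
        (Rep.trivial ℤ
          (Matrix.SpecialLinearGroup (Fin 2) (ZMod ℓ) ⧸
            Subgroup.center (Matrix.SpecialLinearGroup (Fin 2) (ZMod ℓ)))
          (ZMod (2 ^ i)))) ≃+ ZMod 2) := by
  have h2 : ℓ ≠ 2 := by omega
  have hN : ℓ.Coprime (2 ^ i) :=
    Nat.Coprime.pow_right _ ((Nat.coprime_primes Fact.out Nat.prime_two).2 h2)
  have hA : ∀ a : ZMod (2 ^ i), (2 ^ i) • a = 0 := fun a => by
    rw [nsmul_eq_mul, ZMod.natCast_self, zero_mul]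
  set R := Rep.trivial ℤ (Matrix.SpecialLinearGroup (Fin 2) (ZMod ℓ) ⧸
            Subgroup.center (Matrix.SpecialLinearGroup (Fin 2) (ZMod ℓ))) (ZMod (2 ^ i)) with hR
  have zne : ((2 ^ (i - 1) : ℕ) : ZMod (2 ^ i)) ≠ 0 := by
    rw [Ne, ZMod.natCast_eq_zero_iff, Nat.pow_dvd_pow_iff_le_right (by norm_num)]
    omega
  have zz : ((2 ^ (i - 1) : ℕ) : ZMod (2 ^ i)) + ((2 ^ (i - 1) : ℕ) : ZMod (2 ^ i)) = 0 := by
    rw [← Nat.cast_add, ← two_mul, ← pow_succ', Nat.sub_add_cancel hi, ZMod.natCast_self]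
  -- nonzero class
  have hex : ∃ x : groupCohomology.H2 R, x ≠ 0 := by
    obtain ⟨c, hc, hF⟩ := exists_nontriv (ℓ := ℓ) h2 (2 ^ i) hN hA _ zne zz
    refine ⟨groupCohomology.H2π R ⟨c, (groupCohomology.mem_cocycles₂_iff (A := R) c).2 hc⟩, ?_⟩
    rw [Ne, groupCohomology.H2π_eq_zero_iff]
    rintro ⟨F, h⟩
    exact hF ⟨F, fun g h' => congrFun h (g, h')⟩
  -- all nonzero classes agree
  have hlift : ∀ x : groupCohomology.cocycles₂ R,
      ∃ f : Matrix.SpecialLinearGroup (Fin 2) (ZMod ℓ) → ZMod (2 ^ i),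
        ∀ s t : Matrix.SpecialLinearGroup (Fin 2) (ZMod ℓ),
          f s + f t - f (s * t) = x.1 (s, t) := by
    intro x
    exact cobound h2 (2 ^ i) hN hA (fun p => x.1 (p.1, p.2))
      (fun g h j => (groupCohomology.mem_cocycles₂_iff (A := R) x.1).1 x.2 g h j)
  have hzero : ∀ (x : groupCohomology.cocycles₂ R)
      (f : Matrix.SpecialLinearGroup (Fin 2) (ZMod ℓ) → ZMod (2 ^ i)),
        (∀ s t : Matrix.SpecialLinearGroup (Fin 2) (ZMod ℓ),
          f s + f t - f (s * t) = x.1 (s, t)) → f (-1) = f 1 → groupCohomology.H2π R x = 0 := by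
    intro x f hf h1
    rw [groupCohomology.H2π_eq_zero_iff]
    obtain ⟨F, hF⟩ := descend x.1 f hf h1
    exact ⟨F, funext fun p => hF p.1 p.2⟩
  have huniq : ∀ x y : groupCohomology.H2 R, x ≠ 0 → y ≠ 0 → x = y := by
    intro x y
    induction x using groupCohomology.H2_induction_on with | h x => ?_
    induction y using groupCohomology.H2_induction_on with | h y => ?_
    intro hx hy
    obtain ⟨f, hf⟩ := hlift x
    obtain ⟨f', hf'⟩ := hlift y
    have d1 : f (-1) - f 1 ≠ 0 := fun h => hx (hzero x f hf (sub_eq_zero.1 h))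
    have d2 : f' (-1) - f' 1 ≠ 0 := fun h => hy (hzero y f' hf' (sub_eq_zero.1 h))
    have d3 := zmod_tors hi _ d1 (two_tors x.1 f hf)
    have d4 := zmod_tors hi _ d2 (two_tors y.1 f' hf')
    rw [← sub_eq_zero, ← map_sub]
    refine hzero (x - y) (fun s => f s - f' s) ?_ ?_
    · intro s t
      change _ = x.1 (s, t) - y.1 (s, t)
      rw [← hf, ← hf']
      ring
    · linear_combination d3 - d4
  obtain ⟨z, hz⟩ := hex
  have hcard : Nat.card (groupCohomology.H2 R) = 2 := by
    rw [Nat.card_eq_two_iff]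
    refine ⟨0, z, hz.symm, ?_⟩
    ext x
    simp only [Set.mem_insert_iff, Set.mem_singleton_iff, Set.mem_univ, iff_true]
    by_cases hx : x = 0
    · exact Or.inl hx
    · exact Or.inr (huniq x z hx hz)
  haveI : Fact (Nat.Prime 2) := ⟨Nat.prime_two⟩
  haveI : IsAddCyclic (groupCohomology.H2 R) := isAddCyclic_of_prime_card hcard
  exact ⟨((ZMod.ringEquivCongr hcard.symm).toAddEquiv.trans (zmodAddCyclicAddEquiv inferInstance)).symm⟩
end

section
/- Let a ≥ 3 be an integer and let H be a subgroup of the unit group (ℤ/2^aℤ)^*. If the composite of the inclusion H ↪ (ℤ/2^aℤ)^* with the reduction map (ℤ/2^aℤ)^* → (ℤ/8ℤ)^* is surjective, then H = (ℤ/2^aℤ)^*. In other words, a subgroup of (ℤ/2^aℤ)^* which surjects onto (ℤ/8ℤ)^* is necessarily the whole of (ℤ/2^aℤ)^*. -/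
/-- A subgroup of `(ℤ/2^aℤ)ˣ` (with `a ≥ 3`) which surjects onto
`(ℤ/8ℤ)ˣ` under the reduction map is the whole of `(ℤ/2^aℤ)ˣ`. -/
theorem subgroup_eq_top_of_surjects_onto_units_zmod_eight
    (a : ℕ) (ha : 3 ≤ a) (h8 : (8 : ℕ) ∣ 2 ^ a)
    (H : Subgroup (ZMod (2 ^ a))ˣ)
    (hsurj : ∀ y : (ZMod 8)ˣ, ∃ x ∈ H, ZMod.unitsMap h8 x = y) :
    H = ⊤ := by
  obtain ⟨n, rfl⟩ : ∃ n, a = n + 2 := ⟨a - 2, by omega⟩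
  have : NeZero (2 ^ (n + 2)) := ⟨by positivity⟩
  obtain ⟨x, hxH, hx⟩ := hsurj ⟨5, 5, by decide, by decide⟩
  obtain ⟨y, hyH, hy⟩ := hsurj ⟨3, 3, by decide, by decide⟩
  have hord : orderOf x = 2 ^ n := by
    have h1 : ((x : ZMod (2 ^ (n + 2))).val : ZMod 8) = 5 := by
      have := congrArg Units.val hx
      rw [ZMod.unitsMap_val] at this
      rw [ZMod.natCast_val]
      exact this
    have h2 : (x : ZMod (2 ^ (n + 2))).val % 8 = 5 := by
      have h3 : (((x : ZMod (2 ^ (n + 2))).val : ℕ) : ZMod 8) = ((5 : ℕ) : ZMod 8) := by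
        rw [h1]; rfl
      exact (ZMod.natCast_eq_natCast_iff _ _ 8).1 h3
    set v := (x : ZMod (2 ^ (n + 2))).val with hv
    have hxv : (x : ZMod (2 ^ (n + 2))) = 1 + 4 * ((2 * (v / 8 : ℕ) + 1 : ℤ) : ZMod (2 ^ (n + 2))) := by
      have e : v = 1 + 4 * (2 * (v / 8) + 1) := by omega
      have e2 : (x : ZMod (2 ^ (n + 2))) = (v : ZMod (2 ^ (n + 2))) := by
        rw [hv, ZMod.natCast_zmod_val]
      rw [e2]
      generalize v / 8 = q at e ⊢
      rw [e]
      push_cast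
      ring
    rw [← orderOf_units, hxv]
    exact ZMod.orderOf_one_add_four_mul _ ⟨_, rfl⟩ n
  have hle : Subgroup.zpowers x ≤ H := by simpa using hxH
  have hd : 2 ^ n ∣ Nat.card H := by
    have := Subgroup.card_dvd_of_le hle
    rwa [Nat.card_zpowers, hord] at this
  have hc : Nat.card (ZMod (2 ^ (n + 2)))ˣ = 2 ^ n * 2 := by
    rw [Nat.card_eq_fintype_card, ZMod.card_units_eq_totient,
      Nat.totient_prime_pow Nat.prime_two (by omega)]
    simp [pow_succ]
  have hd2 : Nat.card H ∣ 2 ^ n * 2 := hc ▸ Subgroup.card_subgroup_dvd_card H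
  obtain ⟨m, hm⟩ := hd
  rw [hm] at hd2
  have hm2 : m ∣ 2 := Nat.dvd_of_mul_dvd_mul_left (by positivity) hd2
  rcases (Nat.dvd_prime Nat.prime_two).1 hm2 with rfl | rfl
  · exfalso
    have heq : Subgroup.zpowers x = H := by
      apply Subgroup.eq_of_le_of_card_ge hle
      rw [Nat.card_zpowers, hord, hm, mul_one]
    rw [← heq] at hyH
    obtain ⟨k, rfl⟩ := Subgroup.mem_zpowers_iff.1 hyH
    rw [map_zpow, hx] at hy
    have hsq : (⟨5, 5, by decide, by decide⟩ : (ZMod 8)ˣ) ^ (2 : ℤ) = 1 := by decide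
    rcases Int.even_or_odd' k with ⟨j, rfl | rfl⟩
    · rw [zpow_mul, hsq, one_zpow] at hy
      revert hy; decide
    · rw [zpow_add, zpow_mul, hsq, one_zpow, zpow_one] at hy
      revert hy; decide
  · apply Subgroup.eq_top_of_card_eq
    rw [hm, hc]
end

section
/- Let ℓ ≥ 5 be a prime and let S be a subgroup of F_ℓ^*. Let Z_S = {λ·I : λ ∈ S} be the corresponding central subgroup of scalar matrices in GL₂(F_ℓ), and let G = GL₂(F_ℓ)/Z_S. Let S² = {s² : s ∈ S}. Then the determinant induces a well-defined surjective group homomorphism det : G → F_ℓ^*/S², its kernel equals the commutator subgroup of G, and hence the abelianization of G is isomorphic to F_ℓ^*/S² via the map induced by the determinant. -/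
open Matrix

/-- The central subgroup `Z_S = {s·I : s ∈ S}` of `GL₂(F_ℓ)` attached to a subgroup
`S ≤ F_ℓ^*`. -/
noncomputable def scalarSubgroup (ℓ : ℕ) [Fact ℓ.Prime] (S : Subgroup (ZMod ℓ)ˣ) :
    Subgroup (GL (Fin 2) (ZMod ℓ)) :=
  S.map (scalarGL ℓ)

instance (ℓ : ℕ) [Fact ℓ.Prime] (S : Subgroup (ZMod ℓ)ˣ) :
    (scalarSubgroup ℓ S).Normal := by
  constructor
  intro n hn g
  have hcen : n ∈ Subgroup.center (GL (Fin 2) (ZMod ℓ)) := by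
    obtain ⟨s, _, rfl⟩ := hn
    exact scalarGL_mem_center ℓ s
  have h := (Subgroup.mem_center_iff.mp hcen) g
  have : g * n * g⁻¹ = n := by rw [h, mul_assoc, mul_inv_cancel, mul_one]
  rwa [this]

/-- The subgroup `S² = {s² : s ∈ S}` of `F_ℓ^*`. -/
noncomputable def sqSubgroup (ℓ : ℕ) [Fact ℓ.Prime] (S : Subgroup (ZMod ℓ)ˣ) :
    Subgroup (ZMod ℓ)ˣ :=
  S.map (powMonoidHom 2 : (ZMod ℓ)ˣ →* (ZMod ℓ)ˣ)

instance (ℓ : ℕ) [Fact ℓ.Prime] (S : Subgroup (ZMod ℓ)ˣ) : (sqSubgroup ℓ S).Normal :=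
  Subgroup.normal_of_comm _

lemma aux_commutator_le {G H : Type*} [Group G] [Group H] (d : G →* H)
    (hc : ∀ a b : H, a * b = b * a) : commutator G ≤ d.ker := by
  rw [commutator_def, Subgroup.commutator_le]
  intro a _ b _
  rw [MonoidHom.mem_ker, map_commutatorElement, commutatorElement_eq_one_iff_mul_comm]
  exact hc _ _

lemma aux_abelianization_equiv {G H : Type*} [Group G] [Group H] (d : G →* H)
    (hc : ∀ a b : H, a * b = b * a) (hsurj : Function.Surjective d)
    (hker : d.ker = commutator G) :
    ∃ e : Abelianization G ≃* H, ∀ x : G, e (Abelianization.of x) = d x := by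
  let f : Abelianization G →* H := QuotientGroup.lift (commutator G) d
    (fun x hx => aux_commutator_le d hc hx)
  have hf : ∀ x, f (Abelianization.of x) = d x := fun x => rfl
  refine ⟨MulEquiv.ofBijective f ⟨?_, ?_⟩, hf⟩
  · rw [injective_iff_map_eq_one]
    intro a ha
    obtain ⟨x, rfl⟩ := QuotientGroup.mk_surjective a
    have hx : x ∈ d.ker := ha
    rw [hker] at hx
    exact (QuotientGroup.eq_one_iff x).2 hx
  · intro y
    obtain ⟨x, rfl⟩ := hsurj y
    exact ⟨Abelianization.of x, hf x⟩

/-- Let `ℓ ≥ 5` be a prime and `S ≤ F_ℓ^*` a subgroup, `Z_S` the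
corresponding central subgroup of scalar matrices, and `G = GL₂(F_ℓ)/Z_S`. Then the
determinant induces a well-defined surjective group homomorphism `G → F_ℓ^*/S²`, its
kernel equals the commutator subgroup of `G`, and hence the abelianization of `G` is
isomorphic to `F_ℓ^*/S²` via the map induced by the determinant. -/
theorem det_induces_abelianization_of_GL_quotient
    (ℓ : ℕ) [Fact ℓ.Prime] (h5 : 5 ≤ ℓ) (S : Subgroup (ZMod ℓ)ˣ) :
    ∃ d : (GL (Fin 2) (ZMod ℓ) ⧸ scalarSubgroup ℓ S) →* ((ZMod ℓ)ˣ ⧸ sqSubgroup ℓ S),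
      (∀ A : GL (Fin 2) (ZMod ℓ),
        d (QuotientGroup.mk A) = QuotientGroup.mk (Matrix.GeneralLinearGroup.det A)) ∧
      Function.Surjective d ∧
      d.ker = commutator (GL (Fin 2) (ZMod ℓ) ⧸ scalarSubgroup ℓ S) ∧
      ∃ e : Abelianization (GL (Fin 2) (ZMod ℓ) ⧸ scalarSubgroup ℓ S) ≃*
          ((ZMod ℓ)ˣ ⧸ sqSubgroup ℓ S),
        ∀ x : GL (Fin 2) (ZMod ℓ) ⧸ scalarSubgroup ℓ S,
          e (Abelianization.of x) = d x := by
  have hdet : ∀ s : (ZMod ℓ)ˣ, Matrix.GeneralLinearGroup.det (scalarGL ℓ s) = s ^ 2 := by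
    intro s
    ext
    simp [scalarGL, Matrix.det_fin_two, pow_two]
  have hle : scalarSubgroup ℓ S ≤
      (sqSubgroup ℓ S).comap (Matrix.GeneralLinearGroup.det : GL (Fin 2) (ZMod ℓ) →* _) := by
    rintro _ ⟨s, hs, rfl⟩
    exact ⟨s, hs, (hdet s).symm⟩
  let d := QuotientGroup.map (scalarSubgroup ℓ S) (sqSubgroup ℓ S)
    (Matrix.GeneralLinearGroup.det : GL (Fin 2) (ZMod ℓ) →* _) hle
  have hcomm : ∀ a b : (ZMod ℓ)ˣ ⧸ sqSubgroup ℓ S, a * b = b * a := by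
    intro a b
    obtain ⟨a, rfl⟩ := QuotientGroup.mk_surjective a
    obtain ⟨b, rfl⟩ := QuotientGroup.mk_surjective b
    rw [← QuotientGroup.mk_mul, mul_comm, QuotientGroup.mk_mul]
  have hd : ∀ A : GL (Fin 2) (ZMod ℓ),
      d (QuotientGroup.mk A) = QuotientGroup.mk (Matrix.GeneralLinearGroup.det A) :=
    fun A => rfl
  have hsurj : Function.Surjective d := by
    intro y
    obtain ⟨u, rfl⟩ := QuotientGroup.mk_surjective y
    refine ⟨QuotientGroup.mk (Matrix.GeneralLinearGroup.mkOfDetNeZero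
      !![(u : ZMod ℓ), 0; 0, 1] (by simp)), ?_⟩
    rw [hd]
    congr 1
    ext
    simp [Matrix.GeneralLinearGroup.mkOfDetNeZero]
  have hSL : commutator (Matrix.SpecialLinearGroup (Fin 2) (ZMod ℓ)) = ⊤ := by
    have key : ∀ n : ℕ, 0 < n → n < ℓ → ((n : ℕ) : ZMod ℓ) ≠ 0 := by
      intro n h0 hn h
      rw [ZMod.natCast_eq_zero_iff] at h
      exact absurd (Nat.le_of_dvd h0 h) (by omega)
    refine Matrix.SL2.commutator_eq_top (a := (2 : ZMod ℓ)) ?_ ?_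
    · exact_mod_cast key 2 (by norm_num) (by omega)
    · intro h
      apply key 3 (by norm_num) (by omega)
      push_cast
      linear_combination h
  have hker : d.ker = commutator (GL (Fin 2) (ZMod ℓ) ⧸ scalarSubgroup ℓ S) := by
    apply le_antisymm
    · intro x hx
      obtain ⟨A, rfl⟩ := QuotientGroup.mk_surjective x
      rw [MonoidHom.mem_ker, hd, QuotientGroup.eq_one_iff] at hx
      obtain ⟨s, hs, hsA⟩ := hx
      have hsA' : s ^ 2 = Matrix.GeneralLinearGroup.det A := hsA
      have h1 : Matrix.GeneralLinearGroup.det (A * (scalarGL ℓ s)⁻¹) = 1 := by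
        rw [map_mul, map_inv, hdet, hsA', mul_inv_cancel]
      let B : Matrix.SpecialLinearGroup (Fin 2) (ZMod ℓ) :=
        ⟨(A * (scalarGL ℓ s)⁻¹ : GL (Fin 2) (ZMod ℓ)).val, congrArg Units.val h1⟩
      have hB : Matrix.SpecialLinearGroup.toGL B = A * (scalarGL ℓ s)⁻¹ := Units.ext rfl
      let f := (QuotientGroup.mk' (scalarSubgroup ℓ S)).comp
        (Matrix.SpecialLinearGroup.toGL (n := Fin 2) (R := ZMod ℓ))
      have hf : f B = QuotientGroup.mk A := by
        change QuotientGroup.mk (Matrix.SpecialLinearGroup.toGL B) = _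
        rw [hB, QuotientGroup.eq]
        have hmem : scalarGL ℓ s ∈ scalarSubgroup ℓ S := ⟨s, hs, rfl⟩
        simpa using hmem
      rw [← hf]
      have hm : f B ∈ (commutator (Matrix.SpecialLinearGroup (Fin 2) (ZMod ℓ))).map f :=
        ⟨B, by rw [hSL]; trivial, rfl⟩
      rw [commutator_def, Subgroup.map_commutator] at hm
      rw [commutator_def]
      exact Subgroup.commutator_mono le_top le_top hm
    · exact aux_commutator_le d hcomm
  exact ⟨d, hd, hsurj, hker, aux_abelianization_equiv d hcomm hsurj hker⟩
end
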